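/- For every integer n ≥ 3, the sum of divisors satisfies σ(n) < e^γ · n · log log n + n / (log log n), where γ is the Euler–Mascheroni constant. -/

import Mathlib

open Filter Topology Set Metric
open scoped ArithmeticFunction.vonMangoldt

theorem exists_factor_zeros {f : ℂ → ℂ} (hf : Differentiable ℂ f) {c : ℂ} (hc : f c ≠ 0)
    (S : Finset ℂ) : ∃ g : ℂ → ℂ, Differentiable ℂ g ∧
      (∀ z, f z = (∏ α ∈ S, (z - α) ^ analyticOrderNatAt f α) * g z) ∧ ∀ α ∈ S, g α ≠ 0 := by
  classical
  have hfa : ∀ z, AnalyticAt ℂ f z := fun z => hf.analyticAt z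
  have htop : ∀ z, analyticOrderAt f z ≠ ⊤ := by
    intro z hz
    rw [analyticOrderAt_eq_top] at hz
    have := AnalyticOnNhd.eqOn_zero_of_preconnected_of_eventuallyEq_zero
      (fun z _ => hfa z : AnalyticOnNhd ℂ f univ) isPreconnected_univ (mem_univ z) hz
    exact hc (this (mem_univ c))
  induction S using Finset.induction_on with
  | empty => exact ⟨f, hf, by simp, by simp⟩
  | insert a S ha ih =>
    obtain ⟨g, hg, hfg, hgS⟩ := ih
    set P : ℂ → ℂ := fun z => ∏ α ∈ S, (z - α) ^ analyticOrderNatAt f α with hP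
    have hPa : AnalyticAt ℂ P a := by
      apply Differentiable.analyticAt
      simp only [hP]; fun_prop
    have hPne : P a ≠ 0 := by
      simp only [hP]
      refine Finset.prod_ne_zero_iff.2 fun α hα => pow_ne_zero _ (sub_ne_zero.2 ?_)
      rintro rfl; exact ha hα
    have hga := hg.analyticAt a
    have hord : analyticOrderAt g a = analyticOrderAt f a := by
      have : f = P * g := funext hfg
      rw [this, analyticOrderAt_mul hPa hga, hPa.analyticOrderAt_eq_zero.2 hPne, zero_add]
    have hgt : analyticOrderAt g a ≠ ⊤ := hord ▸ htop a
    obtain ⟨h, hha, hh0, hgh⟩ := (hga.analyticOrderAt_ne_top).1 hgt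
    have hnat : analyticOrderNatAt g a = analyticOrderNatAt f a := by
      simp [analyticOrderNatAt, hord]
    rw [hnat] at hgh
    set m := analyticOrderNatAt f a
    refine ⟨Function.update (fun z => g z / (z - a) ^ m) a (h a), ?_, ?_, ?_⟩
    · intro z
      by_cases hz : z = a
      · subst hz
        refine (hha.differentiableAt).congr_of_eventuallyEq ?_
        filter_upwards [hgh] with w hw
        by_cases hwa : w = z
        · subst hwa; simp
        · rw [Function.update_of_ne hwa, hw, smul_eq_mul, mul_div_cancel_left₀]
          exact pow_ne_zero _ (sub_ne_zero.2 hwa)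
      · have : (Function.update (fun z => g z / (z - a) ^ m) a (h a)) =ᶠ[𝓝 z]
            (fun z => g z / (z - a) ^ m) := by
          filter_upwards [isOpen_ne.mem_nhds hz] with w hw
          rw [Function.update_of_ne hw]
        refine DifferentiableAt.congr_of_eventuallyEq ?_ this
        exact (hg z).div (by fun_prop) (pow_ne_zero _ (sub_ne_zero.2 hz))
    · intro z
      rw [Finset.prod_insert ha]
      by_cases hz : z = a
      · subst hz
        have e := hgh.self_of_nhds
        simp only [smul_eq_mul] at e
        rw [hfg z, e, Function.update_self]
        change _ = (z - z) ^ m * _ * _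
        ring
      · rw [Function.update_of_ne hz, hfg z]
        have : (z - a) ^ m ≠ 0 := pow_ne_zero _ (sub_ne_zero.2 hz)
        change _ = (z - a) ^ m * _ * _
        field_simp
    · intro α hα
      rcases Finset.mem_insert.1 hα with rfl | hα
      · simpa using hh0
      · have : α ≠ a := fun h => ha (h ▸ hα)
        rw [Function.update_of_ne this]
        exact div_ne_zero (hgS α hα) (pow_ne_zero _ (sub_ne_zero.2 this))

theorem finite_zeros_closedBall {f : ℂ → ℂ} (hf : Differentiable ℂ f) {c : ℂ} (hc : f c ≠ 0)
    (R : ℝ) : {z | f z = 0 ∧ ‖z‖ ≤ R}.Finite := by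
  by_contra hinf
  obtain ⟨x, -, hx⟩ := Set.Infinite.exists_accPt_of_subset_isCompact hinf
    (isCompact_closedBall (0 : ℂ) R) (fun z hz => by simpa using hz.2)
  have hfr : ∃ᶠ z in 𝓝[≠] x, f z = 0 := by
    rw [accPt_iff_frequently_nhdsNE] at hx
    exact hx.mono fun z hz => hz.1
  have := AnalyticOnNhd.eqOn_zero_of_preconnected_of_frequently_eq_zero
      (fun z _ => hf.analyticAt z : AnalyticOnNhd ℂ f univ) isPreconnected_univ (mem_univ x) hfr
  exact hc (this (mem_univ c))

theorem norm_logDeriv_le_of_norm_le {g : ℂ → ℂ} {c : ℂ} {r M : ℝ} (hr : 0 < r) (hM : 0 < M)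
    (hg : DifferentiableOn ℂ g (ball c r)) (h0 : ∀ z ∈ ball c r, g z ≠ 0)
    (hb : ∀ z ∈ ball c r, ‖g z‖ ≤ Real.exp M * ‖g c‖) :
    ∀ z ∈ ball c (r / 4), ‖logDeriv g z‖ ≤ 8 * M / r := by
  have hcb : c ∈ ball c r := mem_ball_self hr
  have hld : DifferentiableOn ℂ (logDeriv g) (ball c r) := by
    intro z hz
    have hga : AnalyticAt ℂ g z := hg.analyticAt (isOpen_ball.mem_nhds hz)
    exact (hga.deriv.differentiableAt.div hga.differentiableAt (h0 z hz)).differentiableWithinAt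
  obtain ⟨h, hh0, hh⟩ := (hld.isExactOn_ball).with_val_at c 0
  have hhd : DifferentiableOn ℂ h (ball c r) := fun z hz =>
    (hh z hz).differentiableAt.differentiableWithinAt
  have hexp : ∀ z ∈ ball c r, g z = g c * Complex.exp (h z) := by
    have hder : ∀ z ∈ ball c r, HasDerivAt (fun z => g z * Complex.exp (-h z)) 0 z := by
      intro z hz
      have hga : HasDerivAt g (deriv g z) z :=
        (hg.differentiableAt (isOpen_ball.mem_nhds hz)).hasDerivAt
      have hm := hga.mul ((hh z hz).neg.cexp)
      have hgz := h0 z hz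
      have e : (deriv g z * Complex.exp ((-h) z) +
          g z * (Complex.exp ((-h) z) * -logDeriv g z)) = 0 := by
        rw [logDeriv_apply]; field_simp; ring
      rw [e] at hm
      exact hm
    intro z hz
    have hconst := (convex_ball c r).is_const_of_fderivWithin_eq_zero (𝕜 := ℂ)
      (f := fun z => g z * Complex.exp (-h z))
      (fun z hz => (hder z hz).differentiableAt.differentiableWithinAt)
      (fun z hz => by
        rw [fderivWithin_of_isOpen isOpen_ball hz]
        have := (hder z hz).hasFDerivAt.fderiv
        rw [this]; ext; simp) hz hcb
    rw [hh0, neg_zero, Complex.exp_zero, mul_one] at hconst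
    rw [← hconst, mul_assoc, ← Complex.exp_add]; simp
  have hre : ∀ z ∈ ball c r, (h z).re ≤ M := by
    intro z hz
    have h1 := hb z hz
    rw [hexp z hz, norm_mul, Complex.norm_exp, mul_comm] at h1
    have h2 : 0 < ‖g c‖ := norm_pos_iff.2 (h0 c hcb)
    exact Real.exp_le_exp.1 (le_of_mul_le_mul_right h1 h2)
  have hbc : ∀ z ∈ closedBall c (r / 2), ‖h z‖ ≤ 2 * M := by
    intro z hz
    have hz' : ‖z - c‖ ≤ r / 2 := by simpa [dist_eq_norm] using hz
    have := Complex.borelCaratheodory_zero (f := fun w => h (c + w)) (R := r) (M := M)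
      (z := z - c) hM
      (by
        intro w hw
        have hw' : c + w ∈ ball c r := by simpa using hw
        have := (hhd.differentiableAt (isOpen_ball.mem_nhds hw'))
        exact (this.comp w (by fun_prop : DifferentiableAt ℂ (fun w => c + w) w)).differentiableWithinAt)
      (by
        intro w hw
        exact hre _ (by simpa using hw))
      hr (by simp; linarith) (by simpa using hh0)
    simp only [add_sub_cancel] at this
    refine this.trans ?_
    rw [div_le_iff₀ (by linarith)]
    nlinarith
  intro z hz
  have hz' : ‖z - c‖ < r / 4 := by simpa [dist_eq_norm] using hz
  have hzr : z ∈ ball c r := by simp [dist_eq_norm]; linarith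
  rw [← (hh z hzr).deriv]
  have := Complex.norm_deriv_le_of_forall_mem_sphere_norm_le (c := z) (R := r / 4) (C := 2 * M)
    (f := h) (by linarith) ?_ ?_
  · refine this.trans (le_of_eq ?_); field_simp; ring
  · have hsub : closedBall z (r / 4) ⊆ ball c r := by
      intro w hw
      have : ‖w - z‖ ≤ r / 4 := by simpa [dist_eq_norm] using hw
      have h3 : ‖w - c‖ ≤ ‖w - z‖ + ‖z - c‖ := by
        simpa using norm_add_le (w - z) (z - c)
      simp [dist_eq_norm]; linarith
    refine DifferentiableOn.diffContOnCl ?_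
    rw [closure_ball _ (by linarith : r / 4 ≠ 0)]
    exact hhd.mono hsub
  · intro w hw
    apply hbc
    have : ‖w - z‖ = r / 4 := by simpa [dist_eq_norm] using hw
    have h3 : ‖w - c‖ ≤ ‖w - z‖ + ‖z - c‖ := by
        simpa using norm_add_le (w - z) (z - c)
    simp [dist_eq_norm]; linarith

theorem analyticOrderNatAt_neg_of_even {f : ℂ → ℂ} (heven : ∀ z, f (-z) = f z) (α : ℂ) :
    analyticOrderNatAt f (-α) = analyticOrderNatAt f α := by
  have h := analyticOrderAt_comp_of_deriv_ne_zero (f := f) (g := fun z : ℂ => -z) (z₀ := α)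
    (by fun_prop) (by simp)
  have h2 : f ∘ (fun z : ℂ => -z) = f := funext heven
  rw [h2] at h
  simp [analyticOrderNatAt, h]

theorem logDeriv_neg_of_even {f : ℂ → ℂ} (hf : Differentiable ℂ f) (heven : ∀ z, f (-z) = f z)
    (z : ℂ) : logDeriv f (-z) = - logDeriv f z := by
  have h := logDeriv_comp (f := f) (g := fun z : ℂ => -z) (x := z) (hf _) (by fun_prop)
  have h2 : f ∘ (fun z : ℂ => -z) = f := funext heven
  rw [h2] at h
  rw [h]; simp

theorem norm_logDeriv_sub_sum_zeros_le {f : ℂ → ℂ} (hf : Differentiable ℂ f)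
    (heven : ∀ z, f (-z) = f z) {z : ℂ} (hz : f z ≠ 0) {R N : ℝ} (hR : 10 * (‖z‖ + 1) ≤ R)
    (hN : 0 ≤ N) (hgrow : ∀ w, ‖w‖ ≤ 2 * R + 3 * ‖z‖ → ‖f w‖ ≤ Real.exp N) :
    ‖logDeriv f z - ∑ α ∈ (finite_zeros_closedBall hf hz R).toFinset,
      (analyticOrderNatAt f α : ℂ) * (z / (z ^ 2 - α ^ 2))‖ ≤
      64 * (N + |Real.log ‖f z‖| + 1) * ‖z‖ / (R - ‖z‖) ^ 2 := by
  set S := (finite_zeros_closedBall hf hz R).toFinset with hS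
  have memS : ∀ α, α ∈ S ↔ f α = 0 ∧ ‖α‖ ≤ R := fun α => by simp [hS]
  set M := N + |Real.log ‖f z‖| + 1 with hMdef
  have hM : 0 < M := by positivity
  have hz0 := norm_nonneg z
  have hfz : 0 < ‖f z‖ := norm_pos_iff.2 hz
  obtain ⟨g, hg, hfg, hgS⟩ := exists_factor_zeros hf hz S
  set P : ℂ → ℂ := fun w => ∏ α ∈ S, (w - α) ^ analyticOrderNatAt f α with hP
  have hPz : P z ≠ 0 := fun h => hz (by rw [hfg z]; change P z * _ = 0; rw [h, zero_mul])
  have hgz : g z ≠ 0 := fun h => hz (by rw [hfg z, h, mul_zero])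
  have hg0 : ∀ w, ‖w‖ ≤ R → g w ≠ 0 := by
    intro w hw h
    have : f w = 0 := by rw [hfg w, h, mul_zero]
    exact hgS w ((memS w).2 ⟨this, hw⟩) h
  have hbound : ∀ w ∈ closedBall z (2 * (R + ‖z‖)), ‖g w‖ ≤ Real.exp M * ‖g z‖ := by
    have hne : 2 * (R + ‖z‖) ≠ 0 := by linarith
    intro w hw
    refine Complex.norm_le_of_forall_mem_frontier_norm_le (U := ball z (2 * (R + ‖z‖)))
      isBounded_ball hg.diffContOnCl ?_ (by rwa [closure_ball _ hne])
    intro w hw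
    rw [frontier_ball _ hne, mem_sphere, dist_eq_norm] at hw
    have hPP : ‖P z‖ ≤ ‖P w‖ := by
      simp only [hP, norm_prod, norm_pow]
      refine Finset.prod_le_prod (fun _ _ => by positivity) fun α hα => ?_
      refine pow_le_pow_left₀ (norm_nonneg _) ?_ _
      have h1 : ‖w - z‖ ≤ ‖w - α‖ + ‖z - α‖ := by
        have := norm_sub_le (w - α) (z - α); simpa using this
      have h2 : ‖z - α‖ ≤ ‖z‖ + ‖α‖ := norm_sub_le _ _
      have h3 := ((memS α).1 hα).2
      linarith
    have hw2 : ‖w‖ ≤ 2 * R + 3 * ‖z‖ := by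
      have : ‖w‖ ≤ ‖w - z‖ + ‖z‖ := by simpa using norm_add_le (w - z) z
      linarith
    have e1 : ‖f w‖ = ‖P w‖ * ‖g w‖ := by rw [hfg w, norm_mul]
    have e2 : ‖f z‖ = ‖P z‖ * ‖g z‖ := by rw [hfg z, norm_mul]
    have h3 : ‖P z‖ * ‖g w‖ ≤ Real.exp N :=
      (mul_le_mul_of_nonneg_right hPP (norm_nonneg _)).trans (e1 ▸ hgrow w hw2)
    have h4 : Real.exp N ≤ Real.exp M * ‖f z‖ := by
      rw [show Real.exp M * ‖f z‖ = Real.exp (M + Real.log ‖f z‖) by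
        rw [Real.exp_add M, Real.exp_log hfz]]
      apply Real.exp_le_exp.2
      have := neg_abs_le (Real.log ‖f z‖)
      linarith
    have h5 : ‖P z‖ * ‖g w‖ ≤ ‖P z‖ * (Real.exp M * ‖g z‖) := by
      calc _ ≤ _ := h3
        _ ≤ _ := h4
        _ = _ := by rw [e2]; ring
    exact le_of_mul_le_mul_left h5 (norm_pos_iff.2 hPz)
  set r := R - ‖z‖ with hr
  have hrpos : 0 < r := by linarith
  have hsub : ∀ w ∈ ball z r, ‖w‖ < R := by
    intro w hw
    rw [mem_ball, dist_eq_norm] at hw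
    have : ‖w‖ ≤ ‖w - z‖ + ‖z‖ := by simpa using norm_add_le (w - z) z
    linarith
  have hG := norm_logDeriv_le_of_norm_le hrpos hM hg.differentiableOn
    (fun w hw => hg0 w (hsub w hw).le)
    (fun w hw => hbound w (by
      rw [mem_ball] at hw; rw [mem_closedBall]; linarith))
  have hsub' : ball z (r / 4) ⊆ ball z r := ball_subset_ball (by linarith)
  have hGd : DifferentiableOn ℂ (logDeriv g) (ball z (r / 4)) := by
    intro w hw
    have hga : AnalyticAt ℂ g w := hg.analyticAt w
    exact (hga.deriv.differentiableAt.div hga.differentiableAt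
      (hg0 w (hsub w (hsub' hw)).le)).differentiableWithinAt
  have hdist := Complex.dist_le_div_mul_dist_of_mapsTo_ball (R₂ := 16 * M / r) (z := -z) hGd
    (by
      intro w hw
      rw [mem_closedBall, dist_eq_norm]
      have h1 := hG w hw
      have h2 := hG z (mem_ball_self (by linarith))
      calc _ ≤ _ := norm_sub_le _ _
        _ ≤ _ := add_le_add h1 h2
        _ = _ := by ring)
    (by
      rw [mem_ball, dist_eq_norm]
      have : ‖-z - z‖ = 2 * ‖z‖ := by
        rw [show -z - z = -(2 * z) by ring, norm_neg, norm_mul]; simp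
      linarith)
  have hfnz : f (-z) ≠ 0 := by rwa [heven]
  have key : ∀ w, f w ≠ 0 → logDeriv f w =
      ∑ α ∈ S, (analyticOrderNatAt f α : ℂ) * (1 / (w - α)) + logDeriv g w := by
    intro w hw
    have hPw : P w ≠ 0 := fun h => hw (by rw [hfg w]; change P w * _ = 0; rw [h, zero_mul])
    have hgw : g w ≠ 0 := fun h => hw (by rw [hfg w, h, mul_zero])
    have hPd : DifferentiableAt ℂ P w := by simp only [hP]; fun_prop
    have e : f = fun w => P w * g w := funext hfg
    have h1 : logDeriv f w = logDeriv P w + logDeriv g w := by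
      conv_lhs => rw [e]
      exact logDeriv_mul w hPw hgw hPd (hg w)
    rw [h1]
    congr 1
    have hne : ∀ α ∈ S, w - α ≠ 0 := by
      intro α hα h
      apply hw
      rw [sub_eq_zero.1 h]; exact ((memS α).1 hα).1
    rw [hP, logDeriv_prod (𝕜 := ℂ) (f := fun α w => (w - α) ^ analyticOrderNatAt f α)
      (fun α hα => pow_ne_zero _ (hne α hα)) (fun α _ => by fun_prop)]
    refine Finset.sum_congr rfl fun α _ => ?_
    rw [logDeriv_fun_pow (f := fun w => w - α) (by fun_prop), logDeriv_apply]
    simp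
  have hsym : ∑ α ∈ S, (analyticOrderNatAt f α : ℂ) * (1 / (-z - α)) =
      -∑ α ∈ S, (analyticOrderNatAt f α : ℂ) * (1 / (z - -α)) := by
    rw [← Finset.sum_neg_distrib]
    refine Finset.sum_congr rfl fun α _ => ?_
    rw [show -z - α = -(z - -α) by ring, one_div, one_div, inv_neg]; ring
  have hsym2 : ∑ α ∈ S, (analyticOrderNatAt f α : ℂ) * (1 / (z - -α)) =
      ∑ α ∈ S, (analyticOrderNatAt f α : ℂ) * (1 / (z - α)) := by
    refine Finset.sum_bij' (fun α _ => -α) (fun α _ => -α) ?_ ?_ (by simp) (by simp) ?_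
    · intro α hα; rw [memS] at hα ⊢; rwa [heven, norm_neg]
    · intro α hα; rw [memS] at hα ⊢; rwa [heven, norm_neg]
    · intro α _; rw [analyticOrderNatAt_neg_of_even heven]
  have hodd : logDeriv g (-z) = - logDeriv g z := by
    have h1 := key z hz
    have h2 := key (-z) hfnz
    rw [logDeriv_neg_of_even hf heven, hsym, hsym2, h1] at h2
    linear_combination -h2
  have hsum : ∑ α ∈ S, (analyticOrderNatAt f α : ℂ) * (z / (z ^ 2 - α ^ 2)) =
      ∑ α ∈ S, (analyticOrderNatAt f α : ℂ) * (1 / (z - α)) := by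
    have h2 : ∑ α ∈ S, (analyticOrderNatAt f α : ℂ) * (z / (z ^ 2 - α ^ 2)) =
      (1 / 2) * (∑ α ∈ S, (analyticOrderNatAt f α : ℂ) * (1 / (z - α)) +
       ∑ α ∈ S, (analyticOrderNatAt f α : ℂ) * (1 / (z - -α))) := by
      rw [← Finset.sum_add_distrib, Finset.mul_sum]
      refine Finset.sum_congr rfl fun α hα => ?_
      have h1 : z - α ≠ 0 := by
        intro h; apply hz; rw [sub_eq_zero.1 h]; exact ((memS α).1 hα).1
      have h2 : z + α ≠ 0 := by
        intro h; apply hz; rw [eq_neg_of_add_eq_zero_left h, heven]; exact ((memS α).1 hα).1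
      have h3 : z ^ 2 - α ^ 2 ≠ 0 := by
        rw [sq_sub_sq]; exact mul_ne_zero h2 h1
      rw [sub_neg_eq_add]
      field_simp
      ring
    rw [h2, hsym2]; ring
  have hfin : logDeriv f z - ∑ α ∈ S, (analyticOrderNatAt f α : ℂ) * (z / (z ^ 2 - α ^ 2)) =
      logDeriv g z := by rw [hsum, key z hz]; ring
  rw [hfin]
  rw [hodd, dist_eq_norm, dist_eq_norm, show -logDeriv g z - logDeriv g z = -(2 * logDeriv g z) by ring,
    show -z - z = -(2 * z) by ring, norm_neg, norm_neg, norm_mul, norm_mul] at hdist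
  simp only [Complex.norm_ofNat] at hdist
  calc ‖logDeriv g z‖ ≤ 16 * M / r / (r / 4) * ‖z‖ := by linarith
    _ = _ := by field_simp; ring

theorem tendsto_sum_zeros_logDeriv {f : ℂ → ℂ} (hf : Differentiable ℂ f)
    (heven : ∀ z, f (-z) = f z) {C : ℝ} (hC : 0 ≤ C)
    (hgrow : ∀ w, ‖f w‖ ≤ Real.exp (C * (1 + ‖w‖) ^ (3 / 2 : ℝ))) {z : ℂ} (hz : f z ≠ 0) :
    Tendsto (fun R : ℝ => ∑ α ∈ (finite_zeros_closedBall hf hz R).toFinset,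
      (analyticOrderNatAt f α : ℂ) * (z / (z ^ 2 - α ^ 2))) atTop (𝓝 (logDeriv f z)) := by
  rw [tendsto_iff_norm_sub_tendsto_zero]
  set D := |Real.log ‖f z‖| + 1 with hD
  have hbd : ∀ᶠ R : ℝ in atTop, ‖∑ α ∈ (finite_zeros_closedBall hf hz R).toFinset,
      (analyticOrderNatAt f α : ℂ) * (z / (z ^ 2 - α ^ 2)) - logDeriv f z‖ ≤
      64 * ‖z‖ * (8 * C + D) * 4 * R ^ (-(1 / 2) : ℝ) := by
    filter_upwards [eventually_ge_atTop (10 * (‖z‖ + 1))] with R hR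
    have hz0 := norm_nonneg z
    have hR0 : 0 < R := by linarith
    rw [norm_sub_rev]
    have hD0 : 0 ≤ D := by positivity
    have hb := norm_logDeriv_sub_sum_zeros_le hf heven hz hR
      (N := C * (4 * R) ^ (3 / 2 : ℝ)) (by positivity) (by
        intro w hw
        refine (hgrow w).trans (Real.exp_le_exp.2 ?_)
        refine mul_le_mul_of_nonneg_left ?_ hC
        refine Real.rpow_le_rpow (by positivity) (by linarith) (by norm_num))
    refine hb.trans ?_
    have h4 : (4 * R : ℝ) ^ (3 / 2 : ℝ) = 8 * R ^ (3 / 2 : ℝ) := by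
      rw [Real.mul_rpow (by norm_num) hR0.le]
      congr 1
      rw [show (4 : ℝ) = 2 ^ (2 : ℝ) by norm_num, ← Real.rpow_mul (by norm_num)]
      norm_num
    have h1 : 1 ≤ R ^ (3 / 2 : ℝ) := Real.one_le_rpow (by linarith) (by norm_num)
    have h5 : R ^ (-(1 / 2) : ℝ) = R ^ (3 / 2 : ℝ) / R ^ 2 := by
      rw [← Real.rpow_natCast, ← Real.rpow_sub hR0]; norm_num
    rw [h5, h4, add_assoc, ← hD]
    calc 64 * (C * (8 * R ^ (3 / 2 : ℝ)) + D) * ‖z‖ / (R - ‖z‖) ^ 2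
        ≤ 64 * (C * (8 * R ^ (3 / 2 : ℝ)) + D * R ^ (3 / 2 : ℝ)) * ‖z‖ / (R / 2) ^ 2 := by
          gcongr
          · nlinarith
          · linarith
      _ = _ := by field_simp; ring
  refine squeeze_zero' (Eventually.of_forall fun _ => norm_nonneg _) hbd ?_
  rw [← mul_zero (64 * ‖z‖ * (8 * C + D) * 4)]
  exact (tendsto_rpow_neg_atTop (by norm_num)).const_mul _

theorem summable_zeros_of_strip {f : ℂ → ℂ} (hf : Differentiable ℂ f)
    (heven : ∀ z, f (-z) = f z) {C : ℝ} (hC : 0 ≤ C)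
    (hgrow : ∀ w, ‖f w‖ ≤ Real.exp (C * (1 + ‖w‖) ^ (3 / 2 : ℝ)))
    (hstrip : ∀ z, f z = 0 → |z.re| < 1 / 2) :
    Summable fun α : ℂ => (analyticOrderNatAt f α : ℝ) / (1 + ‖α‖ ^ 2) := by
  have hz1 : f 1 ≠ 0 := fun h => by have := hstrip 1 h; norm_num at this
  have hT := tendsto_sum_zeros_logDeriv hf heven hC hgrow hz1
  have hTre := (Complex.continuous_re.tendsto _).comp hT
  have hterm : ∀ α, f α = 0 → 1 / (1 + ‖α‖ ^ 2) ≤ 12 * ((1 : ℂ) / (1 ^ 2 - α ^ 2)).re := by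
    intro α hα
    have h := hstrip α hα
    rw [abs_lt] at h
    set a := α.re
    set b := α.im
    have hn : ‖α‖ ^ 2 = a ^ 2 + b ^ 2 := by rw [Complex.sq_norm, Complex.normSq_apply]; ring
    have hre : ((1 : ℂ) ^ 2 - α ^ 2).re = 1 - a ^ 2 + b ^ 2 := by
      simp [sq, a, b]; ring
    have him : ((1 : ℂ) ^ 2 - α ^ 2).im = - (2 * a * b) := by
      simp [sq, a, b]; ring
    rw [one_div ((1 : ℂ) ^ 2 - α ^ 2), Complex.inv_re, Complex.normSq_apply, hre, him, hn]
    have ha2 : a ^ 2 < 1 / 4 := by nlinarith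
    have hpos : 0 < 1 - a ^ 2 + b ^ 2 := by nlinarith
    rw [mul_div_assoc', div_le_div_iff₀ (by positivity) (by nlinarith [sq_nonneg (2 * a * b)])]
    have hb : 0 ≤ b ^ 2 := sq_nonneg b
    have ha : 0 ≤ a ^ 2 := sq_nonneg a
    nlinarith [mul_nonneg ha hb, mul_nonneg hb hb, mul_nonneg ha ha]
  refine summable_of_sum_le (c := 12 * (logDeriv f 1).re) (fun α => by positivity) fun T => ?_
  have hsub : ∀ᶠ R : ℝ in atTop, (∑ α ∈ T, (analyticOrderNatAt f α : ℝ) / (1 + ‖α‖ ^ 2)) / 12 ≤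
      (Complex.re ∘ fun R : ℝ => ∑ α ∈ (finite_zeros_closedBall hf hz1 R).toFinset,
      (analyticOrderNatAt f α : ℂ) * (1 / (1 ^ 2 - α ^ 2))) R := by
    have hall : ∀ᶠ R : ℝ in atTop, ∀ α ∈ T, ‖α‖ ≤ R := by
      rw [Filter.eventually_all_finset]
      intro α _; exact eventually_ge_atTop _
    filter_upwards [hall] with R hR
    simp only [Function.comp, Complex.re_sum]
    rw [div_le_iff₀ (by norm_num), Finset.sum_mul]
    have hTsub : ∑ α ∈ T, (analyticOrderNatAt f α : ℝ) / (1 + ‖α‖ ^ 2) =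
        ∑ α ∈ T with f α = 0, (analyticOrderNatAt f α : ℝ) / (1 + ‖α‖ ^ 2) := by
      rw [Finset.sum_filter_of_ne]
      intro α _ h
      by_contra h0
      apply h
      have : analyticOrderNatAt f α = 0 := by
        simp [analyticOrderNatAt, (hf.analyticAt α).analyticOrderAt_eq_zero.2 h0]
      simp [this]
    rw [hTsub]
    have hle : ∀ α, f α = 0 → (analyticOrderNatAt f α : ℝ) / (1 + ‖α‖ ^ 2) ≤
        ((analyticOrderNatAt f α : ℂ) * (1 / (1 ^ 2 - α ^ 2))).re * 12 := by
      intro α hα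
      rw [show (analyticOrderNatAt f α : ℂ) = ((analyticOrderNatAt f α : ℝ) : ℂ) by simp,
        Complex.re_ofReal_mul, div_eq_mul_one_div]
      have := mul_le_mul_of_nonneg_left (hterm α hα) (Nat.cast_nonneg (α := ℝ) (analyticOrderNatAt f α))
      linarith
    refine (Finset.sum_le_sum fun α hα => hle α (Finset.mem_filter.1 hα).2).trans ?_
    refine Finset.sum_le_sum_of_subset_of_nonneg ?_ ?_
    · intro α hα
      simp only [Finset.mem_filter] at hα
      simp [hα.2, hR α hα.1]
    · intro α hα _
      simp only [Set.Finite.mem_toFinset, Set.mem_ofPred_eq] at hα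
      exact le_trans (by positivity) (hle α hα.1)
  have := ge_of_tendsto hTre hsub
  linarith

theorem hasSum_logDeriv_of_strip {f : ℂ → ℂ} (hf : Differentiable ℂ f)
    (heven : ∀ z, f (-z) = f z) {C : ℝ} (hC : 0 ≤ C)
    (hgrow : ∀ w, ‖f w‖ ≤ Real.exp (C * (1 + ‖w‖) ^ (3 / 2 : ℝ)))
    (hstrip : ∀ z, f z = 0 → |z.re| < 1 / 2) {z : ℂ} (hz : f z ≠ 0) :
    HasSum (fun α : ℂ => (analyticOrderNatAt f α : ℂ) * (z / (z ^ 2 - α ^ 2))) (logDeriv f z) := by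
  have hs := summable_zeros_of_strip hf heven hC hgrow hstrip
  have hT := tendsto_sum_zeros_logDeriv hf heven hC hgrow hz
  have hm0 : ∀ α, f α ≠ 0 → analyticOrderNatAt f α = 0 := fun α h0 => by
    simp [analyticOrderNatAt, (hf.analyticAt α).analyticOrderAt_eq_zero.2 h0]
  have hsum : Summable (fun α : ℂ => (analyticOrderNatAt f α : ℂ) * (z / (z ^ 2 - α ^ 2))) := by
    refine Summable.of_norm_bounded_eventually (hs.mul_left (4 * (‖z‖ + 1))) ?_
    refine (finite_zeros_closedBall hf hz (2 * ‖z‖ + 2)).subset ?_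
    intro α hα
    by_contra hcon
    apply hα
    by_cases h0 : f α = 0
    swap
    · simp [hm0 α h0]
    have hbig : 2 * ‖z‖ + 2 < ‖α‖ := by
      by_contra h; exact hcon ⟨h0, not_lt.1 h⟩
    have hz0 := norm_nonneg z
    have h1 : ‖α‖ ^ 2 - ‖z‖ ^ 2 ≤ ‖z ^ 2 - α ^ 2‖ := by
      rw [← norm_pow, ← norm_pow, norm_sub_rev]; exact norm_sub_norm_le _ _
    have h2 : 0 < ‖z ^ 2 - α ^ 2‖ := by nlinarith
    show ‖(analyticOrderNatAt f α : ℂ) * (z / (z ^ 2 - α ^ 2))‖ ≤ _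
    rw [norm_mul, norm_div, Complex.norm_natCast, mul_div_assoc', mul_div_assoc',
      div_le_div_iff₀ h2 (by positivity)]
    have h3 : ‖z‖ * (1 + ‖α‖ ^ 2) ≤ 4 * (‖z‖ + 1) * ‖z ^ 2 - α ^ 2‖ := by
      have h4 : (3 / 4) * ‖α‖ ^ 2 ≤ ‖z ^ 2 - α ^ 2‖ := by nlinarith
      nlinarith [mul_le_mul_of_nonneg_left h4 (by linarith : 0 ≤ 4 * (‖z‖ + 1))]
    have := mul_le_mul_of_nonneg_left h3 (Nat.cast_nonneg (α := ℝ) (analyticOrderNatAt f α))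
    linarith
  obtain ⟨L, hL⟩ := hsum
  suffices h : L = logDeriv f z by rwa [← h]
  refine tendsto_nhds_unique ?_ hT
  rw [Metric.tendsto_nhds]
  intro ε hε
  obtain ⟨T, hTT⟩ := (Metric.tendsto_atTop.1 hL) ε hε
  have hall : ∀ᶠ R : ℝ in atTop, ∀ α ∈ T, ‖α‖ ≤ R := by
    rw [Filter.eventually_all_finset]
    intro α _; exact eventually_ge_atTop _
  filter_upwards [hall] with R hR
  classical
  have := hTT ((finite_zeros_closedBall hf hz R).toFinset ∪ T) Finset.subset_union_right
  rwa [← Finset.sum_subset Finset.subset_union_left] at this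
  intro α hα hα'
  have : f α ≠ 0 := by
    intro h
    rcases Finset.mem_union.1 hα with h1 | h1
    · exact hα' h1
    · exact hα' (by simp [h, hR α h1])
  rw [hm0 α this]; simp

/-- The Riemann `ξ`-function (normalised by `ξ = 1` at `s = 1`), centred at `s = 1/2`. -/
noncomputable def centredXi (z : ℂ) : ℂ :=
  (z ^ 2 - 1 / 4) * completedRiemannZeta₀ (1 / 2 + z) + 1

theorem differentiable_centredXi : Differentiable ℂ centredXi := by
  unfold centredXi
  have := differentiable_completedZeta₀
  fun_prop

theorem centredXi_neg (z : ℂ) : centredXi (-z) = centredXi z := by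
  unfold centredXi
  rw [← completedRiemannZeta₀_one_sub (1 / 2 + z)]
  ring_nf

theorem centredXi_eq {z : ℂ} (h : 0 < (1 / 2 + z).re) (h1 : z ≠ 1 / 2) :
    centredXi z = (z ^ 2 - 1 / 4) * (riemannZeta (1 / 2 + z) * Complex.Gammaℝ (1 / 2 + z)) := by
  have h0 : (1 / 2 + z) ≠ 0 := by intro e; rw [e] at h; simp at h
  have h2 : 1 - (1 / 2 + z) ≠ 0 := by
    intro e; apply h1; linear_combination -e
  rw [riemannZeta_def_of_ne_zero h0, div_mul_cancel₀ _ (Complex.Gammaℝ_ne_zero_of_re_pos h),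
    completedRiemannZeta_eq, centredXi]
  have e : z ^ 2 - 1 / 4 = -((1 / 2 + z) * (1 - (1 / 2 + z))) := by ring
  rw [e]
  generalize 1 / 2 + z = s at h0 h2
  field_simp
  ring

theorem centredXi_half : centredXi (1 / 2) = 1 := by unfold centredXi; norm_num

theorem centredXi_ne_zero {z : ℂ} (h : 1 / 2 ≤ z.re) : centredXi z ≠ 0 := by
  by_cases h1 : z = 1 / 2
  · rw [h1, centredXi_half]; exact one_ne_zero
  have hre : (1 / 2 + z).re = 1 / 2 + z.re := by simp
  rw [centredXi_eq (by rw [hre]; linarith) h1]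
  refine mul_ne_zero ?_ (mul_ne_zero (riemannZeta_ne_zero_of_one_le_re (by rw [hre]; linarith))
    (Complex.Gammaℝ_ne_zero_of_re_pos (by rw [hre]; linarith)))
  have : z ^ 2 - 1 / 4 = (z - 1 / 2) * (z + 1 / 2) := by ring
  rw [this]
  refine mul_ne_zero (sub_ne_zero.2 h1) ?_
  intro e
  have := congrArg Complex.re e
  simp at this
  linarith

theorem abs_re_lt_of_centredXi_eq_zero (z : ℂ) (h : centredXi z = 0) : |z.re| < 1 / 2 := by
  rw [abs_lt]
  constructor
  · by_contra hc
    refine centredXi_ne_zero (z := -z) (by simp; linarith) (by rwa [centredXi_neg])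
  · by_contra hc
    exact centredXi_ne_zero (not_lt.1 hc) h

open ComplexConjugate in
theorem centredXi_conj (z : ℂ) : centredXi (conj z) = conj (centredXi z) := by
  have hd : Differentiable ℂ (fun z => conj (centredXi (conj z))) := fun z =>
    differentiableAt_conj_conj_iff.mpr (differentiable_centredXi _)
  have hG : ∀ s : ℂ, Complex.Gammaℝ (conj s) = conj (Complex.Gammaℝ s) := by
    intro s
    have h2 : conj (2 : ℂ) = 2 := Complex.conj_ofNat 2
    have hp : (Real.pi : ℂ) ^ conj (-s / 2) = conj ((Real.pi : ℂ) ^ (-s / 2)) := by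
      rw [Complex.cpow_conj _ _ (by
        rw [Complex.arg_ofReal_of_nonneg Real.pi_pos.le]; exact Real.pi_pos.ne), Complex.conj_ofReal]
    rw [Complex.Gammaℝ_def, Complex.Gammaℝ_def, map_mul, ← Complex.Gamma_conj, ← hp]
    simp [h2]
  have heq : (fun z => conj (centredXi (conj z))) =ᶠ[𝓝 1] centredXi := by
    have hnh : {z : ℂ | 1 / 2 < z.re} ∈ 𝓝 (1 : ℂ) :=
      (isOpen_lt continuous_const Complex.continuous_re).mem_nhds (by norm_num)
    filter_upwards [hnh] with w hw
    have hw : 1 / 2 < w.re := hw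
    have h1 : ∀ w : ℂ, 1 / 2 < w.re → w ≠ 1 / 2 := by
      intro w hw e; rw [e] at hw; norm_num at hw
    rw [centredXi_eq (by simp; linarith) (h1 w hw),
      centredXi_eq (by simp; linarith) (h1 _ (by simpa using hw))]
    have h2 : conj (2 : ℂ) = 2 := Complex.conj_ofNat 2
    have h4 : conj (4 : ℂ) = 4 := Complex.conj_ofNat 4
    have : 1 / 2 + conj w = conj (1 / 2 + w) := by simp [h2]
    rw [this, riemannZeta_conj, hG]
    simp [h4]
  have := AnalyticOnNhd.eqOn_of_preconnected_of_eventuallyEq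
    (fun z _ => hd.analyticAt z : AnalyticOnNhd ℂ _ univ)
    (fun z _ => differentiable_centredXi.analyticAt z : AnalyticOnNhd ℂ _ univ)
    isPreconnected_univ (mem_univ 1) heq
  have h2 := congrArg conj (this (mem_univ z))
  simpa using h2

theorem exists_bound_completedZeta₀_strip (a b : ℝ) :
    ∃ C : ℝ, ∀ s : ℂ, a ≤ s.re → s.re ≤ b → ‖completedRiemannZeta₀ s‖ ≤ C := by
  set P := HurwitzZeta.hurwitzEvenFEPair 0
  have hconv : ∀ s : ℂ, MellinConvergent P.f_modif s := fun s =>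
    (P.isStrongFEPair_toStrongFEPair.hasMellin s).1
  have hInt : ∀ σ : ℝ, MeasureTheory.IntegrableOn (fun t : ℝ => t ^ (σ - 1) * ‖P.f_modif t‖) (Ioi 0) := by
    intro σ
    refine (hconv σ).norm.congr ?_
    filter_upwards [MeasureTheory.ae_restrict_mem measurableSet_Ioi] with t ht
    have ht : 0 < t := ht
    rw [norm_smul, Complex.norm_cpow_eq_rpow_re_of_pos ht]
    simp
  set N : ℝ → ℝ := fun σ => ∫ t in Ioi 0, t ^ (σ - 1) * ‖P.f_modif t‖
  refine ⟨(N (a / 2) + N (b / 2)) / 2, fun s ha hb => ?_⟩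
  have h0 : completedRiemannZeta₀ s = mellin P.f_modif (s / 2) / 2 := rfl
  rw [h0, norm_div, Complex.norm_ofNat]
  gcongr
  rw [mellin, ← MeasureTheory.integral_add (hInt _) (hInt _)]
  refine (MeasureTheory.norm_integral_le_integral_norm _).trans ?_
  refine MeasureTheory.setIntegral_mono_on (hconv _).norm ((hInt _).add (hInt _))
    measurableSet_Ioi fun t ht => ?_
  have ht : 0 < t := ht
  rw [norm_smul, Complex.norm_cpow_eq_rpow_re_of_pos ht, ← add_mul]
  have hre : (s / 2 - 1).re = s.re / 2 - 1 := by simp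
  rw [hre]
  refine mul_le_mul_of_nonneg_right ?_ (norm_nonneg _)
  rcases le_total 1 t with h | h
  · have := Real.rpow_le_rpow_of_exponent_le h (by linarith : s.re / 2 - 1 ≤ b / 2 - 1)
    have := Real.rpow_nonneg ht.le (a / 2 - 1)
    linarith
  · have := Real.rpow_le_rpow_of_exponent_ge ht h (by linarith : a / 2 - 1 ≤ s.re / 2 - 1)
    have := Real.rpow_nonneg ht.le (b / 2 - 1)
    linarith

theorem norm_riemannZeta_le_of_two_le_re {s : ℂ} (hs : 2 ≤ s.re) :
    ‖riemannZeta s‖ ≤ ∑' n : ℕ, 1 / ((n : ℝ) + 1) ^ 2 := by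
  rw [zeta_eq_tsum_one_div_nat_add_one_cpow (by linarith)]
  have hsum : Summable fun n : ℕ => 1 / ((n : ℝ) + 1) ^ 2 := by
    have := (summable_nat_add_iff 1).2 (Real.summable_one_div_nat_pow.2 (by norm_num : 1 < 2))
    simpa using this
  refine tsum_of_norm_bounded hsum.hasSum fun n => ?_
  rw [norm_div, norm_one]
  have : ‖((n : ℂ) + 1) ^ s‖ = ((n : ℝ) + 1) ^ s.re := by
    have := Complex.norm_natCast_cpow_of_pos (Nat.succ_pos n) s
    push_cast at this; exact this
  rw [this]
  gcongr
  rw [← Real.rpow_natCast]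
  exact Real.rpow_le_rpow_of_exponent_le (by linarith [Nat.cast_nonneg (α := ℝ) n]) (by simpa using hs)

theorem Real.Gamma_le_exp_rpow {x : ℝ} (hx : 2 ≤ x) :
    Real.Gamma x ≤ Real.exp (2 * (x + 1) ^ (3 / 2 : ℝ)) := by
  set n := ⌈x⌉₊
  have hn : x ≤ n := Nat.le_ceil x
  have hn1 : (n : ℝ) ≤ x + 1 := (Nat.ceil_lt_add_one (by linarith)).le
  have h1 : Real.Gamma x ≤ Real.Gamma (n + 1) :=
    Real.Gamma_strictMonoOn_Ici.monotoneOn (mem_Ici.2 hx) (mem_Ici.2 (by linarith)) (by linarith)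
  rw [Real.Gamma_nat_eq_factorial] at h1
  refine h1.trans ?_
  have h2 : (n.factorial : ℝ) ≤ (n : ℝ) ^ n := by exact_mod_cast Nat.factorial_le_pow n
  refine h2.trans ?_
  have hn0 : (0 : ℝ) < n := by linarith
  rw [← Real.exp_log (pow_pos hn0 n), Real.log_pow]
  apply Real.exp_le_exp.2
  have h3 : Real.log n ≤ 2 * (x + 1) ^ (1 / 2 : ℝ) := by
    calc Real.log n ≤ Real.log (x + 1) := Real.log_le_log hn0 hn1
      _ ≤ (x + 1) ^ (1 / 2 : ℝ) / (1 / 2) := Real.log_le_rpow_div (by linarith) (by norm_num)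
      _ = _ := by ring
  have h4 : (x + 1) ^ (3 / 2 : ℝ) = (x + 1) * (x + 1) ^ (1 / 2 : ℝ) := by
    rw [show (3 / 2 : ℝ) = 1 + 1 / 2 by norm_num, Real.rpow_add (by linarith), Real.rpow_one]
  rw [h4]
  have h5 : 0 ≤ Real.log n := Real.log_natCast_nonneg n
  calc (n : ℝ) * Real.log n ≤ (x + 1) * (2 * (x + 1) ^ (1 / 2 : ℝ)) := by gcongr
    _ = _ := by ring

theorem Complex.norm_Gamma_le_Gamma_re {s : ℂ} (hs : 0 < s.re) :
    ‖Complex.Gamma s‖ ≤ Real.Gamma s.re := by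
  rw [Complex.Gamma_eq_integral hs, Real.Gamma_eq_integral hs, Complex.GammaIntegral]
  refine (MeasureTheory.norm_integral_le_integral_norm _).trans (le_of_eq ?_)
  refine MeasureTheory.setIntegral_congr_fun measurableSet_Ioi fun t ht => ?_
  have ht : 0 < t := ht
  simp only [norm_mul, Complex.norm_cpow_eq_rpow_re_of_pos ht, Complex.norm_real, Real.norm_eq_abs,
    abs_of_pos (Real.exp_pos _), Complex.sub_re, Complex.one_re]

theorem centredXi_growth_right : ∃ C : ℝ, 0 ≤ C ∧ ∀ w : ℂ, 0 ≤ w.re →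
    ‖centredXi w‖ ≤ Real.exp (C * (1 + ‖w‖) ^ (3 / 2 : ℝ)) := by
  obtain ⟨C₁, hC₁⟩ := exists_bound_completedZeta₀_strip (1 / 2) 4
  set Z := ∑' n : ℕ, 1 / ((n : ℝ) + 1) ^ 2
  have hZ : 0 ≤ Z := tsum_nonneg fun n => by positivity
  have hC₁' : 0 ≤ C₁ := (norm_nonneg _).trans (hC₁ 1 (by norm_num) (by norm_num))
  refine ⟨5 + C₁ + Z, by positivity, fun w hw => ?_⟩
  have hpoly : ‖w ^ 2 - 1 / 4‖ ≤ (1 + ‖w‖) ^ 2 := by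
    refine (norm_sub_le _ _).trans ?_
    rw [norm_pow]; norm_num
    nlinarith [norm_nonneg w]
  have hx1 : 1 ≤ 1 + ‖w‖ := by linarith [norm_nonneg w]
  set x := 1 + ‖w‖ with hx
  have hx32 : x ≤ x ^ (3 / 2 : ℝ) := by
    conv_lhs => rw [← Real.rpow_one x]
    exact Real.rpow_le_rpow_of_exponent_le hx1 (by norm_num)
  set y := x ^ (3 / 2 : ℝ)
  have hx2 : x ^ 2 ≤ Real.exp (2 * y) := by
    have h1 : x ≤ Real.exp y := by linarith [Real.add_one_le_exp y]
    calc x ^ 2 ≤ (Real.exp y) ^ 2 := by gcongr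
      _ = _ := by rw [← Real.exp_nat_mul]; simp
  have hy1 : 1 ≤ y := hx1.trans hx32
  have hexpC : ∀ c : ℝ, 0 ≤ c → c ≤ Real.exp (c * y) := fun c hc => by
    have := Real.add_one_le_exp (c * y)
    nlinarith
  by_cases hw4 : (1 / 2 + w).re ≤ 4
  · have h1 := hC₁ (1 / 2 + w) (by simpa using hw) hw4
    calc ‖centredXi w‖ ≤ ‖w ^ 2 - 1 / 4‖ * ‖completedRiemannZeta₀ (1 / 2 + w)‖ + 1 := by
          refine (norm_add_le _ _).trans ?_
          rw [norm_mul, norm_one]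
      _ ≤ x ^ 2 * C₁ + 1 := by gcongr
      _ ≤ x ^ 2 * C₁ + x ^ 2 := by gcongr; exact one_le_pow₀ hx1
      _ = x ^ 2 * (1 + C₁) := by ring
      _ ≤ Real.exp (2 * y) * Real.exp ((1 + C₁) * y) := by
          gcongr
          exact hexpC _ (by linarith)
      _ = Real.exp ((3 + C₁) * y) := by rw [← Real.exp_add]; ring_nf
      _ ≤ _ := by
          apply Real.exp_le_exp.2
          have : 0 ≤ y := by linarith
          nlinarith
  · have hre : (1 / 2 + w).re = 1 / 2 + w.re := by simp
    rw [hre] at hw4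
    have hwn : w.re ≤ ‖w‖ := Complex.re_le_norm w
    rw [centredXi_eq (by rw [hre]; linarith) (by
      intro e; rw [e] at hw4; norm_num at hw4)]
    have h1 := norm_riemannZeta_le_of_two_le_re (s := 1 / 2 + w) (by rw [hre]; linarith)
    have h2 : ‖Complex.Gammaℝ (1 / 2 + w)‖ ≤ Real.exp (2 * y) := by
      have hre2 : ((1 / 2 + w) / 2).re = (1 / 2 + w.re) / 2 := by simp
      rw [Complex.Gammaℝ_def, norm_mul, Complex.norm_cpow_eq_rpow_re_of_pos Real.pi_pos]
      have h3 : Real.pi ^ (-(1 / 2 + w) / 2).re ≤ 1 := by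
        refine Real.rpow_le_one_of_one_le_of_nonpos (by linarith [Real.two_le_pi]) ?_
        have : (-(1 / 2 + w) / 2).re = -((1 / 2 + w.re) / 2) := by rw [neg_div, Complex.neg_re, hre2]
        rw [this]; linarith
      have h4 := Complex.norm_Gamma_le_Gamma_re (s := (1 / 2 + w) / 2) (by rw [hre2]; linarith)
      have h5 := Real.Gamma_le_exp_rpow (x := ((1 / 2 + w) / 2).re) (by rw [hre2]; linarith)
      calc _ ≤ 1 * Real.exp (2 * (((1 / 2 + w) / 2).re + 1) ^ (3 / 2 : ℝ)) := by
            gcongr; exact h4.trans h5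
        _ ≤ _ := by
          rw [one_mul]
          apply Real.exp_le_exp.2
          have : ((1 / 2 + w) / 2).re + 1 ≤ x := by rw [hre2]; linarith
          have h0 : 0 ≤ ((1 / 2 + w) / 2).re + 1 := by rw [hre2]; linarith
          have := Real.rpow_le_rpow h0 this (by norm_num : (0 : ℝ) ≤ 3 / 2)
          linarith
    rw [norm_mul, norm_mul]
    calc _ ≤ x ^ 2 * (Z * Real.exp (2 * y)) := by gcongr
      _ ≤ Real.exp (2 * y) * (Real.exp (Z * y) * Real.exp (2 * y)) := by
          gcongr
          exact hexpC Z hZ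
      _ = Real.exp ((4 + Z) * y) := by rw [← Real.exp_add, ← Real.exp_add]; ring_nf
      _ ≤ _ := by
          apply Real.exp_le_exp.2
          have : 0 ≤ y := by linarith
          nlinarith

theorem centredXi_growth : ∃ C : ℝ, 0 ≤ C ∧ ∀ w : ℂ,
    ‖centredXi w‖ ≤ Real.exp (C * (1 + ‖w‖) ^ (3 / 2 : ℝ)) := by
  obtain ⟨C, hC, h⟩ := centredXi_growth_right
  refine ⟨C, hC, fun w => ?_⟩
  rcases le_total 0 w.re with hw | hw
  · exact h w hw
  · have := h (-w) (by simpa using hw)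
    rwa [centredXi_neg, norm_neg] at this

/-- Multiplicity of `1/2 + α` as a zero of the completed zeta function. -/
noncomputable def xiMult (α : ℂ) : ℕ := analyticOrderNatAt centredXi α

theorem xiMult_eq_zero {α : ℂ} (h : centredXi α ≠ 0) : xiMult α = 0 := by
  simp [xiMult, analyticOrderNatAt, (differentiable_centredXi.analyticAt α).analyticOrderAt_eq_zero.2 h]

theorem abs_re_lt_of_xiMult_ne_zero {α : ℂ} (h : xiMult α ≠ 0) : |α.re| < 1 / 2 := by
  apply abs_re_lt_of_centredXi_eq_zero
  by_contra h0
  exact h (xiMult_eq_zero h0)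

theorem xiMult_neg (α : ℂ) : xiMult (-α) = xiMult α :=
  analyticOrderNatAt_neg_of_even centredXi_neg α

theorem hasSum_logDeriv_centredXi {z : ℂ} (hz : centredXi z ≠ 0) :
    HasSum (fun α : ℂ => (xiMult α : ℂ) * (z / (z ^ 2 - α ^ 2))) (logDeriv centredXi z) := by
  obtain ⟨C, hC, h⟩ := centredXi_growth
  exact hasSum_logDeriv_of_strip differentiable_centredXi centredXi_neg hC h
    abs_re_lt_of_centredXi_eq_zero hz

open ComplexConjugate in
theorem xiMult_conj (α : ℂ) : xiMult (conj α) = xiMult α := by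
  have hc1 : centredXi 1 ≠ 0 := centredXi_ne_zero (by norm_num)
  obtain ⟨g, hg, hfg, hgα⟩ := exists_factor_zeros differentiable_centredXi hc1 {α}
  have hd : Differentiable ℂ (fun z => conj (g (conj z))) := fun z =>
    differentiableAt_conj_conj_iff.mpr (hg _)
  have : analyticOrderAt centredXi (conj α) = xiMult α := by
    rw [(differentiable_centredXi.analyticAt _).analyticOrderAt_eq_natCast]
    refine ⟨_, hd.analyticAt _, ?_, Eventually.of_forall fun z => ?_⟩
    · simpa using hgα α (by simp)
    · have h1 := congrArg conj (hfg (conj z))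
      rw [centredXi_conj] at h1
      simpa [xiMult] using h1
  simp [xiMult, analyticOrderNatAt, this]

theorem Complex.digamma_ofReal_hasDerivAt {x : ℝ} (hx : 0 < x) :
    Complex.digamma x = ((Complex.digamma x).re : ℂ) ∧
      HasDerivAt (Real.log ∘ Real.Gamma) (Complex.digamma x).re x := by
  have hxm : ∀ m : ℕ, x ≠ -(m : ℝ) := fun m h => by
    have := Nat.cast_nonneg (α := ℝ) m; linarith
  have hxmc : ∀ m : ℕ, (x : ℂ) ≠ -(m : ℂ) := fun m h => hxm m (by exact_mod_cast h)
  have h1 := (Real.differentiableAt_Gamma hxm).hasDerivAt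
  have h2 := (Complex.differentiableAt_Gamma _ hxmc).hasDerivAt.comp_ofReal
  have h3 := h1.ofReal_comp
  have h4 : deriv Complex.Gamma x = ((deriv Real.Gamma x : ℝ) : ℂ) := by
    refine h2.unique ?_
    simpa only [Complex.Gamma_ofReal] using! h3
  have h5 : Complex.digamma x = ((deriv Real.Gamma x / Real.Gamma x : ℝ) : ℂ) := by
    rw [Complex.digamma, logDeriv_apply, h4, Complex.Gamma_ofReal]; push_cast; rfl
  refine ⟨by rw [h5, Complex.ofReal_re], ?_⟩
  rw [h5, Complex.ofReal_re]
  exact h1.log (Real.Gamma_pos_of_pos hx).ne'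

theorem Complex.digamma_add_natCast {w : ℂ} (hw : 0 < w.re) (N : ℕ) :
    Complex.digamma (w + N) = Complex.digamma w + ∑ k ∈ Finset.range N, (w + k)⁻¹ := by
  induction N with
  | zero => simp
  | succ N ih =>
    rw [Finset.sum_range_succ, ← add_assoc, ← ih, Nat.cast_succ, ← add_assoc]
    refine Complex.digamma_apply_add_one _ fun m h => ?_
    have h1 := congrArg Complex.re h
    simp at h1
    have := Nat.cast_nonneg (α := ℝ) m
    have := Nat.cast_nonneg (α := ℝ) N
    linarith

theorem Complex.digamma_re_le_log {x : ℝ} (hx : 0 < x) : (Complex.digamma x).re ≤ Real.log x := by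
  have h := Real.convexOn_log_Gamma.le_slope_of_hasDerivAt (mem_Ioi.2 hx)
    (mem_Ioi.2 (by linarith : 0 < x + 1)) (by linarith) (Complex.digamma_ofReal_hasDerivAt hx).2
  rw [slope_def_field] at h
  simp only [Function.comp, Real.Gamma_add_one hx.ne',
    Real.log_mul hx.ne' (Real.Gamma_pos_of_pos hx).ne'] at h
  simpa using h

theorem Complex.log_le_digamma_re {x : ℝ} (hx : 0 < x) :
    Real.log x ≤ (Complex.digamma (x + 1 : ℝ)).re := by
  have h := Real.convexOn_log_Gamma.slope_le_of_hasDerivAt (mem_Ioi.2 hx)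
    (mem_Ioi.2 (by linarith : 0 < x + 1)) (by linarith)
    (Complex.digamma_ofReal_hasDerivAt (by linarith : 0 < x + 1)).2
  rw [slope_def_field] at h
  simp only [Function.comp, Real.Gamma_add_one hx.ne',
    Real.log_mul hx.ne' (Real.Gamma_pos_of_pos hx).ne'] at h
  simpa using h

theorem tendsto_log_add_sub_log (x : ℝ) :
    Tendsto (fun N : ℕ => Real.log (x + N) - Real.log N) atTop (𝓝 0) := by
  have h : Tendsto (fun N : ℕ => x / N + 1) atTop (𝓝 (0 + 1)) :=
    (tendsto_const_div_atTop_nhds_zero_nat x).add_const 1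
  rw [zero_add] at h
  have h2 := (Real.continuousAt_log one_ne_zero).tendsto.comp h
  rw [Real.log_one] at h2
  refine h2.congr' ?_
  have h3 : ∀ᶠ N : ℕ in atTop, 0 < x + N := by
    have : Tendsto (fun N : ℕ => x + (N : ℝ)) atTop atTop :=
      tendsto_atTop_add_const_left _ _ tendsto_natCast_atTop_atTop
    exact this.eventually_gt_atTop 0
  filter_upwards [eventually_gt_atTop 0, h3] with N hN hxN
  have hN' : (0 : ℝ) < N := by exact_mod_cast hN
  simp only [Function.comp]
  rw [← Real.log_div hxN.ne' hN'.ne']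
  congr 1
  field_simp

theorem Complex.tendsto_digamma_re {x : ℝ} (hx : 0 < x) :
    Tendsto (fun N : ℕ => Real.log N - ∑ k ∈ Finset.range N, (x + k)⁻¹) atTop
      (𝓝 (Complex.digamma x).re) := by
  have key : ∀ N : ℕ, (Complex.digamma (x + N : ℝ)).re =
      (Complex.digamma x).re + ∑ k ∈ Finset.range N, (x + k)⁻¹ := by
    intro N
    have := congrArg Complex.re (Complex.digamma_add_natCast (w := x) (by simpa using hx) N)
    push_cast
    rw [this, Complex.add_re, Complex.re_sum]
    congr 1
    refine Finset.sum_congr rfl fun k _ => ?_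
    rw [← Complex.ofReal_natCast, ← Complex.ofReal_add, ← Complex.ofReal_inv, Complex.ofReal_re]
  have h0 : Tendsto (fun N : ℕ => (Complex.digamma (x + N : ℝ)).re - Real.log N) atTop (𝓝 0) := by
    refine tendsto_of_tendsto_of_tendsto_of_le_of_le' (tendsto_log_add_sub_log (x - 1))
      (tendsto_log_add_sub_log x) ?_ ?_
    · filter_upwards [eventually_gt_atTop 0] with N hN
      have hN' : (1 : ℝ) ≤ N := by exact_mod_cast hN
      have := Complex.log_le_digamma_re (x := x - 1 + N) (by linarith)
      rw [show x - 1 + (N : ℝ) + 1 = x + N by ring] at this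
      linarith
    · filter_upwards with N
      have := Complex.digamma_re_le_log (x := x + N) (by positivity)
      linarith
  have h1 := (tendsto_const_nhds (x := (Complex.digamma x).re)).sub h0
  rw [sub_zero] at h1
  refine h1.congr fun N => ?_
  rw [key]; ring

theorem summable_digamma_series {w : ℂ} (hw : 1 ≤ w.re) :
    Summable fun k : ℕ => ((k : ℂ) + 1)⁻¹ - (w + k)⁻¹ := by
  have hsum : Summable fun n : ℕ => 1 / ((n : ℝ) + 1) ^ 2 := by
    have := (summable_nat_add_iff 1).2 (Real.summable_one_div_nat_pow.2 (by norm_num : 1 < 2))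
    simpa using this
  refine Summable.of_norm_bounded (hsum.mul_left ‖w - 1‖) fun k => ?_
  have hk : (0 : ℝ) < (k : ℝ) + 1 := by positivity
  have h1 : ((k : ℂ) + 1) ≠ 0 := by exact_mod_cast hk.ne'
  have h3 : (k : ℝ) + 1 ≤ ‖w + k‖ := by
    refine le_trans ?_ (Complex.re_le_norm _)
    simp; linarith
  have h2 : w + k ≠ 0 := norm_pos_iff.1 (by linarith)
  have h4 : ((k : ℂ) + 1)⁻¹ - (w + k)⁻¹ = (w - 1) / (((k : ℂ) + 1) * (w + k)) := by
    field_simp; ring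
  have h5 : ‖(k : ℂ) + 1‖ = (k : ℝ) + 1 := by
    have := Complex.norm_natCast (k + 1); push_cast at this; exact this
  rw [h4, norm_div, norm_mul, h5, mul_one_div, pow_two]
  gcongr

theorem Complex.hasSum_digamma {w : ℂ} (hw : 1 < w.re) :
    HasSum (fun k : ℕ => ((k : ℂ) + 1)⁻¹ - (w + k)⁻¹)
      (Complex.digamma w + Real.eulerMascheroniConstant) := by
  have hreal : ∀ x : ℝ, 1 ≤ x → ∑' k : ℕ, (((k : ℂ) + 1)⁻¹ - ((x : ℂ) + k)⁻¹) =
      Complex.digamma x + Real.eulerMascheroniConstant := by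
    intro x hx
    have hs := (summable_digamma_series (w := x) (by simpa using hx)).hasSum.tendsto_sum_nat
    refine tendsto_nhds_unique hs ?_
    have h1 := (Complex.tendsto_digamma_re (by linarith : 0 < x)).add Real.tendsto_harmonic_sub_log
    have h2 := (Complex.continuous_ofReal.tendsto _).comp h1
    rw [Complex.ofReal_add, ← (Complex.digamma_ofReal_hasDerivAt (by linarith : 0 < x)).1] at h2
    refine h2.congr fun N => ?_
    simp only [Function.comp, harmonic]
    push_cast
    rw [Finset.sum_sub_distrib]
    ring
  suffices h : ∑' k : ℕ, (((k : ℂ) + 1)⁻¹ - (w + k)⁻¹) =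
      Complex.digamma w + Real.eulerMascheroniConstant by
    rw [← h]; exact (summable_digamma_series hw.le).hasSum
  set R := ‖w‖ + 3 with hR
  set U : Set ℂ := {z | 1 < z.re} ∩ ball 0 R with hU
  have hUo : IsOpen U := (isOpen_lt continuous_const Complex.continuous_re).inter isOpen_ball
  have hUc : IsPreconnected U :=
    ((convex_halfSpace_re_gt 1).inter (convex_ball 0 R)).isPreconnected
  have hsum : Summable fun n : ℕ => 1 / ((n : ℝ) + 1) ^ 2 := by
    have := (summable_nat_add_iff 1).2 (Real.summable_one_div_nat_pow.2 (by norm_num : 1 < 2))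
    simpa using this
  have hne : ∀ z ∈ U, ∀ k : ℕ, z + k ≠ 0 := by
    intro z hz k h
    have h1 := congrArg Complex.re h
    have h2 : 1 < z.re := hz.1
    simp at h1
    have := Nat.cast_nonneg (α := ℝ) k
    linarith
  have hF : DifferentiableOn ℂ (fun z : ℂ => ∑' k : ℕ, (((k : ℂ) + 1)⁻¹ - (z + k)⁻¹)) U := by
    refine differentiableOn_tsum_of_summable_norm (hsum.mul_left (R + 1)) (fun k => ?_) hUo ?_
    · intro z hz
      refine DifferentiableAt.differentiableWithinAt ?_
      have := hne z hz k
      fun_prop (disch := assumption)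
    · intro k z hz
      have hk : (0 : ℝ) < (k : ℝ) + 1 := by positivity
      have h1 : ((k : ℂ) + 1) ≠ 0 := by exact_mod_cast hk.ne'
      have hz1 : 1 < z.re := hz.1
      have hz2 : ‖z‖ < R := by simpa using hz.2
      have h3 : (k : ℝ) + 1 ≤ ‖z + k‖ := by
        refine le_trans ?_ (Complex.re_le_norm _)
        simp; linarith
      have h2 := hne z hz k
      have h4 : ((k : ℂ) + 1)⁻¹ - (z + k)⁻¹ = (z - 1) / (((k : ℂ) + 1) * (z + k)) := by
        field_simp; ring
      have h5 : ‖(k : ℂ) + 1‖ = (k : ℝ) + 1 := by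
        have := Complex.norm_natCast (k + 1); push_cast at this; exact this
      have h6 : ‖z - 1‖ ≤ R + 1 := (norm_sub_le _ _).trans (by rw [norm_one]; linarith)
      rw [h4, norm_div, norm_mul, h5, mul_one_div, pow_two]
      gcongr
  have hG : DifferentiableOn ℂ (fun z => Complex.digamma z + Real.eulerMascheroniConstant) U := by
    intro z hz
    have hzm : ∀ m : ℕ, z ≠ -(m : ℂ) := fun m h => hne z hz m (by rw [h]; ring)
    have hnh : {z : ℂ | 0 < z.re} ∈ 𝓝 z :=
      (isOpen_lt continuous_const Complex.continuous_re).mem_nhds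
        (show (0 : ℝ) < z.re from lt_trans one_pos hz.1)
    have han : AnalyticAt ℂ Complex.Gamma z := by
      rw [Complex.analyticAt_iff_eventually_differentiableAt]
      filter_upwards [hnh] with y hy
      refine Complex.differentiableAt_Gamma _ fun m h => ?_
      have hy : 0 < y.re := hy
      rw [h] at hy
      simp at hy
      have := Nat.cast_nonneg (α := ℝ) m
      linarith
    refine DifferentiableAt.differentiableWithinAt ?_
    refine DifferentiableAt.add_const _ ?_
    exact han.deriv.differentiableAt.div han.differentiableAt (Complex.Gamma_ne_zero hzm)
  have h2U : (2 : ℂ) ∈ U := by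
    refine ⟨by simp, ?_⟩
    simp [hR]; linarith [norm_nonneg w]
  have heq := (hF.analyticOnNhd hUo).eqOn_of_preconnected_of_frequently_eq
    (hG.analyticOnNhd hUo) hUc h2U ?_
  · exact heq ⟨hw, by simp [hR]⟩
  · have ht : Tendsto (fun n : ℕ => ((2 + 1 / ((n : ℝ) + 1) : ℝ) : ℂ)) atTop (𝓝[≠] 2) := by
      rw [tendsto_nhdsWithin_iff]
      constructor
      · have h1 := tendsto_one_div_add_atTop_nhds_zero_nat (𝕜 := ℝ)
        have h2 := h1.const_add 2
        have h3 := (Complex.continuous_ofReal.tendsto _).comp h2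
        rw [show (2 : ℂ) = ((2 + 0 : ℝ) : ℂ) by simp]
        exact h3
      · filter_upwards with n
        have h1 : (0 : ℝ) < 1 / ((n : ℝ) + 1) := by positivity
        intro h
        have : (2 + 1 / ((n : ℝ) + 1) : ℝ) = 2 := by
          have h : ((2 + 1 / ((n : ℝ) + 1) : ℝ) : ℂ) = 2 := h
          exact_mod_cast h
        linarith
    refine ht.frequently (Frequently.of_forall fun n => ?_)
    refine hreal _ ?_
    have h1 : (0 : ℝ) < 1 / ((n : ℝ) + 1) := by positivity
    linarith

theorem Real.log_le_half_sub_inv {y : ℝ} (hy : 1 ≤ y) : Real.log y ≤ (y - y⁻¹) / 2 := by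
  have h := Real.self_le_sinh_iff.2 (Real.log_nonneg hy)
  rwa [Real.sinh_eq, Real.exp_neg, Real.exp_log (by linarith)] at h

theorem Complex.digamma_re_le_log_sub {x : ℝ} (hx : 0 < x) :
    (Complex.digamma x).re ≤ Real.log x - 1 / (2 * x) := by
  have hsum : ∀ N : ℕ, Real.log (x + N) - Real.log x ≤
      ∑ k ∈ Finset.range N, (x + k)⁻¹ - 1 / (2 * x) + 1 / (2 * (x + N)) := by
    intro N
    induction N with
    | zero => simp
    | succ N ih =>
      rw [Finset.sum_range_succ]
      push_cast
      set a := x + (N : ℝ) with ha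
      have ha0 : 0 < a := by positivity
      rw [show x + ((N : ℝ) + 1) = a + 1 by rw [ha]; ring]
      have h1 := Real.log_le_half_sub_inv (y := (a + 1) / a) (by rw [le_div_iff₀ ha0]; linarith)
      rw [Real.log_div (by linarith) ha0.ne'] at h1
      have h2 : ((a + 1) / a - ((a + 1) / a)⁻¹) / 2 = a⁻¹ - 1 / (2 * a) + 1 / (2 * (a + 1)) := by
        field_simp; ring
      rw [h2] at h1
      linarith
  have h1 := Complex.tendsto_digamma_re hx
  have h3 : Tendsto (fun N : ℕ => 1 / (2 * (x + N))) atTop (𝓝 0) := by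
    refine Tendsto.div_atTop tendsto_const_nhds ?_
    refine Tendsto.const_mul_atTop (by norm_num) ?_
    exact tendsto_atTop_add_const_left _ _ tendsto_natCast_atTop_atTop
  have h4 := ((tendsto_const_nhds (x := Real.log x - 1 / (2 * x))).sub
    (tendsto_log_add_sub_log x)).add h3
  rw [sub_zero, add_zero] at h4
  refine le_of_tendsto_of_tendsto' h1 h4 fun N => ?_
  have := hsum N
  linarith

theorem Complex.digamma_re_le {w : ℂ} (hw : 1 < w.re) (hy : 0 < w.im) :
    (Complex.digamma w).re ≤ Real.log ‖w‖ + Real.pi / (4 * w.im) := by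
  set x := w.re
  set y := w.im
  have hsum : ∀ N : ℕ, Real.log ‖w + N‖ - Real.log ‖w‖ ≤
      ∑ k ∈ Finset.range N, ((w + k)⁻¹).re +
        1 / (2 * y) * (Real.arctan ((x + N - 1) / y) - Real.arctan ((x - 1) / y)) := by
    intro N
    induction N with
    | zero => simp
    | succ N ih =>
      rw [Finset.sum_range_succ]
      push_cast
      set v := w + (N : ℂ) with hv
      set a := x + (N : ℝ) with ha
      have hvre : v.re = a := by simp [hv, ha, x]
      have hvim : v.im = y := by simp [hv, y]
      have ha1 : 1 < a := by have := Nat.cast_nonneg (α := ℝ) N; linarith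
      rw [show w + ((N : ℂ) + 1) = v + 1 by rw [hv]; ring,
        show x + ((N : ℝ) + 1) - 1 = a by rw [ha]; ring]
      have hn1 : ‖v‖ ^ 2 = a ^ 2 + y ^ 2 := by
        rw [Complex.sq_norm, Complex.normSq_apply, hvre, hvim]; ring
      have hn2 : ‖v + 1‖ ^ 2 = (a + 1) ^ 2 + y ^ 2 := by
        rw [Complex.sq_norm, Complex.normSq_apply]; simp [hvre, hvim]; ring
      have hq : 0 < a ^ 2 + y ^ 2 := by positivity
      have hq2 : 0 < (a + 1) ^ 2 + y ^ 2 := by positivity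
      have hl1 : Real.log ‖v‖ = Real.log (a ^ 2 + y ^ 2) / 2 := by
        rw [← hn1, Real.log_pow]; push_cast; ring
      have hl2 : Real.log ‖v + 1‖ = Real.log ((a + 1) ^ 2 + y ^ 2) / 2 := by
        rw [← hn2, Real.log_pow]; push_cast; ring
      have hinv : (v⁻¹).re = a / (a ^ 2 + y ^ 2) := by
        rw [Complex.inv_re, hvre, Complex.normSq_apply, hvre, hvim]; ring_nf
      have hlog : Real.log ((a + 1) ^ 2 + y ^ 2) - Real.log (a ^ 2 + y ^ 2) ≤
          (2 * a + 1) / (a ^ 2 + y ^ 2) := by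
        rw [← Real.log_div hq2.ne' hq.ne']
        have := Real.log_le_sub_one_of_pos (div_pos hq2 hq)
        refine this.trans (le_of_eq ?_)
        field_simp; ring
      have harc : y / (a ^ 2 + y ^ 2) ≤ Real.arctan (a / y) - Real.arctan ((a - 1) / y) := by
        have hlt : (a - 1) / y < a / y := by gcongr; linarith
        obtain ⟨c, hc, hc'⟩ := exists_deriv_eq_slope Real.arctan hlt
          Real.continuous_arctan.continuousOn
          (fun z _ => (Real.differentiableAt_arctan z).differentiableWithinAt)
        rw [Real.deriv_arctan] at hc'
        have hd : a / y - (a - 1) / y = 1 / y := by field_simp; ring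
        rw [hd, eq_div_iff (by positivity)] at hc'
        rw [← hc']
        have hc0 : 0 < c := lt_of_le_of_lt (div_nonneg (by linarith) hy.le) hc.1
        have hcy : c * y ≤ a := ((lt_div_iff₀ hy).1 hc.2).le
        rw [div_mul_div_comm, one_mul, div_le_div_iff₀ (by positivity) (by positivity)]
        nlinarith [mul_pos hc0 hy]
      have e : 1 / (2 * y) * (y / (a ^ 2 + y ^ 2)) = 1 / 2 / (a ^ 2 + y ^ 2) := by field_simp
      have h5 : 1 / 2 / (a ^ 2 + y ^ 2) ≤
          1 / (2 * y) * (Real.arctan (a / y) - Real.arctan ((a - 1) / y)) := by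
        rw [← e]; gcongr
      have h6 : (2 * a + 1) / (a ^ 2 + y ^ 2) / 2 = a / (a ^ 2 + y ^ 2) + 1 / 2 / (a ^ 2 + y ^ 2) := by
        ring
      rw [hl1] at ih
      rw [hl2, hinv]
      linarith
  have hs := (Complex.hasSum_digamma hw).tendsto_sum_nat
  have h1 : Tendsto (fun N : ℕ => Real.log N - ∑ k ∈ Finset.range N, ((w + k)⁻¹).re) atTop
      (𝓝 (Complex.digamma w).re) := by
    have h2 := ((Complex.continuous_re.tendsto _).comp hs).sub Real.tendsto_harmonic_sub_log
    rw [Complex.add_re, Complex.ofReal_re, add_sub_cancel_right] at h2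
    refine h2.congr fun N => ?_
    simp only [Function.comp, Complex.re_sum, Complex.sub_re, Finset.sum_sub_distrib, harmonic]
    push_cast
    have : ∀ k : ℕ, (((k : ℂ) + 1)⁻¹).re = ((k : ℝ) + 1)⁻¹ := by
      intro k
      rw [← Complex.ofReal_natCast, ← Complex.ofReal_one, ← Complex.ofReal_add,
        ← Complex.ofReal_inv, Complex.ofReal_re]
    simp only [this]
    ring
  refine le_of_tendsto h1 ?_
  filter_upwards [eventually_gt_atTop 0] with N hN
  have hN' : (0 : ℝ) < N := by exact_mod_cast hN
  have h2 := hsum N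
  have h3 : Real.log N ≤ Real.log ‖w + N‖ := by
    refine Real.log_le_log hN' (le_trans ?_ (Complex.re_le_norm _))
    simp; linarith
  have h4 : Real.arctan ((x + N - 1) / y) - Real.arctan ((x - 1) / y) ≤ Real.pi / 2 := by
    have := (Real.arctan_lt_pi_div_two ((x + N - 1) / y)).le
    have := Real.arctan_nonneg.2 (div_nonneg (by linarith : 0 ≤ x - 1) hy.le)
    linarith
  have h5 : 1 / (2 * y) * (Real.arctan ((x + N - 1) / y) - Real.arctan ((x - 1) / y)) ≤
      Real.pi / (4 * y) := by
    calc _ ≤ 1 / (2 * y) * (Real.pi / 2) := by gcongr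
      _ = _ := by field_simp; ring
  linarith

theorem div_le_harmonic (n : ℕ) :
    ((∑ i ∈ Finset.range n, 10 ^ 9 / (i + 1) : ℕ) : ℝ) / 10 ^ 9 ≤ (harmonic n : ℝ) := by
  rw [harmonic, Nat.cast_sum, Rat.cast_sum, Finset.sum_div]
  refine Finset.sum_le_sum fun i _ => ?_
  rw [div_le_iff₀ (by positivity), Rat.cast_inv, Rat.cast_natCast, inv_mul_eq_div]
  exact_mod_cast Nat.cast_div_le (α := ℝ) (m := 10 ^ 9) (n := i + 1)

theorem harmonic_le_div (n : ℕ) :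
    (harmonic n : ℝ) ≤ ((∑ i ∈ Finset.range n, (10 ^ 9 / (i + 1) + 1) : ℕ) : ℝ) / 10 ^ 9 := by
  rw [harmonic, Nat.cast_sum, Rat.cast_sum, Finset.sum_div]
  refine Finset.sum_le_sum fun i _ => ?_
  rw [le_div_iff₀ (by positivity), Rat.cast_inv, Rat.cast_natCast,
    inv_mul_le_iff₀ (by positivity)]
  exact_mod_cast (Nat.lt_mul_div_succ (10 ^ 9) (Nat.succ_pos i)).le

theorem Real.eulerMascheroniConstant_lt_d4 : Real.eulerMascheroniConstant < 0.5792 := by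
  have h := Real.eulerMascheroniConstant_lt_eulerMascheroniSeq' 256
  have h1 : ((∑ i ∈ Finset.range 256, (10 ^ 9 / (i + 1) + 1) : ℕ) : ℝ) ≤ (6124360000 : ℕ) :=
    Nat.cast_le.2 (by decide +kernel)
  have h2 := Real.log_two_gt_d9
  have h3 : Real.log ((256 : ℕ) : ℝ) = 8 * Real.log 2 := by
    rw [show ((256 : ℕ) : ℝ) = 2 ^ 8 by norm_num, Real.log_pow]; norm_num
  rw [Real.eulerMascheroniSeq', if_neg (by norm_num), h3] at h
  have h4 : (harmonic 256 : ℝ) ≤ (6124360000 : ℕ) / 10 ^ 9 :=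
    (harmonic_le_div 256).trans (div_le_div_of_nonneg_right h1 (by norm_num))
  norm_num only at h4
  linarith

theorem Real.eulerMascheroniConstant_gt_d4 : 0.5752 < Real.eulerMascheroniConstant := by
  have h := Real.eulerMascheroniSeq_lt_eulerMascheroniConstant 255
  have h1 : ((6120400000 : ℕ) : ℝ) ≤ (∑ i ∈ Finset.range 255, 10 ^ 9 / (i + 1) : ℕ) :=
    Nat.cast_le.2 (by decide +kernel)
  have h2 := Real.log_two_lt_d9
  have h3 : Real.log ((255 : ℕ) + 1 : ℝ) = 8 * Real.log 2 := by
    rw [show ((255 : ℕ) + 1 : ℝ) = 2 ^ 8 by norm_num, Real.log_pow]; norm_num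
  rw [Real.eulerMascheroniSeq, h3] at h
  have h4 : ((6120400000 : ℕ) : ℝ) / 10 ^ 9 ≤ (harmonic 255 : ℝ) :=
    (div_le_div_of_nonneg_right h1 (by norm_num)).trans (div_le_harmonic 255)
  norm_num only at h4
  linarith

set_option exponentiation.threshold 3000 in
theorem log_four_mul_pi_gt : (2.531 : ℝ) < Real.log (4 * Real.pi) := by
  rw [Real.lt_log_iff_exp_lt (by positivity)]
  have h := Real.exp_one_lt_d9
  have h2 := Real.pi_gt_d6
  have h3 : Real.exp 2.531 ^ 1000 = Real.exp 1 ^ 2531 := by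
    rw [← Real.exp_nat_mul, ← Real.exp_nat_mul]; norm_num
  refine lt_of_pow_lt_pow_left₀ 1000 (by positivity) ?_
  rw [h3]
  calc Real.exp 1 ^ 2531 < 2.7182818286 ^ 2531 := by gcongr
    _ < 12.5663 ^ 1000 := by norm_num
    _ < _ := by gcongr; linarith

theorem logDeriv_centredXi_sub_half {s : ℂ} (hs : 1 < s.re) :
    logDeriv centredXi (s - 1 / 2) = 1 / (s - 1) + logDeriv riemannZeta s
      - Complex.log Real.pi / 2 + Complex.digamma (s / 2 + 1) / 2 := by
  have hs0 : s ≠ 0 := by rintro rfl; norm_num at hs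
  have hs1 : s ≠ 1 := by rintro rfl; norm_num at hs
  have hpi : (Real.pi : ℂ) ≠ 0 := by exact_mod_cast Real.pi_ne_zero
  have hz : riemannZeta s ≠ 0 := riemannZeta_ne_zero_of_one_le_re hs.le
  have hm : ∀ m : ℕ, s / 2 ≠ -(m : ℂ) := fun m h => by
    have h1 := congrArg Complex.re h
    rw [Complex.div_ofNat_re] at h1
    simp at h1
    have := Nat.cast_nonneg (α := ℝ) m
    linarith
  have hev : (fun w : ℂ => centredXi (w - 1 / 2)) =ᶠ[𝓝 s]
      fun w => (w * (w - 1)) * (riemannZeta w * ((Real.pi : ℂ) ^ (-w / 2) * Complex.Gamma (w / 2))) := by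
    have : {w : ℂ | 1 < w.re} ∈ 𝓝 s :=
      (isOpen_lt continuous_const Complex.continuous_re).mem_nhds hs
    filter_upwards [this] with w hw
    have hw : 1 < w.re := hw
    rw [centredXi_eq, ← Complex.Gammaℝ_def]
    · ring_nf
    · simp; linarith
    · intro h
      rw [show w = 1 by linear_combination h] at hw
      norm_num at hw
  have h1 : logDeriv centredXi (s - 1 / 2) = logDeriv (fun w : ℂ => centredXi (w - 1 / 2)) s := by
    have := logDeriv_comp (f := centredXi) (g := fun w : ℂ => w - 1 / 2) (x := s)
      (differentiable_centredXi _) (by fun_prop)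
    simp only [deriv_sub_const, deriv_id'', mul_one] at this
    exact this.symm
  have hG : DifferentiableAt ℂ (fun w : ℂ => Complex.Gamma (w / 2)) s :=
    (Complex.differentiableAt_Gamma _ hm).comp s (by fun_prop)
  have hP : DifferentiableAt ℂ (fun w : ℂ => (Real.pi : ℂ) ^ (-w / 2)) s := by
    refine DifferentiableAt.const_cpow (by fun_prop) (Or.inl hpi)
  have hZ : DifferentiableAt ℂ riemannZeta s := differentiableAt_riemannZeta hs1
  have hG0 : Complex.Gamma (s / 2) ≠ 0 := Complex.Gamma_ne_zero hm
  have hP0 : (Real.pi : ℂ) ^ (-s / 2) ≠ 0 := by simp [Complex.cpow_eq_zero_iff, hpi]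
  have e1 : logDeriv (fun w : ℂ => w * (w - 1)) s = 1 / s + 1 / (s - 1) := by
    rw [logDeriv_mul (f := fun w : ℂ => w) (g := fun w : ℂ => w - 1) s hs0 (sub_ne_zero.2 hs1)
      (by fun_prop) (by fun_prop)]
    simp [logDeriv_apply]
  have e2 : logDeriv (fun w : ℂ => (Real.pi : ℂ) ^ (-w / 2)) s = -Complex.log Real.pi / 2 := by
    have hd : HasDerivAt (fun w : ℂ => -w / 2) (-1 / 2) s := ((hasDerivAt_id s).neg).div_const 2
    rw [logDeriv_apply, (hd.const_cpow (Or.inl hpi)).deriv]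
    field_simp
  have e3 : logDeriv (fun w : ℂ => Complex.Gamma (w / 2)) s = Complex.digamma (s / 2) / 2 := by
    have hd : HasDerivAt (fun w : ℂ => w / 2) (1 / 2) s := (hasDerivAt_id s).div_const 2
    have := logDeriv_comp (f := Complex.Gamma) (g := fun w : ℂ => w / 2) (x := s)
      (Complex.differentiableAt_Gamma _ hm) hd.differentiableAt
    rw [hd.deriv] at this
    rw [show (fun w : ℂ => Complex.Gamma (w / 2)) = Complex.Gamma ∘ fun w : ℂ => w / 2 from rfl,
      this, Complex.digamma]; ring
  rw [h1, (logDeriv_congr_nhds hev).eq_of_nhds,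
    logDeriv_mul (f := fun w : ℂ => w * (w - 1))
      (g := fun w : ℂ => riemannZeta w * ((Real.pi : ℂ) ^ (-w / 2) * Complex.Gamma (w / 2)))
      s (mul_ne_zero hs0 (sub_ne_zero.2 hs1))
      (mul_ne_zero hz (mul_ne_zero hP0 hG0)) (by fun_prop) (hZ.mul (hP.mul hG)),
    logDeriv_mul (f := riemannZeta)
      (g := fun w : ℂ => (Real.pi : ℂ) ^ (-w / 2) * Complex.Gamma (w / 2)) s hz (mul_ne_zero hP0 hG0) hZ (hP.mul hG),
    logDeriv_mul (f := fun w : ℂ => (Real.pi : ℂ) ^ (-w / 2))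
      (g := fun w : ℂ => Complex.Gamma (w / 2)) s hP0 hG0 hP hG, e1, e2, e3, Complex.digamma_apply_add_one _ hm]
  field_simp
  ring

theorem hasSum_xiMult_div : HasSum (fun α : ℂ => (xiMult α : ℂ) / (1 / 4 - α ^ 2))
    ((2 + Real.eulerMascheroniConstant - Real.log (4 * Real.pi) : ℝ) : ℂ) := by
  have h := hasSum_logDeriv_centredXi (z := 1 / 2) (by rw [centredXi_half]; exact one_ne_zero)
  have hd : HasDerivAt centredXi (completedRiemannZeta₀ 1) (1 / 2) := by
    have h0 : HasDerivAt (fun z : ℂ => completedRiemannZeta₀ (1 / 2 + z))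
        (deriv (fun z : ℂ => completedRiemannZeta₀ (1 / 2 + z)) (1 / 2)) (1 / 2) := by
      have := differentiable_completedZeta₀
      exact DifferentiableAt.hasDerivAt (by fun_prop)
    have h1 : HasDerivAt (fun z : ℂ => z ^ 2 - 1 / 4) (2 * (1 / 2)) (1 / 2) := by
      simpa using! ((hasDerivAt_id (1 / 2 : ℂ)).pow 2).sub_const (1 / 4)
    have h2 := (h1.mul h0).add_const 1
    convert! h2 using 1
    norm_num
  rw [logDeriv_apply, hd.deriv, centredXi_half, div_one, completedRiemannZeta₀_one] at h
  convert! h.mul_left 2 using 1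
  · funext α; ring
  · push_cast [Complex.ofReal_log (by positivity : (0 : ℝ) ≤ 4 * Real.pi)]
    ring

theorem quarter_sub_sq_re (α : ℂ) : (1 / 4 - α ^ 2).re = 1 / 4 - α.re ^ 2 + α.im ^ 2 := by
  simp [pow_two]; ring

theorem normSq_quarter_sub_sq (α : ℂ) : Complex.normSq (1 / 4 - α ^ 2) =
    (1 / 4 - α.re ^ 2 + α.im ^ 2) ^ 2 + 4 * α.re ^ 2 * α.im ^ 2 := by
  rw [Complex.normSq_apply]; simp [pow_two]; ring

theorem two_add_gamma_sub_log_lt :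
    2 + Real.eulerMascheroniConstant - Real.log (4 * Real.pi) < 0.0482 := by
  have := log_four_mul_pi_gt
  have := Real.eulerMascheroniConstant_lt_d4
  linarith

theorem hasSum_xiMult_mul_re_inv : HasSum (fun α : ℂ => (xiMult α : ℝ) * ((1 / 4 - α ^ 2)⁻¹).re)
    (2 + Real.eulerMascheroniConstant - Real.log (4 * Real.pi)) := by
  have h := Complex.hasSum_re hasSum_xiMult_div
  rw [Complex.ofReal_re] at h
  convert! h using 1
  funext α
  generalize (1 / 4 - α ^ 2 : ℂ) = w
  rw [div_eq_mul_inv, ← Complex.ofReal_natCast, Complex.re_ofReal_mul]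

theorem sq_re_lt_of_xiMult_ne_zero {α : ℂ} (h : xiMult α ≠ 0) : α.re ^ 2 < 1 / 4 := by
  have := sq_lt_sq' (abs_lt.1 (abs_re_lt_of_xiMult_ne_zero h)).1
    (abs_lt.1 (abs_re_lt_of_xiMult_ne_zero h)).2
  linarith

theorem xiMult_mul_re_inv_nonneg (α : ℂ) : 0 ≤ (xiMult α : ℝ) * ((1 / 4 - α ^ 2)⁻¹).re := by
  by_cases h : xiMult α = 0
  · simp [h]
  · have := sq_re_lt_of_xiMult_ne_zero h
    rw [Complex.inv_re, quarter_sub_sq_re]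
    have : 0 ≤ 1 / 4 - α.re ^ 2 + α.im ^ 2 := by nlinarith
    have := Complex.normSq_nonneg (1 / 4 - α ^ 2)
    positivity

theorem sum_re_inv_lt {s : Finset ℂ} (hs : ∀ α ∈ s, xiMult α ≠ 0) :
    ∑ α ∈ s, ((1 / 4 - α ^ 2)⁻¹).re < 0.0482 := by
  refine lt_of_le_of_lt ?_ two_add_gamma_sub_log_lt
  refine le_trans (Finset.sum_le_sum fun α hα => ?_)
    (sum_le_hasSum s (fun α _ => xiMult_mul_re_inv_nonneg α) hasSum_xiMult_mul_re_inv)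
  have h1 : (1 : ℝ) ≤ xiMult α := by exact_mod_cast Nat.one_le_iff_ne_zero.2 (hs α hα)
  have h2 := xiMult_mul_re_inv_nonneg α
  have h3 : 0 ≤ ((1 / 4 - α ^ 2)⁻¹).re := nonneg_of_mul_nonneg_right h2 (by linarith)
  nlinarith

open ComplexConjugate in
theorem sq_im_ge_of_xiMult_ne_zero {α : ℂ} (h : xiMult α ≠ 0) :
    41 ≤ α.im ^ 2 ∧ (α.re ≠ 0 → 81 ≤ α.im ^ 2) := by
  have hr := sq_re_lt_of_xiMult_ne_zero h
  have hn : xiMult (-α) ≠ 0 := by rwa [xiMult_neg]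
  set X := 1 / 4 - α.re ^ 2 + α.im ^ 2 with hX
  have hX0 : 0 < X := by nlinarith
  have hinv : ((1 / 4 - α ^ 2)⁻¹).re = X / (X ^ 2 + 4 * α.re ^ 2 * α.im ^ 2) := by
    rw [Complex.inv_re, quarter_sub_sq_re, normSq_quarter_sub_sq]
  have hα0 : α ≠ -α := by
    intro h0
    have h1 : α = 0 := by linear_combination h0 / 2
    have := sum_re_inv_lt (s := {α}) (by simpa using h)
    rw [h1] at this
    norm_num at this
  have h2 := sum_re_inv_lt (s := {α, -α}) (by simp [h, hn])
  rw [Finset.sum_pair hα0, neg_sq, hinv] at h2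
  have hden : 0 < X ^ 2 + 4 * α.re ^ 2 * α.im ^ 2 := by positivity
  have hle : X ^ 2 + 4 * α.re ^ 2 * α.im ^ 2 ≤ X ^ 2 + X := by
    nlinarith [sq_nonneg α.im]
  have h3 : 1 / (X + 1) ≤ X / (X ^ 2 + 4 * α.re ^ 2 * α.im ^ 2) := by
    rw [div_le_div_iff₀ (by linarith) hden]; nlinarith
  have him : α.im ≠ 0 := by
    intro h0
    have h4 : 1 / (X + 1) < 0.0241 := by linarith
    rw [div_lt_iff₀ (by linarith)] at h4
    rw [h0] at hX
    nlinarith [sq_nonneg α.re]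
  by_cases h0 : α.re = 0
  · refine ⟨?_, fun h => absurd h0 h⟩
    have h4 : X / (X ^ 2 + 4 * α.re ^ 2 * α.im ^ 2) = 1 / X := by rw [h0]; field_simp; ring
    rw [h4] at h2
    have h5 : 1 / X < 0.0241 := by linarith
    rw [div_lt_iff₀ hX0] at h5
    rw [h0] at hX
    nlinarith
  · have h81 : 81 ≤ α.im ^ 2 := by
      have hc : xiMult (conj α) ≠ 0 := by rwa [xiMult_conj]
      have hcn : xiMult (-conj α) ≠ 0 := by rwa [xiMult_neg]
      have hd1 : α ≠ conj α := fun h1 => him (by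
        have := congrArg Complex.im h1; simp at this; linarith)
      have hd2 : α ≠ -conj α := fun h1 => h0 (by
        have := congrArg Complex.re h1; simp at this; linarith)
      have hd3 : -α ≠ conj α := fun h1 => h0 (by
        have := congrArg Complex.re h1; simp at this; linarith)
      have hd4 : -α ≠ -conj α := fun h1 => hd1 (neg_injective h1)
      have hd5 : conj α ≠ -conj α := fun h1 => h0 (by
        have := congrArg Complex.re h1; simp at this; linarith)
      have h5 := sum_re_inv_lt (s := {α, -α, conj α, -conj α}) (by simp [h, hn, hc, hcn])
      rw [Finset.sum_insert (by simp [hα0, hd1, hd2]), Finset.sum_insert (by simp [hd3, hd4]),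
        Finset.sum_pair hd5, neg_sq, neg_sq] at h5
      have h6 : ((1 / 4 - conj α ^ 2)⁻¹).re = ((1 / 4 - α ^ 2)⁻¹).re := by
        rw [← Complex.conj_re, map_inv₀, map_sub, map_pow, Complex.conj_conj, map_div₀, map_one,
          map_ofNat]
      rw [h6, hinv] at h5
      have h7 : 1 / (X + 1) < 0.01205 := by linarith
      rw [div_lt_iff₀ (by linarith)] at h7
      nlinarith [sq_nonneg α.re]
    exact ⟨by linarith, fun _ => h81⟩

theorem norm_inv_quarter_sub_sq_le {α : ℂ} (h : xiMult α ≠ 0) :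
    ‖(1 / 4 - α ^ 2)⁻¹‖ ≤ 1.0122 * ((1 / 4 - α ^ 2)⁻¹).re := by
  have hr := sq_re_lt_of_xiMult_ne_zero h
  have ht := (sq_im_ge_of_xiMult_ne_zero h).1
  rw [norm_inv, Complex.inv_re, quarter_sub_sq_re, ← Complex.sq_norm]
  have hn := normSq_quarter_sub_sq α
  rw [← Complex.sq_norm] at hn
  set X := 1 / 4 - α.re ^ 2 + α.im ^ 2 with hX
  have hX0 : 41 ≤ X := by linarith
  set N := ‖1 / 4 - α ^ 2‖
  have hN : 0 < N := by
    have : 0 ≤ N := norm_nonneg _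
    refine lt_of_le_of_ne this fun h => ?_
    rw [← h] at hn
    nlinarith [mul_nonneg (sq_nonneg α.re) (sq_nonneg α.im)]
  have h1 : N ≤ 1.0122 * X := by
    refine le_of_sq_le_sq ?_ (by linarith)
    rw [hn]
    nlinarith [sq_nonneg α.im]
  rw [← mul_div_assoc, le_div_iff₀ (by positivity)]
  calc N⁻¹ * N ^ 2 = N := by field_simp
    _ ≤ _ := h1

theorem xiMult_mul_norm_le (α : ℂ) : (xiMult α : ℝ) * ‖(1 / 4 - α ^ 2)⁻¹‖ ≤
    1.0122 * ((xiMult α : ℝ) * ((1 / 4 - α ^ 2)⁻¹).re) := by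
  by_cases h : xiMult α = 0
  · simp [h]
  · have := mul_le_mul_of_nonneg_left (norm_inv_quarter_sub_sq_le h) (Nat.cast_nonneg (xiMult α))
    linarith

theorem summable_xiMult_mul_norm :
    Summable fun α : ℂ => (xiMult α : ℝ) * ‖(1 / 4 - α ^ 2)⁻¹‖ :=
  Summable.of_nonneg_of_le (fun _ => by positivity) xiMult_mul_norm_le
    (hasSum_xiMult_mul_re_inv.summable.mul_left _)

theorem tsum_xiMult_mul_norm_le :
    ∑' α : ℂ, (xiMult α : ℝ) * ‖(1 / 4 - α ^ 2)⁻¹‖ ≤ 0.0488 := by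
  have h := hasSum_xiMult_mul_re_inv.mul_left 1.0122
  refine (summable_xiMult_mul_norm.hasSum.summable.tsum_le_tsum xiMult_mul_norm_le
    h.summable).trans ?_
  rw [h.tsum_eq]
  have := two_add_gamma_sub_log_lt
  linarith

/-- `f` has an absolutely convergent Laplace transform at `w`, with value `L`. -/
def HasLaplace (f : ℝ → ℂ) (w L : ℂ) : Prop :=
  MeasureTheory.IntegrableOn (fun v : ℝ => Complex.exp (-w * v) * f v) (Ioi 0) ∧
    ∫ v : ℝ in Ioi 0, Complex.exp (-w * v) * f v = L

theorem HasLaplace.add {f g : ℝ → ℂ} {w L M : ℂ} (hf : HasLaplace f w L) (hg : HasLaplace g w M) :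
    HasLaplace (fun v => f v + g v) w (L + M) := by
  unfold HasLaplace
  simp only [mul_add]
  exact ⟨hf.1.add hg.1, by rw [MeasureTheory.integral_add hf.1 hg.1, hf.2, hg.2]⟩

theorem HasLaplace.const_mul {f : ℝ → ℂ} {w L : ℂ} (hf : HasLaplace f w L) (c : ℂ) :
    HasLaplace (fun v => c * f v) w (c * L) := by
  unfold HasLaplace
  simp only [mul_left_comm _ c]
  exact ⟨hf.1.const_mul c, by rw [MeasureTheory.integral_const_mul, hf.2]⟩

theorem HasLaplace.sub {f g : ℝ → ℂ} {w L M : ℂ} (hf : HasLaplace f w L) (hg : HasLaplace g w M) :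
    HasLaplace (fun v => f v - g v) w (L - M) := by
  have := hf.add (hg.const_mul (-1))
  simpa only [neg_one_mul, ← sub_eq_add_neg] using this

theorem HasLaplace.congr {f g : ℝ → ℂ} {w L : ℂ} (hf : HasLaplace f w L)
    (h : ∀ v, 0 < v → f v = g v) : HasLaplace g w L := by
  have h1 : EqOn (fun v : ℝ => Complex.exp (-w * v) * f v)
      (fun v : ℝ => Complex.exp (-w * v) * g v) (Ioi 0) := fun v hv => by simp only [h v hv]
  exact ⟨hf.1.congr_fun h1 measurableSet_Ioi,
    by rw [← MeasureTheory.setIntegral_congr_fun measurableSet_Ioi h1, hf.2]⟩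

theorem hasLaplace_exp {c w : ℂ} (h : c.re < w.re) :
    HasLaplace (fun v => Complex.exp (c * v)) w (w - c)⁻¹ := by
  have h1 : (c - w).re < 0 := by simpa using h
  have h2 := integral_exp_mul_complex_Ioi h1 0
  have h3 := integrableOn_exp_mul_complex_Ioi h1 0
  have h4 : (fun v : ℝ => Complex.exp ((c - w) * v)) =
      fun v : ℝ => Complex.exp (-w * v) * Complex.exp (c * v) := by
    funext v; rw [← Complex.exp_add]; ring_nf
  rw [h4] at h3
  simp only [h4] at h2
  refine ⟨h3, h2.trans ?_⟩
  rw [Complex.ofReal_zero, mul_zero, Complex.exp_zero, ← neg_sub w c, neg_div_neg_eq, one_div]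

theorem hasLaplace_one {w : ℂ} (h : 0 < w.re) : HasLaplace (fun _ => 1) w w⁻¹ := by
  simpa using hasLaplace_exp (c := 0) (w := w) (by simpa using h)

theorem hasLaplace_id {w : ℂ} (h : 0 < w.re) : HasLaplace (fun v => (v : ℂ)) w (w ^ 2)⁻¹ := by
  have hw : w ≠ 0 := by rintro rfl; simp at h
  have hi : MeasureTheory.IntegrableOn (fun v : ℝ => Complex.exp (-w * v) * v) (Ioi 0) := by
    have h4 := integrableOn_rpow_mul_exp_neg_mul_rpow (p := 1) (s := 1) (b := w.re)
      (by norm_num) (by norm_num) h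
    refine MeasureTheory.Integrable.mono' h4 ?_ ?_
    · exact Continuous.aestronglyMeasurable (by fun_prop)
    · filter_upwards [MeasureTheory.ae_restrict_mem measurableSet_Ioi] with v hv
      have hv : 0 < v := hv
      rw [norm_mul, Complex.norm_exp]
      simp [abs_of_pos hv, mul_comm]
  refine ⟨hi, ?_⟩
  have hd : ∀ v ∈ Ici (0 : ℝ), HasDerivAt
      (fun v : ℝ => -(Complex.exp (-w * v) * (v / w + (w ^ 2)⁻¹))) (Complex.exp (-w * v) * v) v := by
    intro v _
    have h1 : HasDerivAt (fun v : ℝ => (v : ℂ)) 1 v := Complex.ofRealCLM.hasDerivAt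
    have h2 := ((h1.const_mul (-w)).cexp.mul ((h1.div_const w).add_const (w ^ 2)⁻¹)).neg
    convert! h2 using 1
    field_simp
    ring
  have ht : Tendsto (fun v : ℝ => -(Complex.exp (-w * v) * (v / w + (w ^ 2)⁻¹))) atTop (𝓝 0) := by
    rw [tendsto_zero_iff_norm_tendsto_zero]
    have t1 := (tendsto_rpow_mul_exp_neg_mul_atTop_nhds_zero 1 w.re h).mul_const ‖w‖⁻¹
    have t2 := (tendsto_rpow_mul_exp_neg_mul_atTop_nhds_zero 0 w.re h).mul_const ‖(w ^ 2)⁻¹‖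
    have t3 := t1.add t2
    rw [zero_mul, zero_mul, add_zero] at t3
    refine squeeze_zero' (Eventually.of_forall fun _ => norm_nonneg _) ?_ t3
    filter_upwards [eventually_gt_atTop 0] with v hv
    rw [norm_neg, norm_mul, Complex.norm_exp]
    have : ‖(v : ℂ) / w + (w ^ 2)⁻¹‖ ≤ v * ‖w‖⁻¹ + ‖(w ^ 2)⁻¹‖ := by
      refine (norm_add_le _ _).trans ?_
      rw [norm_div, Complex.norm_real, Real.norm_of_nonneg hv.le, div_eq_mul_inv]
    refine (mul_le_mul_of_nonneg_left this (Real.exp_nonneg _)).trans_eq ?_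
    simp
    ring
  rw [MeasureTheory.integral_Ioi_of_hasDerivAt_of_tendsto' hd hi ht]
  simp

theorem HasLaplace.of_hasSum {ι : Type*} [Countable ι] {f : ι → ℝ → ℂ} {F : ℝ → ℂ} {w : ℂ}
    {L : ι → ℂ} {M : ℂ} (hF : ContinuousOn F (Ici 0)) (h : ∀ i, HasLaplace (f i) w (L i))
    (hs : Summable fun i => ∫ v : ℝ in Ioi 0, ‖Complex.exp (-w * v) * f i v‖)
    (hsum : ∀ v, 0 < v → HasSum (fun i => f i v) (F v)) (hL : HasSum L M) : HasLaplace F w M := by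
  have h1 := MeasureTheory.hasSum_integral_of_summable_integral_norm (fun i => (h i).1) hs
  have h2 : EqOn (fun v : ℝ => ∑' i, Complex.exp (-w * v) * f i v)
      (fun v : ℝ => Complex.exp (-w * v) * F v) (Ioi 0) := fun v hv =>
    ((hsum v hv).mul_left _).tsum_eq
  constructor
  · refine ⟨(ContinuousOn.mul (by fun_prop) (hF.mono Ioi_subset_Ici_self)).aestronglyMeasurable
      measurableSet_Ioi, ?_⟩
    have h3 : ∀ i, AEMeasurable (fun v : ℝ => ‖Complex.exp (-w * v) * f i v‖ₑ)
        (MeasureTheory.volume.restrict (Ioi 0)) := fun i => (h i).1.1.enorm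
    have h4 := MeasureTheory.lintegral_tsum h3
    refine lt_of_le_of_lt (b := ∫⁻ v : ℝ in Ioi 0, ∑' i, ‖Complex.exp (-w * v) * f i v‖ₑ) ?_ ?_
    · refine MeasureTheory.lintegral_mono_ae ?_
      filter_upwards [MeasureTheory.ae_restrict_mem measurableSet_Ioi] with v hv
      have h2v : ∑' i, Complex.exp (-w * v) * f i v = Complex.exp (-w * v) * F v := h2 hv
      rw [← h2v]
      exact enorm_tsum_le_tsum_enorm
    · rw [h4]
      have h5 : ∀ i, ∫⁻ v : ℝ in Ioi 0, ‖Complex.exp (-w * v) * f i v‖ₑ =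
          ENNReal.ofReal (∫ v : ℝ in Ioi 0, ‖Complex.exp (-w * v) * f i v‖) := fun i =>
        (MeasureTheory.ofReal_integral_norm_eq_lintegral_enorm (h i).1).symm
      simp only [h5]
      exact hs.tsum_ofReal_lt_top
  · rw [← MeasureTheory.setIntegral_congr_fun measurableSet_Ioi h2]
    refine h1.unique ?_
    simp only [(h _).2]
    exact hL

theorem HasLaplace.eq_zero_of_continuous {F : ℝ → ℂ} (hF : Continuous F) (h0 : F 0 = 0)
    (h : ∀ w : ℂ, w.re = 1 → HasLaplace F w 0) {v : ℝ} (hv : 0 ≤ v) : F v = 0 := by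
  set G : ℝ → ℂ := (Ioi (0 : ℝ)).indicator fun v => Complex.exp (-v) * F v with hG
  have hGc : Continuous G := by
    have : G = fun v : ℝ => if v ≤ 0 then 0 else Complex.exp (-v) * F v := by
      funext x
      by_cases hx : x ≤ 0
      · simp [hG, hx]
      · simp [hG, hx, lt_of_not_ge hx]
    rw [this]
    refine Continuous.if_le continuous_const (by fun_prop) continuous_id continuous_const ?_
    rintro x rfl
    simp [h0]
  have hGi : MeasureTheory.Integrable G := by
    rw [hG, MeasureTheory.integrable_indicator_iff measurableSet_Ioi]
    simpa using (h 1 (by simp)).1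
  have hFG : FourierTransform.fourier G = 0 := by
    funext ξ
    rw [Real.fourier_real_eq_integral_exp_smul]
    have h1 := (h (1 + 2 * Real.pi * ξ * Complex.I) (by simp)).2
    rw [← MeasureTheory.integral_indicator measurableSet_Ioi] at h1
    refine Eq.trans ?_ h1
    refine MeasureTheory.integral_congr_ae (Eventually.of_forall fun x => ?_)
    by_cases hx : 0 < x
    · simp only [hG, Set.indicator_of_mem (show x ∈ Ioi (0 : ℝ) from hx), smul_eq_mul]
      rw [← mul_assoc, ← Complex.exp_add]
      congr 2
      push_cast; ring
    · simp only [hG, Set.indicator_of_notMem (show x ∉ Ioi (0 : ℝ) from hx), smul_zero]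
  have h2 := hGc.fourierInv_fourier_eq hGi (by rw [hFG]; exact MeasureTheory.integrable_zero _ _ _)
  have h3 : G = 0 := by
    rw [← h2, hFG]; funext ξ
    rw [Real.fourierInv_eq]
    simp
  rcases hv.eq_or_lt with rfl | hv
  · exact h0
  · have := congrFun h3 v
    simp only [hG, Set.indicator_of_mem (show v ∈ Ioi (0 : ℝ) from hv)] at this
    simpa using this

theorem HasLaplace.eq_zero {F : ℝ → ℂ} (hF : ContinuousOn F (Ici 0)) (h0 : F 0 = 0)
    (h : ∀ w : ℂ, w.re = 1 → HasLaplace F w 0) {v : ℝ} (hv : 0 ≤ v) : F v = 0 := by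
  have h1 : Continuous fun x : ℝ => F (max x 0) :=
    hF.comp_continuous (by fun_prop) fun x => le_max_right x 0
  have h2 := HasLaplace.eq_zero_of_continuous h1 (by simpa using h0)
    (fun w hw => (h w hw).congr fun v hv => by rw [max_eq_left hv.le]) hv
  rwa [max_eq_left hv] at h2

theorem integral_norm_exp_mul_le {f : ℝ → ℂ} {w L : ℂ} (hw : w.re = 1) (hf : HasLaplace f w L)
    {b : ℝ} (hb : ∀ v, 0 < v → ‖f v‖ ≤ b) :
    ∫ v : ℝ in Ioi 0, ‖Complex.exp (-w * v) * f v‖ ≤ b := by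
  have h1 : ∫ v : ℝ in Ioi 0, b * Real.exp ((-1) * v) = b := by
    rw [MeasureTheory.integral_const_mul, integral_exp_mul_Ioi (by norm_num)]
    simp
  rw [← h1]
  refine MeasureTheory.setIntegral_mono_on hf.1.norm
    ((integrableOn_exp_mul_Ioi (by norm_num) 0).const_mul b) measurableSet_Ioi fun v hv => ?_
  rw [norm_mul, Complex.norm_exp, mul_comm]
  have : (-w * (v : ℂ)).re = (-1) * v := by simp [hw]
  rw [this]
  exact mul_le_mul_of_nonneg_right (hb v hv) (Real.exp_nonneg _)

/-- The logarithmic mean `∑_{n ≤ e^v} Λ(n) (1/n - e^{-v})`. -/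
noncomputable def mangoldtMean (v : ℝ) : ℝ := ∑' n : ℕ, Λ n * max ((n : ℝ)⁻¹ - Real.exp (-v)) 0

theorem mangoldt_mul_max_eq_zero {v : ℝ} {N n : ℕ} (h : Real.exp v ≤ N) (hn : n ∉ Finset.range N) :
    Λ n * max ((n : ℝ)⁻¹ - Real.exp (-v)) 0 = 0 := by
  have h1 : (N : ℝ) ≤ n := by exact_mod_cast not_lt.1 (Finset.mem_range.not.1 hn)
  rw [max_eq_right, mul_zero]
  rw [Real.exp_neg, sub_nonpos]
  exact inv_anti₀ (Real.exp_pos v) (h.trans h1)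

theorem mangoldtMean_eq_sum {v : ℝ} {N : ℕ} (h : Real.exp v ≤ N) :
    mangoldtMean v = ∑ n ∈ Finset.range N, Λ n * max ((n : ℝ)⁻¹ - Real.exp (-v)) 0 :=
  tsum_eq_sum fun _ hn => mangoldt_mul_max_eq_zero h hn

theorem hasSum_mangoldtMean (v : ℝ) :
    HasSum (fun n : ℕ => Λ n * max ((n : ℝ)⁻¹ - Real.exp (-v)) 0) (mangoldtMean v) := by
  obtain ⟨N, hN⟩ := exists_nat_ge (Real.exp v)
  rw [mangoldtMean_eq_sum hN]
  exact hasSum_sum_of_ne_finset_zero fun _ hn => mangoldt_mul_max_eq_zero hN hn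

theorem continuous_mangoldtMean : Continuous mangoldtMean := by
  rw [continuous_iff_continuousAt]
  intro v
  obtain ⟨N, hN⟩ := exists_nat_ge (Real.exp (v + 1))
  have h : mangoldtMean =ᶠ[𝓝 v]
      fun x => ∑ n ∈ Finset.range N, Λ n * max ((n : ℝ)⁻¹ - Real.exp (-x)) 0 := by
    filter_upwards [Iio_mem_nhds (lt_add_one v)] with x hx
    exact mangoldtMean_eq_sum ((Real.exp_le_exp.2 (le_of_lt hx)).trans hN)
  refine ContinuousAt.congr ?_ h.symm
  fun_prop

theorem hasLaplace_max_exp_sub_exp {l : ℝ} (hl : 0 ≤ l) {w : ℂ} (hw : 0 < w.re) :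
    HasLaplace (fun v => ((max (Real.exp (-l) - Real.exp (-v)) 0 : ℝ) : ℂ)) w
      (Complex.exp (-(w + 1) * l) / (w * (w + 1))) := by
  have hw0 : w ≠ 0 := by rintro rfl; simp at hw
  have hw1 : w + 1 ≠ 0 := by
    intro h; have := congrArg Complex.re h; simp at this; linarith
  have e1 : (fun v : ℝ => Complex.exp (-w * v) * ((max (Real.exp (-l) - Real.exp (-v)) 0 : ℝ) : ℂ)) =
      (Ioi l).indicator fun v : ℝ => Complex.exp (-l) * Complex.exp (-w * v) -
        Complex.exp (-(w + 1) * v) := by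
    funext v
    by_cases hv : l < v
    · rw [Set.indicator_of_mem (show v ∈ Ioi l from hv), max_eq_left]
      · push_cast
        rw [mul_sub, mul_comm (Complex.exp (-l)), ← Complex.exp_add (-w * v) (-v)]
        ring_nf
      · rw [sub_nonneg]; exact Real.exp_le_exp.2 (by linarith)
    · rw [Set.indicator_of_notMem (show v ∉ Ioi l from hv), max_eq_right]
      · simp
      · rw [sub_nonpos]; exact Real.exp_le_exp.2 (by linarith [not_lt.1 hv])
  have r1 : (-w).re < 0 := by simpa using hw
  have r2 : (-(w + 1)).re < 0 := by simp; linarith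
  have i1 := integrableOn_exp_mul_complex_Ioi r1 l
  have i2 := integrableOn_exp_mul_complex_Ioi r2 l
  have hsub : Ioi (0 : ℝ) ∩ Ioi l = Ioi l := by
    rw [Ioi_inter_Ioi, max_eq_right hl]
  have i3 : MeasureTheory.IntegrableOn (fun v : ℝ => Complex.exp (-l) * Complex.exp (-w * v) -
        Complex.exp (-(w + 1) * v)) (Ioi l) := (i1.const_mul _).sub i2
  constructor
  · rw [e1]
    exact ((MeasureTheory.integrable_indicator_iff measurableSet_Ioi).2 i3).integrableOn
  · rw [e1, MeasureTheory.setIntegral_indicator measurableSet_Ioi, hsub,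
      MeasureTheory.integral_sub (i1.const_mul _) i2, MeasureTheory.integral_const_mul,
      integral_exp_mul_complex_Ioi r1, integral_exp_mul_complex_Ioi r2]
    have : Complex.exp (-(w + 1) * l) = Complex.exp (-l) * Complex.exp (-w * l) := by
      rw [← Complex.exp_add]; ring_nf
    rw [this]
    field_simp
    ring

theorem hasLaplace_mangoldt_term {w : ℂ} (hw : 0 < w.re) (n : ℕ) :
    HasLaplace (fun v => ((Λ n * max ((n : ℝ)⁻¹ - Real.exp (-v)) 0 : ℝ) : ℂ)) w
      (LSeries.term (fun n => (Λ n : ℂ)) (w + 1) n / (w * (w + 1))) := by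
  rcases Nat.eq_zero_or_pos n with rfl | hn
  · simp [HasLaplace]
  · have h := (hasLaplace_max_exp_sub_exp (Real.log_natCast_nonneg n) hw).const_mul (Λ n : ℂ)
    have hn' : (0 : ℝ) < n := by exact_mod_cast hn
    rw [Real.exp_neg, Real.exp_log hn'] at h
    have e : LSeries.term (fun n => (Λ n : ℂ)) (w + 1) n / (w * (w + 1)) =
        (Λ n : ℂ) * (Complex.exp (-(w + 1) * Real.log n) / (w * (w + 1))) := by
      rw [LSeries.term_of_ne_zero hn.ne', Complex.cpow_def_of_ne_zero (by exact_mod_cast hn.ne'),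
        neg_mul, Complex.exp_neg, Complex.natCast_log, mul_comm (w + 1)]
      simp only [div_eq_mul_inv, mul_inv]
      ring
    rw [e]
    simpa only [Complex.ofReal_mul] using h

theorem hasLaplace_mangoldtMean {w : ℂ} (hw : 0 < w.re) :
    HasLaplace (fun v => (mangoldtMean v : ℂ)) w (-logDeriv riemannZeta (w + 1) / (w * (w + 1))) := by
  have hs : ∀ {w : ℂ}, 0 < w.re → 1 < (w + 1).re := fun h => by simpa using h
  have hL : ∀ {w : ℂ}, 0 < w.re →
      HasSum (fun n => LSeries.term (fun n => (Λ n : ℂ)) (w + 1) n / (w * (w + 1)))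
        (-logDeriv riemannZeta (w + 1) / (w * (w + 1))) := fun {w} hw => by
    have h1 := (ArithmeticFunction.LSeriesSummable_vonMangoldt (hs hw)).hasSum
    have h2 := ArithmeticFunction.LSeries_vonMangoldt_eq_deriv_riemannZeta_div (hs hw)
    rw [logDeriv_apply, ← neg_div, ← h2]
    exact h1.div_const _
  refine HasLaplace.of_hasSum (Complex.continuous_ofReal.comp continuous_mangoldtMean).continuousOn
    (fun n => hasLaplace_mangoldt_term hw n) ?_ (fun v _ => ?_) (hL hw)
  · have hr : 0 < ((w.re : ℝ) : ℂ).re := by simpa using hw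
    have h1 := (Complex.hasSum_re (hL hr)).summable
    refine h1.congr fun n => ?_
    have h2 := (hasLaplace_mangoldt_term hr n).2
    rw [← h2]
    have h3 : ∀ v : ℝ, Complex.exp (-(w.re : ℂ) * v) *
        ((Λ n * max ((n : ℝ)⁻¹ - Real.exp (-v)) 0 : ℝ) : ℂ) =
        ((‖Complex.exp (-w * v) * ((Λ n * max ((n : ℝ)⁻¹ - Real.exp (-v)) 0 : ℝ) : ℂ)‖ : ℝ) : ℂ) := by
      intro v
      rw [norm_mul, Complex.norm_exp, Complex.norm_real, Real.norm_of_nonneg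
        (mul_nonneg ArithmeticFunction.vonMangoldt_nonneg (le_max_right _ _))]
      simp
    simp only [h3]
    rw [integral_complex_ofReal, Complex.ofReal_re]
  · have := Complex.hasSum_ofReal.2 (hasSum_mangoldtMean v)
    exact this

/-- The coefficient of `e^{-(2 k + 3) v}` in the explicit formula. -/
noncomputable def trivCoeff (k : ℕ) : ℝ := ((2 * k + 2) * (2 * k + 3))⁻¹

theorem trivCoeff_nonneg (k : ℕ) : 0 ≤ trivCoeff k := by unfold trivCoeff; positivity

theorem summable_trivCoeff : Summable trivCoeff := by
  have h := (summable_nat_add_iff 1).2 (Real.summable_one_div_nat_pow.2 (le_refl 2))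
  refine Summable.of_nonneg_of_le trivCoeff_nonneg (fun k => ?_) h
  unfold trivCoeff
  push_cast
  rw [one_div]
  apply inv_anti₀ (by positivity)
  nlinarith [Nat.cast_nonneg (α := ℝ) k]

/-- The contribution of the trivial zeros to the explicit formula for `mangoldtMean`. -/
noncomputable def trivSum (v : ℝ) : ℝ := ∑' k : ℕ, trivCoeff k * Real.exp (-(2 * k + 3) * v)

theorem trivCoeff_mul_exp_le {v : ℝ} (hv : 0 ≤ v) (k : ℕ) :
    trivCoeff k * Real.exp (-(2 * k + 3) * v) ≤ trivCoeff k := by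
  refine mul_le_of_le_one_right (trivCoeff_nonneg k) (Real.exp_le_one_iff.2 ?_)
  rw [neg_mul, neg_nonpos]
  positivity

theorem norm_trivCoeff_mul_exp_le {v : ℝ} (hv : 0 ≤ v) (k : ℕ) :
    ‖trivCoeff k * Real.exp (-(2 * k + 3) * v)‖ ≤ trivCoeff k := by
  rw [Real.norm_of_nonneg (mul_nonneg (trivCoeff_nonneg k) (Real.exp_pos _).le)]
  exact trivCoeff_mul_exp_le hv k

theorem hasSum_trivSum {v : ℝ} (hv : 0 ≤ v) :
    HasSum (fun k : ℕ => trivCoeff k * Real.exp (-(2 * k + 3) * v)) (trivSum v) :=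
  (Summable.of_norm_bounded summable_trivCoeff (norm_trivCoeff_mul_exp_le hv)).hasSum

theorem continuousOn_trivSum : ContinuousOn trivSum (Ici 0) :=
  continuousOn_tsum (fun k => by fun_prop) summable_trivCoeff
    fun k _ hv => norm_trivCoeff_mul_exp_le hv k

theorem hasLaplace_trivTerm {w : ℂ} (hw : w.re = 1) (k : ℕ) :
    HasLaplace (fun v => ((trivCoeff k * (1 - Real.exp (-(2 * k + 3) * v)) : ℝ) : ℂ)) w
      (((k : ℂ) + 1)⁻¹ - ((w + 3) / 2 + k)⁻¹ |> (· / (2 * w * (w + 1)))) := by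
  have h1 := (hasLaplace_one (w := w) (by linarith)).sub
    (hasLaplace_exp (c := -(2 * k + 3)) (w := w) (by simp; linarith [Nat.cast_nonneg (α := ℝ) k]))
  have h2 := h1.const_mul (trivCoeff k : ℂ)
  have e0 : ∀ {z : ℂ}, 0 < z.re → z ≠ 0 := fun h h0 => by simp [h0] at h
  have k0 := Nat.cast_nonneg (α := ℝ) k
  have n1 : w ≠ 0 := e0 (by linarith)
  have n2 : w + 1 ≠ 0 := e0 (by simp; linarith)
  have n3 : w + (2 * k + 3) ≠ 0 := e0 (by simp; linarith)
  have n3' : w + 3 + 2 * k ≠ 0 := e0 (by simp; linarith)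
  have n4 : (k : ℂ) + 1 ≠ 0 := e0 (by simp; linarith)
  have n5 : (2 * k + 3 : ℂ) ≠ 0 := e0 (by simp; linarith)
  have n6 : (2 * k + 2 : ℂ) ≠ 0 := e0 (by simp; linarith)
  have n7 : (w + 3) / 2 + k ≠ 0 := e0 (by simp; linarith)
  have e : (((k : ℂ) + 1)⁻¹ - ((w + 3) / 2 + k)⁻¹ |> (· / (2 * w * (w + 1)))) =
      (trivCoeff k : ℂ) * (w⁻¹ - (w - -(2 * k + 3))⁻¹) := by
    have : (w + 3) / 2 + k = (w + (2 * k + 3)) / 2 := by ring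
    simp only [trivCoeff, sub_neg_eq_add, this]
    push_cast
    have n8 : (2 * k + 2 : ℂ) = 2 * (k + 1) := by ring
    rw [n8]
    generalize hY : (2 * k + 3 : ℂ) = Y at n3 n5 ⊢
    generalize hX : w + Y = X at n3 ⊢
    have hk : (k : ℂ) = (Y - 3) / 2 := by rw [← hY]; ring
    field_simp
    rw [← hX, hk]
    ring
  rw [e]
  refine h2.congr fun v _ => ?_
  push_cast
  rfl

theorem hasLaplace_trivSum {w : ℂ} (hw : w.re = 1) :
    HasLaplace (fun v => ((trivSum 0 - trivSum v : ℝ) : ℂ)) w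
      ((Complex.digamma ((w + 1) / 2 + 1) + Real.eulerMascheroniConstant) / (2 * w * (w + 1))) := by
  have hd := Complex.hasSum_digamma (w := (w + 3) / 2) (by simp [hw]; norm_num)
  have e : (w + 1) / 2 + 1 = (w + 3) / 2 := by ring
  rw [e]
  have hb : ∀ (k : ℕ) (v : ℝ), 0 < v →
      ‖((trivCoeff k * (1 - Real.exp (-(2 * k + 3) * v)) : ℝ) : ℂ)‖ ≤ trivCoeff k := by
    intro k v hv
    have h1 := trivCoeff_mul_exp_le hv.le k
    have h2 := mul_nonneg (trivCoeff_nonneg k) (Real.exp_pos (-(2 * k + 3) * v)).le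
    rw [Complex.norm_real, Real.norm_of_nonneg] <;> linarith
  refine HasLaplace.of_hasSum ?_ (fun k => hasLaplace_trivTerm hw k) ?_ (fun v hv => ?_)
    (hd.div_const _)
  · exact Complex.continuous_ofReal.comp_continuousOn (continuousOn_const.sub continuousOn_trivSum)
  · exact Summable.of_nonneg_of_le (fun k => by positivity)
      (fun k => integral_norm_exp_mul_le hw (hasLaplace_trivTerm hw k) (hb k)) summable_trivCoeff
  · refine Complex.hasSum_ofReal.2 ?_
    have := (hasSum_trivSum le_rfl).sub (hasSum_trivSum hv.le)
    simpa [mul_sub] using this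

/-- The coefficient attached to the zero `1/2 + α` in the explicit formula. -/
noncomputable def zeroCoeff (α : ℂ) : ℂ := xiMult α / (1 / 4 - α ^ 2)

/-- The symmetrised exponential attached to the zeros `1/2 ± α`. -/
noncomputable def zeroExp (α : ℂ) (v : ℝ) : ℂ :=
  (Complex.exp ((α - 1 / 2) * v) + Complex.exp ((-α - 1 / 2) * v)) / 2

/-- The contribution of the nontrivial zeros to the explicit formula for `mangoldtMean`. -/
noncomputable def zeroSum (v : ℝ) : ℂ := ∑' α : ℂ, zeroCoeff α * zeroExp α v

theorem norm_zeroCoeff (α : ℂ) : ‖zeroCoeff α‖ = xiMult α * ‖(1 / 4 - α ^ 2)⁻¹‖ := by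
  simp [zeroCoeff, div_eq_mul_inv]

theorem summable_norm_zeroCoeff : Summable fun α => ‖zeroCoeff α‖ := by
  simpa only [norm_zeroCoeff] using summable_xiMult_mul_norm

theorem zeroCoeff_eq_zero {α : ℂ} (h : xiMult α = 0) : zeroCoeff α = 0 := by simp [zeroCoeff, h]

theorem xiMult_ne_zero_of_zeroCoeff {α : ℂ} (h : zeroCoeff α ≠ 0) : xiMult α ≠ 0 :=
  fun h0 => h (zeroCoeff_eq_zero h0)

/-- A bound for the symmetrised exponential attached to the zeros `1/2 ± α`. -/
noncomputable def zeroBound (α : ℂ) (v : ℝ) : ℝ :=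
  (Real.exp (-(1 / 2 - |α.re|) * v) + Real.exp (-(1 / 2) * v)) / 2

theorem exp_add_exp_le_zeroBound (α : ℂ) {v : ℝ} (hv : 0 ≤ v) :
    (Real.exp ((α.re - 1 / 2) * v) + Real.exp ((-α.re - 1 / 2) * v)) / 2 ≤ zeroBound α v := by
  have key : ∀ a : ℝ, 0 ≤ a → Real.exp ((a - 1 / 2) * v) + Real.exp ((-a - 1 / 2) * v) ≤
      Real.exp (-(1 / 2 - |a|) * v) + Real.exp (-(1 / 2) * v) := fun a ha => by
    rw [abs_of_nonneg ha, neg_sub]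
    gcongr
    linarith
  rw [zeroBound]
  rcases le_total 0 α.re with h | h
  · linarith [key _ h]
  · have := key (-α.re) (by linarith)
    rw [neg_neg, abs_neg] at this
    linarith

theorem norm_zeroExp_le (α : ℂ) {v : ℝ} (hv : 0 ≤ v) : ‖zeroExp α v‖ ≤ zeroBound α v := by
  have h1 : ‖Complex.exp ((α - 1 / 2) * v)‖ = Real.exp ((α.re - 1 / 2) * v) := by
    rw [Complex.norm_exp]; simp
  have h2 : ‖Complex.exp ((-α - 1 / 2) * v)‖ = Real.exp ((-α.re - 1 / 2) * v) := by
    rw [Complex.norm_exp]; simp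
  refine le_trans ?_ (exp_add_exp_le_zeroBound α hv)
  rw [zeroExp, norm_div, Complex.norm_ofNat, ← h1, ← h2]
  gcongr
  exact norm_add_le _ _

theorem zeroBound_nonneg (α : ℂ) (v : ℝ) : 0 ≤ zeroBound α v := by unfold zeroBound; positivity

theorem norm_zeroCoeff_mul_zeroBound_le (α : ℂ) {v : ℝ} (hv : 0 ≤ v) :
    ‖zeroCoeff α‖ * zeroBound α v ≤ ‖zeroCoeff α‖ := by
  by_cases h0 : zeroCoeff α = 0
  · simp [h0]
  refine mul_le_of_le_one_right (norm_nonneg _) ?_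
  have h := abs_re_lt_of_xiMult_ne_zero (xiMult_ne_zero_of_zeroCoeff h0)
  have h1 : Real.exp (-(1 / 2 - |α.re|) * v) ≤ 1 := by
    rw [Real.exp_le_one_iff]; nlinarith
  have h2 : Real.exp (-(1 / 2) * v) ≤ 1 := by
    rw [Real.exp_le_one_iff]; nlinarith
  rw [zeroBound]
  linarith

theorem norm_zeroCoeff_mul_zeroExp_le (α : ℂ) {v : ℝ} (hv : 0 ≤ v) :
    ‖zeroCoeff α * zeroExp α v‖ ≤ ‖zeroCoeff α‖ := by
  rw [norm_mul]
  exact (mul_le_mul_of_nonneg_left (norm_zeroExp_le α hv) (norm_nonneg _)).trans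
    (norm_zeroCoeff_mul_zeroBound_le α hv)

theorem hasSum_zeroSum {v : ℝ} (hv : 0 ≤ v) :
    HasSum (fun α => zeroCoeff α * zeroExp α v) (zeroSum v) :=
  (Summable.of_norm_bounded summable_norm_zeroCoeff
    fun α => norm_zeroCoeff_mul_zeroExp_le α hv).hasSum

theorem continuous_zeroExp (α : ℂ) : Continuous (zeroExp α) := by
  unfold zeroExp; fun_prop

theorem continuousOn_zeroSum : ContinuousOn zeroSum (Ici 0) :=
  continuousOn_tsum (fun α => ((continuous_zeroExp α).const_mul _).continuousOn)
    summable_norm_zeroCoeff fun α _ hv => norm_zeroCoeff_mul_zeroExp_le α hv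

theorem hasSum_zeroCoeff :
    HasSum zeroCoeff
      ((2 + Real.eulerMascheroniConstant - Real.log (4 * Real.pi) : ℝ) : ℂ) := hasSum_xiMult_div

/-- The indices of the nontrivial zeros. -/
abbrev XiZero : Type := Function.support zeroCoeff

instance : Countable XiZero := summable_norm_zeroCoeff.of_norm.countable_support.to_subtype

theorem hasSum_xiZero {E : Type*} [AddCommMonoid E] [TopologicalSpace E] {f : ℂ → E} {a : E}
    (h : HasSum f a) (hf : ∀ α, zeroCoeff α = 0 → f α = 0) :
    HasSum (fun α : XiZero => f α) a := by
  refine (hasSum_subtype_iff_of_support_subset fun α hα h0 => hα (hf α h0)).2 h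

theorem hasLaplace_zeroTerm {w : ℂ} (hw : w.re = 1) (α : XiZero) :
    HasLaplace (fun v => zeroCoeff α * (zeroExp α v - 1 / 2 - Complex.exp (-v) / 2)) w
      (-(xiMult (α : ℂ) * ((w + 1 / 2) / ((w + 1 / 2) ^ 2 - (α : ℂ) ^ 2))) / (w * (w + 1))) := by
  obtain ⟨α, hα⟩ := α
  have hr := abs_lt.1 (abs_re_lt_of_xiMult_ne_zero (xiMult_ne_zero_of_zeroCoeff hα))
  have h1 := hasLaplace_exp (c := α - 1 / 2) (w := w) (by simp; linarith)
  have h2 := hasLaplace_exp (c := -α - 1 / 2) (w := w) (by simp; linarith)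
  have h3 := hasLaplace_one (w := w) (by linarith)
  have h4 := hasLaplace_exp (c := -1) (w := w) (by simp; linarith)
  have h := (((h1.add h2).sub (h3.add h4)).const_mul (1 / 2)).const_mul (zeroCoeff α)
  have e0 : ∀ {z : ℂ}, 0 < z.re → z ≠ 0 := fun h h0 => by simp [h0] at h
  have n1 : w ≠ 0 := e0 (by linarith)
  have n2 : w + 1 ≠ 0 := e0 (by simp; linarith)
  have n3 : w - (α - 1 / 2) ≠ 0 := e0 (by simp; linarith)
  have n4 : w - (-α - 1 / 2) ≠ 0 := e0 (by simp; linarith)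
  have n5 : 1 / 2 - α ≠ 0 := e0 (by simp at hr ⊢; linarith)
  have n6 : 1 / 2 + α ≠ 0 := e0 (by simp at hr ⊢; linarith)
  have n7 : 1 / 4 - α ^ 2 ≠ 0 := by
    rw [show (1 / 4 - α ^ 2 : ℂ) = (1 / 2 - α) * (1 / 2 + α) by ring]; exact mul_ne_zero n5 n6
  have n8 : (w + 1 / 2) ^ 2 - α ^ 2 ≠ 0 := by
    rw [show (w + 1 / 2) ^ 2 - α ^ 2 = (w - (α - 1 / 2)) * (w - (-α - 1 / 2)) by ring]
    exact mul_ne_zero n3 n4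
  have n9 : w - -1 ≠ 0 := by simpa using n2
  have e : -(xiMult α * ((w + 1 / 2) / ((w + 1 / 2) ^ 2 - α ^ 2))) / (w * (w + 1)) =
      zeroCoeff α * (1 / 2 * ((w - (α - 1 / 2))⁻¹ + (w - (-α - 1 / 2))⁻¹ - (w⁻¹ + (w - -1)⁻¹))) := by
    have a1 : (w - (α - 1 / 2))⁻¹ + (w - (-α - 1 / 2))⁻¹ =
        2 * (w + 1 / 2) / ((w + 1 / 2) ^ 2 - α ^ 2) := by
      rw [inv_add_inv n3 n4]; congr 1 <;> ring
    have a2 : w⁻¹ + (w - -1)⁻¹ = 2 * (w + 1 / 2) / (w * (w + 1)) := by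
      rw [inv_add_inv n1 n9]; congr 1 <;> ring
    rw [a1, a2, zeroCoeff, div_sub_div _ _ n8 (mul_ne_zero n1 n2)]
    rw [show 2 * (w + 1 / 2) * (w * (w + 1)) - ((w + 1 / 2) ^ 2 - α ^ 2) * (2 * (w + 1 / 2)) =
      -(2 * (w + 1 / 2) * (1 / 4 - α ^ 2)) by ring]
    generalize (1 / 4 - α ^ 2 : ℂ) = X at n7 ⊢
    generalize ((w + 1 / 2) ^ 2 - α ^ 2 : ℂ) = Y at n8 ⊢
    field_simp
  rw [e]
  refine h.congr fun v _ => ?_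
  simp only [zeroExp]
  ring_nf

theorem hasLaplace_zeroSum {w : ℂ} (hw : w.re = 1) :
    HasLaplace (fun v => zeroSum v - (1 / 2 + Complex.exp (-v) / 2) *
        ((2 + Real.eulerMascheroniConstant - Real.log (4 * Real.pi) : ℝ) : ℂ)) w
      (-logDeriv centredXi (w + 1 / 2) / (w * (w + 1))) := by
  have hz : centredXi (w + 1 / 2) ≠ 0 := centredXi_ne_zero (by simp; linarith)
  have hL := (hasSum_logDeriv_centredXi hz).neg.div_const (w * (w + 1))
  have hL' := hasSum_xiZero hL (fun α h => by
    have : xiMult α = 0 ∨ (1 / 4 - α ^ 2 : ℂ) = 0 := by simpa [zeroCoeff] using h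
    rcases this with h | h
    · simp [h]
    · by_contra h0
      have h1 : xiMult α ≠ 0 := by rintro h1; simp [h1] at h0
      have hr := abs_lt.1 (abs_re_lt_of_xiMult_ne_zero h1)
      rw [show (1 / 4 - α ^ 2 : ℂ) = (1 / 2 - α) * (1 / 2 + α) by ring, mul_eq_zero] at h
      rcases h with h | h <;>
      · have := congrArg Complex.re h
        simp at this hr
        linarith)
  have hc := summable_norm_zeroCoeff.subtype (Function.support zeroCoeff)
  have hb : ∀ (α : XiZero) (v : ℝ), 0 < v →
      ‖zeroCoeff α * (zeroExp α v - 1 / 2 - Complex.exp (-v) / 2)‖ ≤ 2 * ‖zeroCoeff α‖ := by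
    intro α v hv
    have h1 := norm_zeroCoeff_mul_zeroExp_le α hv.le
    have h2 : ‖(1 / 2 + Complex.exp (-v) / 2 : ℂ)‖ ≤ 1 := by
      refine (norm_add_le _ _).trans ?_
      rw [norm_div, norm_div, Complex.norm_exp]
      have : Real.exp (-v) ≤ 1 := Real.exp_le_one_iff.2 (by linarith)
      simp
      linarith
    have h3 : zeroCoeff α * (zeroExp α v - 1 / 2 - Complex.exp (-v) / 2) =
      zeroCoeff α * zeroExp α v - zeroCoeff α * (1 / 2 + Complex.exp (-v) / 2) := by ring
    rw [h3]
    refine (norm_sub_le _ _).trans ?_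
    rw [norm_mul (zeroCoeff α) (1 / 2 + _)]
    nlinarith [norm_nonneg (zeroCoeff α)]
  refine HasLaplace.of_hasSum ?_ (fun α => hasLaplace_zeroTerm hw α) ?_ (fun v hv => ?_) hL'
  · exact continuousOn_zeroSum.sub (Continuous.continuousOn (by fun_prop))
  · exact Summable.of_nonneg_of_le (fun k => by positivity)
      (fun α => integral_norm_exp_mul_le hw (hasLaplace_zeroTerm hw α) (hb α)) (hc.mul_left 2)
  · have h1 := hasSum_xiZero (hasSum_zeroSum hv.le) (fun α h => by simp [h])
    have h2 := (hasSum_xiZero hasSum_zeroCoeff (fun α h => h)).mul_left (1 / 2 + Complex.exp (-v) / 2)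
    refine (h1.sub h2).congr_fun fun α => ?_
    ring

/-- The error term in the explicit formula for `mangoldtMean`. -/
noncomputable def meanError (v : ℝ) : ℝ :=
  -Real.log (2 * Real.pi) * Real.exp (-v) + trivSum v - (zeroSum v).re

theorem continuousOn_meanError : ContinuousOn meanError (Ici 0) :=
  ((Continuous.continuousOn (by fun_prop)).add continuousOn_trivSum).sub
    (Complex.continuous_re.comp_continuousOn continuousOn_zeroSum)

theorem exists_mangoldtMean_eq : ∃ C : ℝ, ∀ v, 0 ≤ v → mangoldtMean v = v + C - meanError v := by
  set S : ℝ := 2 + Real.eulerMascheroniConstant - Real.log (4 * Real.pi) with hS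
  set c : ℝ := 1 + Real.log Real.pi / 2 + Real.eulerMascheroniConstant / 2 with hc
  have hA : ∀ v : ℝ, 0 ≤ v → (mangoldtMean v : ℂ) - (v - c * (1 - Complex.exp (-v)) +
      (trivSum 0 - trivSum v : ℝ) + (zeroSum v - (1 / 2 + Complex.exp (-v) / 2) * S)) = 0 := by
    intro v hv
    refine HasLaplace.eq_zero (F := fun v : ℝ => (mangoldtMean v : ℂ) -
      (v - c * (1 - Complex.exp (-v)) +
      (trivSum 0 - trivSum v : ℝ) + (zeroSum v - (1 / 2 + Complex.exp (-v) / 2) * S)))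
      ?_ ?_ (fun w hw => ?_) hv
    · refine (Complex.continuous_ofReal.comp continuous_mangoldtMean).continuousOn.sub ?_
      refine ContinuousOn.add (ContinuousOn.add (Continuous.continuousOn (by fun_prop)) ?_) ?_
      · exact Complex.continuous_ofReal.comp_continuousOn
          (continuousOn_const.sub continuousOn_trivSum)
      · exact continuousOn_zeroSum.sub (Continuous.continuousOn (by fun_prop))
    · have h0 : mangoldtMean 0 = 0 := by
        rw [mangoldtMean_eq_sum (N := 1) (by simp)]; simp
      have h1 : zeroSum 0 = S := by
        rw [← hasSum_zeroCoeff.tsum_eq]; simp [zeroSum, zeroExp]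
      simp only [h0, h1]
      push_cast
      simp
      ring
    · have l1 := hasLaplace_mangoldtMean (w := w) (by linarith)
      have l2 := hasLaplace_id (w := w) (by linarith)
      have l3 := ((hasLaplace_one (w := w) (by linarith)).sub
        (hasLaplace_exp (c := -1) (w := w) (by simp; linarith))).const_mul (c : ℂ)
      have l4 := hasLaplace_trivSum hw
      have l5 := hasLaplace_zeroSum hw
      have l := l1.sub (((l2.sub l3).add l4).add l5)
      have e0 : ∀ {z : ℂ}, 0 < z.re → z ≠ 0 := fun h h0 => by simp [h0] at h
      have n1 : w ≠ 0 := e0 (by linarith)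
      have n2 : w + 1 ≠ 0 := e0 (by simp; linarith)
      have hX := logDeriv_centredXi_sub_half (s := w + 1) (by simp; linarith)
      rw [show w + 1 - 1 / 2 = w + 1 / 2 by ring, show w + 1 - 1 = w by ring] at hX
      have e : -logDeriv riemannZeta (w + 1) / (w * (w + 1)) - ((w ^ 2)⁻¹ - c * (w⁻¹ - (w - -1)⁻¹) +
          (Complex.digamma ((w + 1) / 2 + 1) + Real.eulerMascheroniConstant) / (2 * w * (w + 1)) +
          -logDeriv centredXi (w + 1 / 2) / (w * (w + 1))) = 0 := by
        rw [hX, sub_neg_eq_add, hc, ← Complex.ofReal_log Real.pi_pos.le]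
        push_cast
        generalize logDeriv riemannZeta (w + 1) = Z
        generalize Complex.digamma ((w + 1) / 2 + 1) = D
        field_simp
        ring
      rw [e, ← hS] at l
      refine l.congr fun v _ => ?_
      ring_nf
  refine ⟨-c + trivSum 0 - S / 2, fun v hv => ?_⟩
  have h := congrArg Complex.re (hA v hv)
  have h1 : Real.log (2 * Real.pi) = c - S / 2 := by
    rw [hc, hS, Real.log_mul (by norm_num) Real.pi_pos.ne', Real.log_mul (by norm_num)
      Real.pi_pos.ne', show (4 : ℝ) = 2 ^ 2 by norm_num, Real.log_pow]
    push_cast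
    ring
  have h2 : (Complex.exp (-(v : ℂ))).re = Real.exp (-v) := by
    rw [← Complex.ofReal_neg, Complex.exp_ofReal_re]
  simp [h2] at h
  rw [meanError, h1]
  linarith

/-- The primitive weight `1/v + 1/v²`. -/
noncomputable def recipWeight (v : ℝ) : ℝ := 1 / v + 1 / v ^ 2

/-- The derivative of `-recipWeight`. -/
noncomputable def recipWeightDeriv (v : ℝ) : ℝ := 1 / v ^ 2 + 2 / v ^ 3

theorem hasDerivAt_recipWeight {v : ℝ} (hv : v ≠ 0) :
    HasDerivAt recipWeight (-recipWeightDeriv v) v := by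
  have h := (hasDerivAt_inv hv).add ((hasDerivAt_pow 2 v).fun_inv (pow_ne_zero 2 hv))
  have e : recipWeight = (Inv.inv : ℝ → ℝ) + fun x => (x ^ 2)⁻¹ := by
    funext x; simp [recipWeight]
  rw [e]
  refine h.congr_deriv ?_
  rw [recipWeightDeriv]
  field_simp
  push_cast
  ring

theorem recipWeight_nonneg {v : ℝ} (hv : 0 ≤ v) : 0 ≤ recipWeight v := by
  unfold recipWeight; positivity

theorem recipWeightDeriv_nonneg {v : ℝ} (hv : 0 ≤ v) : 0 ≤ recipWeightDeriv v := by
  unfold recipWeightDeriv; positivity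

theorem tendsto_recipWeight : Tendsto recipWeight atTop (𝓝 0) := by
  have h1 : Tendsto (fun v : ℝ => v⁻¹) atTop (𝓝 0) := tendsto_inv_atTop_zero
  have h2 := h1.add (h1.pow 2)
  simp only [ne_eq, OfNat.ofNat_ne_zero, not_false_eq_true, zero_pow, add_zero] at h2
  refine h2.congr fun v => ?_
  simp [recipWeight]

theorem continuousOn_recipWeightDeriv : ContinuousOn recipWeightDeriv (Ioi 0) := by
  unfold recipWeightDeriv
  refine ContinuousOn.add ?_ ?_ <;>
  · refine ContinuousOn.div continuousOn_const (by fun_prop) fun x hx => pow_ne_zero _ (ne_of_gt hx)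

theorem integrableOn_recipWeightDeriv {u : ℝ} (hu : 0 < u) :
    MeasureTheory.IntegrableOn recipWeightDeriv (Ioi u) := by
  have h := MeasureTheory.integrableOn_Ioi_deriv_of_nonneg' (g := fun v => -recipWeight v)
    (g' := recipWeightDeriv) (a := u) (l := -0)
    (fun x hx => (hasDerivAt_recipWeight (lt_of_lt_of_le hu hx).ne').fun_neg.congr_deriv (neg_neg _))
    (fun x hx => recipWeightDeriv_nonneg (hu.trans hx).le) tendsto_recipWeight.neg
  exact h

theorem integral_recipWeightDeriv {u : ℝ} (hu : 0 < u) :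
    ∫ v in Ioi u, recipWeightDeriv v = recipWeight u := by
  have h := MeasureTheory.integral_Ioi_of_hasDerivAt_of_nonneg' (g := fun v => -recipWeight v)
    (g' := recipWeightDeriv) (a := u) (l := -0)
    (fun x hx => (hasDerivAt_recipWeight (lt_of_lt_of_le hu hx).ne').fun_neg.congr_deriv (neg_neg _))
    (fun x hx => recipWeightDeriv_nonneg (hu.trans hx).le) tendsto_recipWeight.neg
  simpa using h

theorem intervalIntegrable_mul_recipWeightDeriv {f : ℝ → ℝ} {a u : ℝ} (ha : 0 < a) (hu : a ≤ u)
    (hf : ContinuousOn f (Ici 0)) :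
    IntervalIntegrable (fun v => f v * recipWeightDeriv v) MeasureTheory.volume a u := by
  apply ContinuousOn.intervalIntegrable
  rw [uIcc_of_le hu]
  exact (hf.mono fun x hx => ha.le.trans hx.1).mul
    (continuousOn_recipWeightDeriv.mono fun x hx => ha.trans_le hx.1)

theorem integral_max_inv_sub_exp {n : ℕ} (hn : 2 ≤ n) {u : ℝ} (hu : Real.log n ≤ u) :
    max ((n : ℝ)⁻¹ - Real.exp (-u)) 0 * recipWeight u +
      ∫ v in (Real.log 2)..u, max ((n : ℝ)⁻¹ - Real.exp (-v)) 0 * recipWeightDeriv v =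
    1 / (n * Real.log n) - 1 / (u * Real.exp u) := by
  have hn0 : (0 : ℝ) < n := by positivity
  have h2n : (2 : ℝ) ≤ n := by exact_mod_cast hn
  have ha : 0 < Real.log 2 := Real.log_pos one_lt_two
  have hal : Real.log 2 ≤ Real.log n := Real.log_le_log two_pos h2n
  have hl : 0 < Real.log n := ha.trans_le hal
  have hu0 : 0 < u := hl.trans_le hu
  have hexp : Real.exp (-Real.log n) = (n : ℝ)⁻¹ := by rw [Real.exp_neg, Real.exp_log hn0]
  have hc : Continuous fun v : ℝ => max ((n : ℝ)⁻¹ - Real.exp (-v)) 0 := by fun_prop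
  rw [← intervalIntegral.integral_add_adjacent_intervals
    (intervalIntegrable_mul_recipWeightDeriv ha hal hc.continuousOn)
    (intervalIntegrable_mul_recipWeightDeriv hl hu hc.continuousOn)]
  have i1 : ∫ v in (Real.log 2)..Real.log n,
      max ((n : ℝ)⁻¹ - Real.exp (-v)) 0 * recipWeightDeriv v = 0 := by
    rw [intervalIntegral.integral_congr (g := fun _ => (0 : ℝ)), intervalIntegral.integral_zero]
    intro v hv
    rw [uIcc_of_le hal] at hv
    simp only
    rw [max_eq_right, zero_mul]
    rw [← hexp, sub_nonpos]
    exact Real.exp_le_exp.2 (neg_le_neg hv.2)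
  have pos : ∀ v, Real.log n ≤ v → max ((n : ℝ)⁻¹ - Real.exp (-v)) 0 = (n : ℝ)⁻¹ - Real.exp (-v) :=
    fun v hv => by
      rw [max_eq_left]
      rw [← hexp, sub_nonneg]
      exact Real.exp_le_exp.2 (neg_le_neg hv)
  have i2 : ∫ v in (Real.log n)..u, max ((n : ℝ)⁻¹ - Real.exp (-v)) 0 * recipWeightDeriv v =
      (-((n : ℝ)⁻¹ - Real.exp (-u)) * recipWeight u - Real.exp (-u) / u) -
      (-((n : ℝ)⁻¹ - Real.exp (-Real.log n)) * recipWeight (Real.log n) -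
        Real.exp (-Real.log n) / Real.log n) := by
    rw [intervalIntegral.integral_eq_sub_of_hasDerivAt
      (f := fun v => -((n : ℝ)⁻¹ - Real.exp (-v)) * recipWeight v - Real.exp (-v) / v) ?_
      (intervalIntegrable_mul_recipWeightDeriv hl hu hc.continuousOn)]
    intro v hv
    rw [uIcc_of_le hu] at hv
    have hv0 : v ≠ 0 := (hl.trans_le hv.1).ne'
    rw [pos v hv.1]
    have d1 : HasDerivAt (fun v : ℝ => Real.exp (-v)) (-Real.exp (-v)) v := by
      simpa using (hasDerivAt_neg v).exp
    have d2 := ((d1.const_sub (n : ℝ)⁻¹).neg.mul (hasDerivAt_recipWeight hv0)).sub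
      (d1.div (hasDerivAt_id v) hv0)
    refine d2.congr_deriv ?_
    simp only [Pi.neg_apply, recipWeight, recipWeightDeriv, id]
    field_simp
    ring
  rw [i1, i2, pos u hu, hexp, Real.exp_neg]
  field_simp
  ring

/-- The smoothed Mertens sum `∑_{n ≤ e^u} Λ(n) (1/(n log n) - 1/(u e^u)) + 1/u`. -/
noncomputable def mertensMean (u : ℝ) : ℝ :=
  ∑ n ∈ Finset.range (⌊Real.exp u⌋₊ + 1), Λ n * (1 / (n * Real.log n) - 1 / (u * Real.exp u)) + 1 / u

theorem mertensMean_eq {u : ℝ} (hu : Real.log 2 ≤ u) :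
    mertensMean u = mangoldtMean u * recipWeight u +
      (∫ v in (Real.log 2)..u, mangoldtMean v * recipWeightDeriv v) + 1 / u := by
  have ha : 0 < Real.log 2 := Real.log_pos one_lt_two
  set N := ⌊Real.exp u⌋₊ + 1 with hN
  have hNu : Real.exp u ≤ N := by
    rw [hN]; push_cast; exact (Nat.lt_floor_add_one _).le
  have e1 : ∫ v in (Real.log 2)..u, mangoldtMean v * recipWeightDeriv v =
      ∑ n ∈ Finset.range N, Λ n * ∫ v in (Real.log 2)..u,
        max ((n : ℝ)⁻¹ - Real.exp (-v)) 0 * recipWeightDeriv v := by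
    rw [intervalIntegral.integral_congr (g := fun v => ∑ n ∈ Finset.range N,
      Λ n * (max ((n : ℝ)⁻¹ - Real.exp (-v)) 0 * recipWeightDeriv v))]
    · rw [intervalIntegral.integral_finsetSum]
      · simp only [intervalIntegral.integral_const_mul]
      · intro n _
        exact (intervalIntegrable_mul_recipWeightDeriv ha hu
          (Continuous.continuousOn (by fun_prop))).const_mul _
    · intro v hv
      rw [uIcc_of_le hu] at hv
      simp only
      rw [mangoldtMean_eq_sum ((Real.exp_le_exp.2 hv.2).trans hNu), Finset.sum_mul]
      exact Finset.sum_congr rfl fun n _ => by ring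
  rw [mertensMean, e1, mangoldtMean_eq_sum hNu, Finset.sum_mul, ← Finset.sum_add_distrib, ← hN]
  congr 1
  refine Finset.sum_congr rfl fun n hn => ?_
  rcases lt_or_ge n 2 with h | h
  · interval_cases n <;> simp
  · have hn' : n ≤ ⌊Real.exp u⌋₊ := by
      rw [hN, Finset.mem_range] at hn; omega
    have hnu : Real.log n ≤ u := by
      rw [Real.log_le_iff_le_exp (by positivity)]
      exact (Nat.cast_le.2 hn').trans (Nat.floor_le (Real.exp_pos u).le)
    rw [← integral_max_inv_sub_exp h hnu]
    ring

/-- The error term of the smoothed Mertens sum. -/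
noncomputable def mertensError (u : ℝ) : ℝ :=
  -meanError u * recipWeight u + ∫ v in Ioi u, meanError v * recipWeightDeriv v

theorem trivSum_nonneg (v : ℝ) : 0 ≤ trivSum v :=
  tsum_nonneg fun k => mul_nonneg (trivCoeff_nonneg k) (Real.exp_pos _).le

theorem exists_abs_meanError_le : ∃ B, 0 ≤ B ∧ ∀ v, 0 ≤ v → |meanError v| ≤ B := by
  refine ⟨|Real.log (2 * Real.pi)| + trivSum 0 + ∑' α, ‖zeroCoeff α‖, ?_, fun v hv => ?_⟩
  · have : 0 ≤ trivSum 0 := tsum_nonneg fun k => mul_nonneg (trivCoeff_nonneg k) (Real.exp_pos _).le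
    positivity
  · have h1 : |(zeroSum v).re| ≤ ∑' α, ‖zeroCoeff α‖ :=
      (Complex.abs_re_le_norm _).trans (tsum_of_norm_bounded summable_norm_zeroCoeff.hasSum
        fun α => norm_zeroCoeff_mul_zeroExp_le α hv)
    have h2 : |trivSum v| ≤ trivSum 0 := by
      rw [abs_of_nonneg (trivSum_nonneg v)]
      refine (hasSum_trivSum hv).summable.tsum_le_tsum (fun k => ?_) (hasSum_trivSum le_rfl).summable
      simpa using trivCoeff_mul_exp_le hv k
    have h3 : |-Real.log (2 * Real.pi) * Real.exp (-v)| ≤ |Real.log (2 * Real.pi)| := by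
      rw [abs_mul, abs_neg, Real.abs_exp]
      exact mul_le_of_le_one_right (abs_nonneg _) (Real.exp_le_one_iff.2 (by linarith))
    rw [meanError]
    exact (abs_sub _ _).trans (add_le_add ((abs_add_le _ _).trans (add_le_add h3 h2)) h1)

theorem integrableOn_mul_recipWeightDeriv {E : Type*} [NormedAddCommGroup E] [NormedSpace ℝ E]
    {f : ℝ → E} (hf : ContinuousOn f (Ici 0)) {B : ℝ} (hB : ∀ v, 0 ≤ v → ‖f v‖ ≤ B) {u : ℝ}
    (hu : 0 < u) : MeasureTheory.IntegrableOn (fun v => recipWeightDeriv v • f v) (Ioi u) := by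
  refine MeasureTheory.Integrable.mono' ((integrableOn_recipWeightDeriv hu).const_mul B) ?_ ?_
  · refine ContinuousOn.aestronglyMeasurable ?_ measurableSet_Ioi
    exact (continuousOn_recipWeightDeriv.mono fun x hx => hu.trans hx).smul
      (hf.mono fun x hx => (hu.trans hx).le)
  · refine (MeasureTheory.ae_restrict_iff' measurableSet_Ioi).2 (Eventually.of_forall fun v hv => ?_)
    have hv0 : 0 < v := hu.trans hv
    rw [norm_smul, Real.norm_of_nonneg (recipWeightDeriv_nonneg hv0.le), mul_comm]
    exact mul_le_mul_of_nonneg_right (hB v hv0.le) (recipWeightDeriv_nonneg hv0.le)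

theorem integrableOn_meanError {u : ℝ} (hu : 0 < u) :
    MeasureTheory.IntegrableOn (fun v => meanError v * recipWeightDeriv v) (Ioi u) := by
  obtain ⟨B, -, hB⟩ := exists_abs_meanError_le
  simpa only [smul_eq_mul, mul_comm] using integrableOn_mul_recipWeightDeriv continuousOn_meanError hB hu

theorem tendsto_mertensError : Tendsto mertensError atTop (𝓝 0) := by
  obtain ⟨B, hB0, hB⟩ := exists_abs_meanError_le
  have h2 := tendsto_recipWeight.const_mul (2 * B)
  rw [mul_zero] at h2
  refine squeeze_zero_norm' ?_ h2
  filter_upwards [eventually_gt_atTop 0] with u hu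
  have h3 : ‖∫ v in Ioi u, meanError v * recipWeightDeriv v‖ ≤ B * recipWeight u := by
    rw [← integral_recipWeightDeriv hu, ← MeasureTheory.integral_const_mul]
    refine MeasureTheory.norm_integral_le_of_norm_le ((integrableOn_recipWeightDeriv hu).const_mul B) ?_
    refine (MeasureTheory.ae_restrict_iff' measurableSet_Ioi).2 (Eventually.of_forall fun v hv => ?_)
    have hv0 : 0 < v := hu.trans hv
    rw [norm_mul, Real.norm_of_nonneg (recipWeightDeriv_nonneg hv0.le)]
    exact mul_le_mul_of_nonneg_right (hB v hv0.le) (recipWeightDeriv_nonneg hv0.le)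
  have h4 : ‖-meanError u * recipWeight u‖ ≤ B * recipWeight u := by
    rw [norm_mul, norm_neg, Real.norm_of_nonneg (recipWeight_nonneg hu.le)]
    exact mul_le_mul_of_nonneg_right (hB u hu.le) (recipWeight_nonneg hu.le)
  rw [mertensError]
  exact (norm_add_le _ _).trans (by linarith)

theorem exists_mertensMean_eq :
    ∃ M : ℝ, ∀ u, Real.log 2 ≤ u → mertensMean u = Real.log u + M + mertensError u := by
  obtain ⟨C, hC⟩ := exists_mangoldtMean_eq
  have ha : 0 < Real.log 2 := Real.log_pos one_lt_two
  set a := Real.log 2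
  refine ⟨(a + C) * recipWeight a - Real.log a + 1 / a -
    ∫ v in Ioi a, meanError v * recipWeightDeriv v, fun u hu => ?_⟩
  have hu0 : 0 < u := ha.trans_le hu
  have hK := intervalIntegrable_mul_recipWeightDeriv ha hu continuousOn_meanError
  have hV := intervalIntegrable_mul_recipWeightDeriv (f := fun v => v + C) ha hu
    (Continuous.continuousOn (by fun_prop))
  have e1 : ∫ v in a..u, mangoldtMean v * recipWeightDeriv v =
      (∫ v in a..u, (v + C) * recipWeightDeriv v) - ∫ v in a..u, meanError v * recipWeightDeriv v := by
    rw [← intervalIntegral.integral_sub hV hK]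
    refine intervalIntegral.integral_congr fun v hv => ?_
    rw [uIcc_of_le hu] at hv
    rw [hC v (ha.le.trans hv.1)]
    ring
  have e2 : ∫ v in a..u, (v + C) * recipWeightDeriv v =
      (-(u + C) * recipWeight u + Real.log u - 1 / u) -
        (-(a + C) * recipWeight a + Real.log a - 1 / a) := by
    rw [intervalIntegral.integral_eq_sub_of_hasDerivAt
      (f := fun v => -(v + C) * recipWeight v + Real.log v - 1 / v) ?_ hV]
    intro v hv
    rw [uIcc_of_le hu] at hv
    have hv0 : v ≠ 0 := (ha.trans_le hv.1).ne'
    have d := ((((hasDerivAt_id v).add_const C).neg.mul (hasDerivAt_recipWeight hv0)).add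
      (Real.hasDerivAt_log hv0)).sub ((hasDerivAt_inv hv0).congr_deriv rfl)
    have e : (fun v => -(v + C) * recipWeight v + Real.log v - 1 / v) =
        ((-fun x => id x + C) * recipWeight + Real.log) - Inv.inv := by
      funext x; simp; ring
    rw [e]
    refine d.congr_deriv ?_
    simp only [Pi.neg_apply, recipWeight, recipWeightDeriv, id]
    field_simp
    ring
  have e3 := intervalIntegral.integral_interval_add_Ioi (integrableOn_meanError ha)
    (integrableOn_meanError hu0)
  rw [mertensMean_eq hu, e1, e2, hC u hu0.le, mertensError]
  linarith

/-- The partial sums `∑_{n ≤ e^u} Λ(n) / (n log n)`. -/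
noncomputable def mertensSum (u : ℝ) : ℝ :=
  ∑ n ∈ Finset.range (⌊Real.exp u⌋₊ + 1), Λ n / (n * Real.log n)

theorem mangoldt_div_nonneg (n : ℕ) : 0 ≤ Λ n / (n * Real.log n) :=
  div_nonneg ArithmeticFunction.vonMangoldt_nonneg
    (mul_nonneg n.cast_nonneg (Real.log_natCast_nonneg n))

theorem mertensSum_mono : Monotone mertensSum := fun u v h => by
  refine Finset.sum_le_sum_of_subset_of_nonneg ?_ fun n _ _ => mangoldt_div_nonneg n
  refine Finset.range_subset_range.2 (Nat.succ_le_succ (Nat.floor_le_floor (Real.exp_le_exp.2 h)))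

theorem summable_mangoldt_div_rpow {d : ℝ} (hd : 0 < d) :
    Summable fun n : ℕ => Λ n / ((n : ℝ) ^ (1 + d) * Real.log n) := by
  have h := (ArithmeticFunction.LSeriesSummable_vonMangoldt (s := ((1 + d : ℝ) : ℂ))
    (by simpa using hd)).norm.div_const (Real.log 2)
  refine Summable.of_nonneg_of_le (fun n => ?_) (fun n => ?_) h
  · exact div_nonneg ArithmeticFunction.vonMangoldt_nonneg
      (mul_nonneg (Real.rpow_nonneg n.cast_nonneg _) (Real.log_natCast_nonneg n))
  · rcases lt_or_ge n 2 with hn | hn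
    · interval_cases n <;> simp
    have hl : Real.log 2 ≤ Real.log n := Real.log_le_log two_pos (by exact_mod_cast hn)
    have h2 : 0 < Real.log 2 := Real.log_pos one_lt_two
    have hn0 : 0 < n := by omega
    have hp : 0 < (n : ℝ) ^ (1 + d) := Real.rpow_pos_of_pos (by exact_mod_cast hn0) _
    rw [LSeries.term_of_ne_zero hn0.ne', norm_div, Complex.norm_natCast_cpow_of_pos hn0,
      Complex.norm_real, Real.norm_of_nonneg ArithmeticFunction.vonMangoldt_nonneg,
      Complex.ofReal_re, div_div]
    have := ArithmeticFunction.vonMangoldt_nonneg (n := n)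
    gcongr

theorem log_riemannZeta_eq_integral {d : ℝ} (hd : 0 < d) :
    Real.log (riemannZeta ((1 + d : ℝ) : ℂ)).re =
      d * ∫ u in Ioi (0 : ℝ), Real.exp (-d * u) * mertensSum u := by
  set f : ℕ → ℝ → ℝ := fun n => (Ici (Real.log n)).indicator
    fun u => Λ n / (n * Real.log n) * Real.exp (-d * u) with hf
  have hsub : ∀ n : ℕ, (Ioi (0 : ℝ) ∩ Ici (Real.log n) : Set ℝ) =ᵐ[MeasureTheory.volume]
      Ioi (Real.log n) := fun n => by
    have h1 : Ioi (0 : ℝ) ∩ Ioi (Real.log n) = Ioi (Real.log n) := by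
      rw [Ioi_inter_Ioi, max_eq_right (Real.log_natCast_nonneg n)]
    have h2 := (Filter.EventuallyEq.refl (MeasureTheory.ae MeasureTheory.volume)
      (Ioi (0 : ℝ))).inter (MeasureTheory.Ioi_ae_eq_Ici (a := Real.log n) (μ := MeasureTheory.volume))
    rw [h1] at h2
    exact h2.symm
  have hi : ∀ n, MeasureTheory.IntegrableOn (f n) (Ioi 0) := fun n => by
    rw [hf]
    refine MeasureTheory.IntegrableOn.indicator ?_ measurableSet_Ici
    exact (integrableOn_exp_mul_Ioi (by linarith) 0).const_mul _
  have hInt : ∀ n, ∫ u in Ioi (0 : ℝ), f n u = Λ n / ((n : ℝ) ^ (1 + d) * Real.log n) / d := by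
    intro n
    rcases lt_or_ge n 2 with hn | hn
    · interval_cases n <;> simp [hf]
    have hn0 : (0 : ℝ) < n := by positivity
    rw [hf, MeasureTheory.setIntegral_indicator measurableSet_Ici,
      MeasureTheory.setIntegral_congr_set (hsub n), MeasureTheory.integral_const_mul,
      integral_exp_mul_Ioi (by linarith), Real.rpow_add hn0, Real.rpow_one,
      Real.rpow_def_of_pos hn0, neg_mul, Real.exp_neg, mul_comm d]
    field_simp
  have hnn : ∀ n u, 0 ≤ f n u := fun n u => by
    rw [hf]
    exact indicator_nonneg (fun _ _ => mul_nonneg (mangoldt_div_nonneg n) (Real.exp_pos _).le) _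
  have h1 := MeasureTheory.hasSum_integral_of_summable_integral_norm hi (by
    simp only [Real.norm_of_nonneg (hnn _ _), hInt]
    exact (summable_mangoldt_div_rpow hd).div_const d)
  simp only [hInt] at h1
  have h2 := ((summable_mangoldt_div_rpow hd).hasSum.div_const d).unique h1
  rw [← log_riemannZeta_eq (by linarith)] at h2
  have h3 : ∫ u in Ioi (0 : ℝ), ∑' n, f n u = ∫ u in Ioi (0 : ℝ), Real.exp (-d * u) * mertensSum u := by
    refine MeasureTheory.setIntegral_congr_fun measurableSet_Ioi fun u hu => ?_
    have hu : 0 < u := hu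
    rw [tsum_eq_sum (s := Finset.range (⌊Real.exp u⌋₊ + 1)), mertensSum, Finset.mul_sum]
    · refine Finset.sum_congr rfl fun n hn => ?_
      rcases Nat.eq_zero_or_pos n with rfl | hn0
      · simp [hf]
      have : Real.log n ≤ u := by
        rw [Real.log_le_iff_le_exp (by exact_mod_cast hn0)]
        exact (Nat.cast_le.2 (Nat.lt_succ_iff.1 (Finset.mem_range.1 hn))).trans
          (Nat.floor_le (Real.exp_pos u).le)
      simp only [hf]
      rw [indicator_of_mem (show u ∈ Ici (Real.log n) from this), mul_comm]
    · intro n hn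
      have h4 : Real.exp u < n := by
        rw [← Nat.floor_lt (Real.exp_pos u).le]
        simpa using hn
      have : u < Real.log n := (Real.lt_log_iff_exp_lt ((Real.exp_pos u).trans h4)).2 h4
      simp only [hf]
      rw [indicator_of_notMem]
      simpa using this
  rw [← h3, ← h2]
  field_simp

theorem integrableOn_exp_neg_mul_log :
    MeasureTheory.IntegrableOn (fun t : ℝ => Real.exp (-t) * Real.log t) (Ioi 0) := by
  have h1 := (Real.GammaIntegral_convergent (s := 1 / 2) (by norm_num)).const_mul 2
  have h2 := Real.GammaIntegral_convergent (s := 2) (by norm_num)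
  refine MeasureTheory.Integrable.mono' (h1.add h2) ?_ ?_
  · exact (Measurable.mul (by fun_prop) Real.measurable_log).aestronglyMeasurable
  · refine (MeasureTheory.ae_restrict_iff' measurableSet_Ioi).2 (Eventually.of_forall fun t ht => ?_)
    have ht : 0 < t := ht
    have e1 : t ^ ((2 : ℝ) - 1) = t := by norm_num
    have l1 := Real.log_le_sub_one_of_pos ht
    have l2 := Real.log_le_sub_one_of_pos (Real.rpow_pos_of_pos ht (1 / 2 - 1))
    rw [Real.log_rpow ht] at l2
    have l3 := Real.rpow_pos_of_pos ht (1 / 2 - 1)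
    have l4 : |Real.log t| ≤ 2 * t ^ ((1 : ℝ) / 2 - 1) + t := by
      rw [abs_le]; constructor <;> linarith
    rw [norm_mul, Real.norm_of_nonneg (Real.exp_pos _).le, Real.norm_eq_abs, Pi.add_apply, e1]
    calc _ ≤ Real.exp (-t) * (2 * t ^ ((1 : ℝ) / 2 - 1) + t) := by gcongr
      _ = _ := by ring

theorem integral_exp_neg_mul_log :
    ∫ t in Ioi (0 : ℝ), Real.exp (-t) * Real.log t = -Real.eulerMascheroniConstant := by
  have h1 := Complex.hasDerivAt_GammaIntegral (s := 1) (by simp)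
  have h2 : Complex.Gamma =ᶠ[𝓝 1] Complex.GammaIntegral := by
    filter_upwards [(isOpen_lt continuous_const Complex.continuous_re).mem_nhds
      (show (0 : ℝ) < (1 : ℂ).re by simp)] with z hz
    exact Complex.Gamma_eq_integral hz
  have h3 : (∫ t : ℝ in Ioi 0, (t : ℂ) ^ ((1 : ℂ) - 1) * (Real.log t * Real.exp (-t))) =
      ((∫ t in Ioi (0 : ℝ), Real.exp (-t) * Real.log t : ℝ) : ℂ) := by
    rw [← integral_complex_ofReal]
    refine MeasureTheory.setIntegral_congr_fun measurableSet_Ioi fun t _ => ?_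
    simp [mul_comm]
  rw [h3] at h1
  have h4 := h1.congr_of_eventuallyEq h2
  have h5 : HasDerivAt Real.Gamma _ 1 :=
    HasDerivAt.real_of_complex (z := 1) (by rw [Complex.ofReal_one]; exact h4)
  rw [Real.eulerMascheroniConstant_eq_neg_deriv, h5.deriv, neg_neg, Complex.ofReal_re]

theorem laplace_log {d : ℝ} (hd : 0 < d) :
    MeasureTheory.IntegrableOn (fun u => Real.exp (-d * u) * Real.log u) (Ioi 0) ∧
      d * ∫ u in Ioi (0 : ℝ), Real.exp (-d * u) * Real.log u =
        -Real.eulerMascheroniConstant - Real.log d := by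
  have i1 : MeasureTheory.IntegrableOn (fun t : ℝ => Real.exp (-t)) (Ioi 0) := by
    simpa using integrableOn_exp_mul_Ioi (a := -1) (by norm_num) 0
  have i2 : ∫ t in Ioi (0 : ℝ), Real.exp (-t) = 1 := by
    simpa using integral_exp_mul_Ioi (a := -1) (by norm_num) 0
  have h1 := integrableOn_exp_neg_mul_log.sub (i1.mul_const (Real.log d))
  have h2 : ∀ u ∈ Ioi (0 : ℝ), Real.exp (-(d * u)) * Real.log (d * u) -
      Real.exp (-(d * u)) * Real.log d = Real.exp (-d * u) * Real.log u := fun u hu => by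
    rw [Real.log_mul hd.ne' (ne_of_gt hu), neg_mul]; ring
  constructor
  · have h3 := (MeasureTheory.integrableOn_Ioi_comp_mul_left_iff (fun t : ℝ =>
      Real.exp (-t) * Real.log t - Real.exp (-t) * Real.log d) 0 hd).2 (by rw [mul_zero]; exact h1)
    exact h3.congr_fun h2 measurableSet_Ioi
  · have h3 := MeasureTheory.integral_comp_mul_left_Ioi (fun t : ℝ =>
      Real.exp (-t) * Real.log t - Real.exp (-t) * Real.log d) 0 hd
    rw [MeasureTheory.setIntegral_congr_fun measurableSet_Ioi h2, mul_zero,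
      MeasureTheory.integral_sub integrableOn_exp_neg_mul_log (i1.mul_const _),
      MeasureTheory.integral_mul_const, i2, integral_exp_neg_mul_log, one_mul] at h3
    rw [h3, smul_eq_mul, mul_inv_cancel_left₀ hd.ne']

theorem tendsto_laplace_of_tendsto_zero {R : ℝ → ℝ}
    (hi : ∀ U, MeasureTheory.IntegrableOn R (Ioc 0 U)) (hR : Tendsto R atTop (𝓝 0))
    (hm : ∀ d, 0 < d → MeasureTheory.IntegrableOn (fun u => Real.exp (-d * u) * R u) (Ioi 0)) :
    Tendsto (fun d => d * ∫ u in Ioi (0 : ℝ), Real.exp (-d * u) * R u) (𝓝[>] 0) (𝓝 0) := by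
  rw [Metric.tendsto_nhds]
  intro e he
  obtain ⟨U, hU0, hU⟩ : ∃ U : ℝ, 0 < U ∧ ∀ u, U ≤ u → |R u| ≤ e / 2 := by
    have h1 := (Metric.tendsto_nhds.1 hR (e / 2) (by linarith)).and (eventually_gt_atTop 0)
    obtain ⟨U, hU⟩ := eventually_atTop.1 h1
    exact ⟨U, (hU U le_rfl).2, fun u hu => by simpa using (hU u hu).1.le⟩
  set J := ∫ u in Ioc 0 U, |R u|
  have hlim : Tendsto (fun d : ℝ => d * J) (𝓝[>] 0) (𝓝 0) := by
    have : Tendsto (fun d : ℝ => d * J) (𝓝 0) (𝓝 (0 * J)) := (continuous_mul_const J).tendsto 0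
    rw [zero_mul] at this
    exact this.mono_left nhdsWithin_le_nhds
  filter_upwards [hlim.eventually (gt_mem_nhds (show (0 : ℝ) < e / 2 by linarith)),
    self_mem_nhdsWithin] with d hd hd0
  have hd0 : 0 < d := hd0
  have hsplit : Ioi (0 : ℝ) = Ioc 0 U ∪ Ioi U := (Ioc_union_Ioi_eq_Ioi hU0.le).symm
  have i1 := (hm d hd0).mono_set (Ioc_subset_Ioi_self : Ioc 0 U ⊆ Ioi 0)
  have i2 := (hm d hd0).mono_set (Ioi_subset_Ioi hU0.le)
  have hdis : Disjoint (Ioc 0 U) (Ioi U) := Ioc_disjoint_Ioi le_rfl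
  rw [Real.dist_eq, sub_zero, abs_mul, abs_of_pos hd0, hsplit,
    MeasureTheory.setIntegral_union hdis measurableSet_Ioi i1 i2]
  have b1 : |∫ u in Ioc 0 U, Real.exp (-d * u) * R u| ≤ J := by
    rw [← Real.norm_eq_abs]
    refine MeasureTheory.norm_integral_le_of_norm_le (hi U).abs ?_
    refine (MeasureTheory.ae_restrict_iff' measurableSet_Ioc).2 (Eventually.of_forall fun u hu => ?_)
    rw [norm_mul, Real.norm_of_nonneg (Real.exp_pos _).le, Real.norm_eq_abs]
    refine mul_le_of_le_one_left (abs_nonneg _) (Real.exp_le_one_iff.2 ?_)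
    nlinarith [hu.1]
  have i3 : MeasureTheory.IntegrableOn (fun u => Real.exp (-d * u) * (e / 2)) (Ioi 0) :=
    (integrableOn_exp_mul_Ioi (by linarith) 0).mul_const _
  have b2 : |∫ u in Ioi U, Real.exp (-d * u) * R u| ≤ d⁻¹ * (e / 2) := by
    have : ∫ u in Ioi (0 : ℝ), Real.exp (-d * u) * (e / 2) = d⁻¹ * (e / 2) := by
      rw [MeasureTheory.integral_mul_const, integral_exp_mul_Ioi (by linarith)]
      simp
    rw [← this, ← Real.norm_eq_abs]
    refine (MeasureTheory.norm_integral_le_of_norm_le (i3.mono_set (Ioi_subset_Ioi hU0.le)) ?_).trans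
      (MeasureTheory.setIntegral_mono_set i3 ?_ (Ioi_subset_Ioi hU0.le).eventuallyLE)
    · refine (MeasureTheory.ae_restrict_iff' measurableSet_Ioi).2
        (Eventually.of_forall fun u hu => ?_)
      rw [norm_mul, Real.norm_of_nonneg (Real.exp_pos _).le, Real.norm_eq_abs]
      gcongr
      exact hU u (le_of_lt hu)
    · exact Eventually.of_forall fun u => mul_nonneg (Real.exp_pos _).le (by linarith)
  calc _ ≤ d * (J + d⁻¹ * (e / 2)) := by
        gcongr
        exact (abs_add_le _ _).trans (add_le_add b1 b2)
    _ = d * J + e / 2 := by field_simp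
    _ < e := by linarith

theorem mertensSum_eq (u : ℝ) :
    mertensSum u = mertensMean u - 1 / u + Chebyshev.psi (Real.exp u) / (u * Real.exp u) := by
  rw [mertensSum, mertensMean, Chebyshev.psi_eq_sum_Icc, ← Nat.range_succ_eq_Icc_zero,
    Finset.sum_div, add_sub_cancel_right, ← Finset.sum_add_distrib]
  refine Finset.sum_congr rfl fun n _ => ?_
  ring

theorem mertensMean_eq_log_add {u : ℝ} (hu : Real.log 2 ≤ u) :
    mertensMean u = Real.log u + Real.eulerMascheroniConstant + mertensError u := by
  obtain ⟨M, hM⟩ := exists_mertensMean_eq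
  have ha : 0 < Real.log 2 := Real.log_pos one_lt_two
  suffices h : M = Real.eulerMascheroniConstant by rw [← h]; exact hM u hu
  set R : ℝ → ℝ := fun u => mertensSum u - (Real.log u + M) with hR
  have hR0 : Tendsto R atTop (𝓝 0) := by
    have h1 : Tendsto (fun u : ℝ => 1 / u) atTop (𝓝 0) := by
      simpa using tendsto_inv_atTop_zero (𝕜 := ℝ)
    have h2 : Tendsto (fun u => Chebyshev.psi (Real.exp u) / (u * Real.exp u)) atTop (𝓝 0) := by
      have h3 := h1.const_mul (Real.log 4 + 4)
      rw [mul_zero] at h3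
      refine tendsto_of_tendsto_of_tendsto_of_le_of_le' tendsto_const_nhds h3 ?_ ?_
      · filter_upwards [eventually_gt_atTop 0] with u hu
        exact div_nonneg (Chebyshev.psi_nonneg _) (by positivity)
      · filter_upwards [eventually_gt_atTop 0] with u hu
        have := Chebyshev.psi_le_const_mul_self (Real.exp_pos u).le
        have hE := Real.exp_pos u
        rw [div_le_iff₀ (by positivity)]
        calc _ ≤ _ := this
          _ = _ := by field_simp
    have h4 := (tendsto_mertensError.sub h1).add h2
    simp only [sub_zero, add_zero] at h4
    refine h4.congr' ?_
    filter_upwards [eventually_ge_atTop (Real.log 2)] with u hu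
    rw [hR]
    simp only
    rw [mertensSum_eq u, hM u hu]
    ring
  have hlog : ∀ U, MeasureTheory.IntegrableOn Real.log (Ioc 0 U) := fun U => by
    rcases le_total 0 U with h | h
    · exact (intervalIntegrable_iff_integrableOn_Ioc_of_le h).1 intervalIntegral.intervalIntegrable_log'
    · rw [Ioc_eq_empty (not_lt.2 h)]; exact MeasureTheory.integrableOn_empty
  have hRi : ∀ U, MeasureTheory.IntegrableOn R (Ioc 0 U) := fun U => by
    have h1 : MeasureTheory.IntegrableOn mertensSum (Ioc 0 U) := by
      refine MeasureTheory.IntegrableOn.mono_set ?_ (Ioc_subset_Icc_self)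
      exact (mertensSum_mono.monotoneOn _).integrableOn_isCompact isCompact_Icc
    exact h1.sub ((hlog U).add (MeasureTheory.integrableOn_const (by simp)))
  have hRm : ∀ d, 0 < d → MeasureTheory.IntegrableOn (fun u => Real.exp (-d * u) * R u) (Ioi 0) := by
    intro d hd
    obtain ⟨U, hU⟩ := eventually_atTop.1 ((Metric.tendsto_nhds.1 hR0 1 one_pos).and
      (eventually_gt_atTop 0))
    have hU0 := (hU U le_rfl).2
    rw [← Ioc_union_Ioi_eq_Ioi hU0.le]
    have hmeas : Measurable R := mertensSum_mono.measurable.sub (Real.measurable_log.add_const M)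
    have hmeas' : Measurable fun u => Real.exp (-d * u) * R u := (by fun_prop : Measurable
      fun u : ℝ => Real.exp (-d * u)).mul hmeas
    refine MeasureTheory.IntegrableOn.union ?_ ?_
    · refine MeasureTheory.Integrable.mono' (hRi U).abs hmeas'.aestronglyMeasurable ?_
      refine (MeasureTheory.ae_restrict_iff' measurableSet_Ioc).2
        (Eventually.of_forall fun u hu => ?_)
      rw [norm_mul, Real.norm_of_nonneg (Real.exp_pos _).le, Real.norm_eq_abs]
      refine mul_le_of_le_one_left (abs_nonneg _) (Real.exp_le_one_iff.2 ?_)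
      nlinarith [hu.1]
    · refine MeasureTheory.Integrable.mono' (integrableOn_exp_mul_Ioi (a := -d) (by linarith) U)
        hmeas'.aestronglyMeasurable ?_
      refine (MeasureTheory.ae_restrict_iff' measurableSet_Ioi).2
        (Eventually.of_forall fun u hu => ?_)
      rw [norm_mul, Real.norm_of_nonneg (Real.exp_pos _).le]
      refine mul_le_of_le_one_right (Real.exp_pos _).le ?_
      simpa using (hU u (le_of_lt hu)).1.le
  have hT := tendsto_laplace_of_tendsto_zero hRi hR0 hRm
  have hZ : Tendsto (fun d : ℝ => Real.log (riemannZeta ((1 + d : ℝ) : ℂ)).re + Real.log d)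
      (𝓝[>] 0) (𝓝 0) := by
    have h1 := (Asymptotics.isLittleO_one_iff ℝ).1 log_riemannZeta_add_log_sub_isLittleO_ofReal
    have h2 : Tendsto (fun d : ℝ => 1 + d) (𝓝[>] 0) (𝓝[>] 1) := by
      refine tendsto_nhdsWithin_iff.2 ⟨?_, ?_⟩
      · have : Tendsto (fun d : ℝ => 1 + d) (𝓝 0) (𝓝 (1 + 0)) := (continuous_const_add 1).tendsto 0
        rw [add_zero] at this
        exact this.mono_left nhdsWithin_le_nhds
      · filter_upwards [self_mem_nhdsWithin] with d hd
        simpa using hd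
    refine (h1.comp h2).congr fun d => ?_
    simp
  have hE : ∀ᶠ d : ℝ in 𝓝[>] 0, Real.log (riemannZeta ((1 + d : ℝ) : ℂ)).re + Real.log d =
      M - Real.eulerMascheroniConstant + d * ∫ u in Ioi (0 : ℝ), Real.exp (-d * u) * R u := by
    filter_upwards [self_mem_nhdsWithin] with d hd
    have hd : 0 < d := hd
    obtain ⟨l1, l2⟩ := laplace_log hd
    have i1 := (integrableOn_exp_mul_Ioi (a := -d) (by linarith) 0).mul_const M
    have i2 : MeasureTheory.Integrable (fun u => Real.exp (-d * u) * Real.log u +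
        Real.exp (-d * u) * M) (MeasureTheory.volume.restrict (Ioi 0)) := l1.add i1
    have e1 : ∫ u in Ioi (0 : ℝ), Real.exp (-d * u) * mertensSum u =
        (∫ u in Ioi (0 : ℝ), Real.exp (-d * u) * Real.log u) +
        (∫ u in Ioi (0 : ℝ), Real.exp (-d * u) * M) +
        ∫ u in Ioi (0 : ℝ), Real.exp (-d * u) * R u := by
      rw [← MeasureTheory.integral_add l1 i1, ← MeasureTheory.integral_add i2 (hRm d hd)]
      refine MeasureTheory.setIntegral_congr_fun measurableSet_Ioi fun u _ => ?_
      simp only [hR]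
      ring
    have e2 : d * ∫ u in Ioi (0 : ℝ), Real.exp (-d * u) * M = M := by
      rw [MeasureTheory.integral_mul_const, integral_exp_mul_Ioi (by linarith)]
      simp
      field_simp
    rw [log_riemannZeta_eq_integral hd, e1, mul_add, mul_add, l2, e2]
    ring
  have h1 := (tendsto_congr' hE).1 hZ
  have h2 := tendsto_nhds_unique h1 (hT.const_add (M - Real.eulerMascheroniConstant))
  linarith

theorem hasDerivAt_recipWeightDeriv {v : ℝ} (hv : v ≠ 0) :
    HasDerivAt recipWeightDeriv (-(2 / v ^ 3 + 6 / v ^ 4)) v := by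
  have h := ((hasDerivAt_pow 2 v).fun_inv (pow_ne_zero 2 hv)).add
    (((hasDerivAt_pow 3 v).fun_inv (pow_ne_zero 3 hv)).const_mul 2)
  have e : recipWeightDeriv = (fun x : ℝ => (x ^ 2)⁻¹) + fun x => 2 * (x ^ 3)⁻¹ := by
    funext x; simp [recipWeightDeriv, div_eq_mul_inv]
  rw [e]
  refine h.congr_deriv ?_
  field_simp
  push_cast
  ring

theorem tendsto_recipWeightDeriv : Tendsto recipWeightDeriv atTop (𝓝 0) := by
  have h1 : Tendsto (fun v : ℝ => v⁻¹) atTop (𝓝 0) := tendsto_inv_atTop_zero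
  have h2 := (h1.pow 2).add ((h1.pow 3).const_mul 2)
  simp only [ne_eq, OfNat.ofNat_ne_zero, not_false_eq_true, zero_pow, add_zero, mul_zero] at h2
  refine h2.congr fun v => ?_
  simp [recipWeightDeriv, div_eq_mul_inv]

theorem norm_integral_exp_mul_recipWeightDeriv_le {c : ℂ} (hc : c ≠ 0) (hc0 : 0 ≤ c.re) {u : ℝ}
    (hu : 0 < u) :
    ‖∫ v in Ioi u, recipWeightDeriv v • Complex.exp (-c * v)‖ ≤
      2 / ‖c‖ * (recipWeightDeriv u * Real.exp (-c.re * u)) := by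
  have hE : ∀ v : ℝ, ‖Complex.exp (-c * v)‖ = Real.exp (-c.re * v) := fun v => by
    rw [Complex.norm_exp]; simp
  have hE1 : ∀ v : ℝ, 0 ≤ v → ‖Complex.exp (-c * v)‖ ≤ 1 := fun v hv => by
    rw [hE, Real.exp_le_one_iff]; nlinarith
  have hEu : ∀ v : ℝ, u ≤ v → ‖Complex.exp (-c * v)‖ ≤ Real.exp (-c.re * u) := fun v hv => by
    rw [hE]; exact Real.exp_le_exp.2 (by nlinarith)
  have i1 := integrableOn_mul_recipWeightDeriv (f := fun v : ℝ => Complex.exp (-c * v))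
    (Continuous.continuousOn (by fun_prop)) hE1 hu
  have j0 := MeasureTheory.integrableOn_Ioi_deriv_of_nonneg' (g := fun v => -recipWeightDeriv v)
    (g' := fun v => 2 / v ^ 3 + 6 / v ^ 4) (a := u) (l := -0)
    (fun x hx => (hasDerivAt_recipWeightDeriv (lt_of_lt_of_le hu hx).ne').fun_neg.congr_deriv
      (neg_neg _)) (fun x hx => by have : 0 < x := hu.trans hx; positivity)
    tendsto_recipWeightDeriv.neg
  have j1 := MeasureTheory.integral_Ioi_of_hasDerivAt_of_nonneg' (g := fun v => -recipWeightDeriv v)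
    (g' := fun v => 2 / v ^ 3 + 6 / v ^ 4) (a := u) (l := -0)
    (fun x hx => (hasDerivAt_recipWeightDeriv (lt_of_lt_of_le hu hx).ne').fun_neg.congr_deriv
      (neg_neg _)) (fun x hx => by have : 0 < x := hu.trans hx; positivity)
    tendsto_recipWeightDeriv.neg
  rw [neg_zero, zero_sub, neg_neg] at j1
  have hb : ∀ᵐ v : ℝ ∂MeasureTheory.volume.restrict (Ioi u),
      ‖(2 / v ^ 3 + 6 / v ^ 4 : ℝ) • Complex.exp (-c * v)‖ ≤
        (2 / v ^ 3 + 6 / v ^ 4) * Real.exp (-c.re * u) := by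
    refine (MeasureTheory.ae_restrict_iff' measurableSet_Ioi).2 (Eventually.of_forall fun v hv => ?_)
    have hv0 : 0 < v := hu.trans hv
    have : 0 ≤ 2 / v ^ 3 + 6 / v ^ 4 := by positivity
    rw [norm_smul, Real.norm_of_nonneg this]
    exact mul_le_mul_of_nonneg_left (hEu v (le_of_lt hv)) this
  have i2 : MeasureTheory.IntegrableOn
      (fun v : ℝ => (2 / v ^ 3 + 6 / v ^ 4 : ℝ) • Complex.exp (-c * v)) (Ioi u) := by
    refine MeasureTheory.Integrable.mono' (j0.mul_const (Real.exp (-c.re * u))) ?_ hb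
    refine ContinuousOn.aestronglyMeasurable ?_ measurableSet_Ioi
    have hcE : Continuous fun v : ℝ => Complex.exp (-c * v) := by fun_prop
    have hcW : ContinuousOn (fun v : ℝ => 2 / v ^ 3 + 6 / v ^ 4) (Ioi u) := by
      refine ContinuousOn.add ?_ ?_ <;>
      exact ContinuousOn.div continuousOn_const (by fun_prop)
        fun x hx => pow_ne_zero _ (ne_of_gt (hu.trans hx))
    exact hcW.smul hcE.continuousOn
  have b2 : ‖∫ v : ℝ in Ioi u, (2 / v ^ 3 + 6 / v ^ 4 : ℝ) • Complex.exp (-c * v)‖ ≤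
      recipWeightDeriv u * Real.exp (-c.re * u) := by
    refine (MeasureTheory.norm_integral_le_of_norm_le (j0.mul_const _) hb).trans_eq ?_
    rw [MeasureTheory.integral_mul_const, j1]
  have key : ∫ v : ℝ in Ioi u, (c * (recipWeightDeriv v • Complex.exp (-c * v)) +
      (2 / v ^ 3 + 6 / v ^ 4 : ℝ) • Complex.exp (-c * v)) =
      0 - -(recipWeightDeriv u • Complex.exp (-c * u)) := by
    refine MeasureTheory.integral_Ioi_of_hasDerivAt_of_tendsto'
      (f := fun v : ℝ => -(recipWeightDeriv v • Complex.exp (-c * v))) (fun v hv => ?_)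
      ((i1.const_mul c).add i2) ?_
    · have hv0 : v ≠ 0 := (lt_of_lt_of_le hu hv).ne'
      have d1 : HasDerivAt (fun v : ℝ => Complex.exp (-c * v)) (Complex.exp (-c * v) * -c) v := by
        have := ((hasDerivAt_id (v : ℂ)).const_mul (-c)).cexp.comp_ofReal
        simpa using this
      refine ((hasDerivAt_recipWeightDeriv hv0).smul d1).neg.congr_deriv ?_
      simp only [Complex.real_smul]
      push_cast
      ring
    · rw [tendsto_zero_iff_norm_tendsto_zero]
      refine squeeze_zero' (Eventually.of_forall fun _ => norm_nonneg _) ?_ tendsto_recipWeightDeriv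
      filter_upwards [eventually_ge_atTop 0] with v hv
      rw [norm_neg, norm_smul, Real.norm_of_nonneg (recipWeightDeriv_nonneg hv)]
      exact mul_le_of_le_one_right (recipWeightDeriv_nonneg hv) (hE1 v hv)
  rw [MeasureTheory.integral_add (i1.const_mul c) i2, MeasureTheory.integral_const_mul] at key
  have k2 : c * ∫ v in Ioi u, recipWeightDeriv v • Complex.exp (-c * v) =
      recipWeightDeriv u • Complex.exp (-c * u) -
        ∫ v : ℝ in Ioi u, (2 / v ^ 3 + 6 / v ^ 4 : ℝ) • Complex.exp (-c * v) := by
    rw [eq_sub_iff_add_eq, key]; simp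
  have k3 : ‖c‖ * ‖∫ v in Ioi u, recipWeightDeriv v • Complex.exp (-c * v)‖ ≤
      2 * (recipWeightDeriv u * Real.exp (-c.re * u)) := by
    rw [← norm_mul, k2]
    refine (norm_sub_le _ _).trans ?_
    rw [norm_smul, Real.norm_of_nonneg (recipWeightDeriv_nonneg hu.le), hE]
    linarith
  have hcn : 0 < ‖c‖ := norm_pos_iff.2 hc
  rw [div_mul_eq_mul_div, le_div_iff₀ hcn]
  linarith

theorem norm_integral_zeroExp_le {α : ℂ} (h : zeroCoeff α ≠ 0) {u : ℝ} (hu : 0 < u) :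
    ‖∫ v in Ioi u, recipWeightDeriv v • zeroExp α v‖ ≤ recipWeightDeriv u / 3 * zeroBound α u := by
  have hx := xiMult_ne_zero_of_zeroCoeff h
  have hr := abs_lt.1 (abs_re_lt_of_xiMult_ne_zero hx)
  have him := (sq_im_ge_of_xiMult_ne_zero hx).1
  have him6 : 6 ≤ |α.im| := by nlinarith [sq_abs α.im, abs_nonneg α.im]
  have hn1 : 6 ≤ ‖1 / 2 - α‖ := by
    refine him6.trans (le_trans (le_of_eq ?_) (Complex.abs_im_le_norm _)); simp
  have hn2 : 6 ≤ ‖1 / 2 + α‖ := by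
    refine him6.trans (le_trans (le_of_eq ?_) (Complex.abs_im_le_norm _)); simp
  have hc1 : (1 / 2 - α : ℂ) ≠ 0 := norm_pos_iff.1 (by linarith)
  have hc2 : (1 / 2 + α : ℂ) ≠ 0 := norm_pos_iff.1 (by linarith)
  have r1 : (1 / 2 - α : ℂ).re = 1 / 2 - α.re := by simp
  have r2 : (1 / 2 + α : ℂ).re = 1 / 2 + α.re := by simp
  have hw := recipWeightDeriv_nonneg hu.le
  have bd : ∀ c : ℂ, 6 ≤ ‖c‖ → 0 ≤ c.re →
      ‖∫ v in Ioi u, recipWeightDeriv v • Complex.exp (-c * v)‖ ≤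
        1 / 3 * (recipWeightDeriv u * Real.exp (-c.re * u)) := fun c hc hc0 => by
    refine (norm_integral_exp_mul_recipWeightDeriv_le (norm_pos_iff.1 (by linarith)) hc0 hu).trans ?_
    have : 2 / ‖c‖ ≤ 1 / 3 := by rw [div_le_div_iff₀ (by linarith) (by norm_num)]; linarith
    exact mul_le_mul_of_nonneg_right this (mul_nonneg hw (Real.exp_pos _).le)
  have b1 := bd _ hn1 (by rw [r1]; linarith)
  have b2 := bd _ hn2 (by rw [r2]; linarith)
  rw [r1] at b1
  rw [r2] at b2
  have ii : ∀ c : ℂ, 0 ≤ c.re → MeasureTheory.IntegrableOn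
      (fun v : ℝ => recipWeightDeriv v • Complex.exp (-c * v)) (Ioi u) := fun c hc =>
    integrableOn_mul_recipWeightDeriv (f := fun v : ℝ => Complex.exp (-c * v))
      (Continuous.continuousOn (by fun_prop)) (B := 1) (fun v hv => by
        rw [Complex.norm_exp, Real.exp_le_one_iff]; simp; nlinarith) hu
  have e : ∫ v in Ioi u, recipWeightDeriv v • zeroExp α v =
      ((∫ v in Ioi u, recipWeightDeriv v • Complex.exp (-(1 / 2 - α) * v)) +
        ∫ v in Ioi u, recipWeightDeriv v • Complex.exp (-(1 / 2 + α) * v)) / 2 := by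
    rw [← MeasureTheory.integral_add (ii _ (by rw [r1]; linarith)) (ii _ (by rw [r2]; linarith)),
      ← MeasureTheory.integral_div]
    refine MeasureTheory.setIntegral_congr_fun measurableSet_Ioi fun v _ => ?_
    simp only [zeroExp, Complex.real_smul]
    rw [show α - 1 / 2 = -(1 / 2 - α) by ring, show -α - 1 / 2 = -(1 / 2 + α) by ring]
    ring
  rw [e, norm_div, Complex.norm_ofNat]
  have hz := exp_add_exp_le_zeroBound α hu.le
  rw [show α.re - 1 / 2 = -(1 / 2 - α.re) by ring, show -α.re - 1 / 2 = -(1 / 2 + α.re) by ring] at hz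
  have h3 := (norm_add_le _ _).trans (add_le_add b1 b2)
  have h4 := mul_le_mul_of_nonneg_left hz hw
  linarith

/-- The total size of the contributions of the nontrivial zeros. -/
noncomputable def zeroBoundSum (u : ℝ) : ℝ := ∑' α : ℂ, ‖zeroCoeff α‖ * zeroBound α u

theorem summable_zeroBoundSum {u : ℝ} (hu : 0 ≤ u) :
    Summable fun α : ℂ => ‖zeroCoeff α‖ * zeroBound α u :=
  Summable.of_nonneg_of_le (fun α => mul_nonneg (norm_nonneg _) (zeroBound_nonneg α u))
    (fun α => norm_zeroCoeff_mul_zeroBound_le α hu) summable_norm_zeroCoeff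

theorem norm_zeroSum_le {u : ℝ} (hu : 0 ≤ u) : ‖zeroSum u‖ ≤ zeroBoundSum u :=
  tsum_of_norm_bounded (summable_zeroBoundSum hu).hasSum fun α => by
    rw [norm_mul]; exact mul_le_mul_of_nonneg_left (norm_zeroExp_le α hu) (norm_nonneg _)

theorem integrableOn_zeroSum {u : ℝ} (hu : 0 < u) :
    MeasureTheory.IntegrableOn (fun v => recipWeightDeriv v • zeroSum v) (Ioi u) :=
  integrableOn_mul_recipWeightDeriv continuousOn_zeroSum (B := ∑' α, ‖zeroCoeff α‖)
    (fun _ hv => tsum_of_norm_bounded summable_norm_zeroCoeff.hasSum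
      fun α => norm_zeroCoeff_mul_zeroExp_le α hv) hu

theorem norm_integral_zeroSum_le {u : ℝ} (hu : 0 < u) :
    ‖∫ v in Ioi u, recipWeightDeriv v • zeroSum v‖ ≤ recipWeightDeriv u / 3 * zeroBoundSum u := by
  have hi : ∀ α : XiZero, MeasureTheory.IntegrableOn
      (fun v => recipWeightDeriv v • (zeroCoeff α * zeroExp α v)) (Ioi u) := fun α =>
    integrableOn_mul_recipWeightDeriv ((continuous_zeroExp α).const_mul _).continuousOn
      (fun v hv => norm_zeroCoeff_mul_zeroExp_le α hv) hu
  have hsn := summable_norm_zeroCoeff.subtype (Function.support zeroCoeff)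
  have h1 := MeasureTheory.hasSum_integral_of_summable_integral_norm hi (by
    refine Summable.of_nonneg_of_le (fun α => by positivity) (fun α => ?_)
      (hsn.mul_right (recipWeight u))
    rw [← integral_recipWeightDeriv hu, ← MeasureTheory.integral_const_mul]
    refine MeasureTheory.integral_mono_of_nonneg (Eventually.of_forall fun _ => norm_nonneg _)
      ((integrableOn_recipWeightDeriv hu).const_mul _) ?_
    refine (MeasureTheory.ae_restrict_iff' measurableSet_Ioi).2 (Eventually.of_forall fun v hv => ?_)
    have hv0 : 0 < v := hu.trans hv
    simp only
    rw [norm_smul, Real.norm_of_nonneg (recipWeightDeriv_nonneg hv0.le), mul_comm]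
    exact mul_le_mul_of_nonneg_right (norm_zeroCoeff_mul_zeroExp_le α hv0.le)
      (recipWeightDeriv_nonneg hv0.le))
  have h2 : ∫ v in Ioi u, ∑' α : XiZero, recipWeightDeriv v • (zeroCoeff α * zeroExp α v) =
      ∫ v in Ioi u, recipWeightDeriv v • zeroSum v := by
    refine MeasureTheory.setIntegral_congr_fun measurableSet_Ioi fun v hv => ?_
    have hv0 : 0 < v := hu.trans hv
    have := (hasSum_xiZero (hasSum_zeroSum hv0.le) fun α h => by simp [h]).const_smul
      (recipWeightDeriv v)
    exact this.tsum_eq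
  rw [h2] at h1
  have h3 := hasSum_xiZero ((summable_zeroBoundSum hu.le).hasSum.mul_left (recipWeightDeriv u / 3))
    fun α h => by simp [h]
  rw [← h1.tsum_eq]
  refine tsum_of_norm_bounded h3 fun α => ?_
  have h4 : ∫ v in Ioi u, recipWeightDeriv v • (zeroCoeff α * zeroExp α v) =
      zeroCoeff α * ∫ v in Ioi u, recipWeightDeriv v • zeroExp α v := by
    rw [← MeasureTheory.integral_const_mul]
    refine MeasureTheory.setIntegral_congr_fun measurableSet_Ioi fun v _ => ?_
    simp only [Complex.real_smul]; ring
  rw [h4, norm_mul]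
  have := mul_le_mul_of_nonneg_left (norm_integral_zeroExp_le α.2 hu) (norm_nonneg (zeroCoeff α))
  linarith

theorem integral_exp_neg_mul_recipWeightDeriv {u : ℝ} (hu : 0 < u) :
    ∫ v in Ioi u, Real.exp (-v) * recipWeightDeriv v = Real.exp (-u) / u ^ 2 := by
  have hl : Tendsto (fun v : ℝ => -(Real.exp (-v) / v ^ 2)) atTop (𝓝 (-(0 * 0 ^ 2))) := by
    have h1 : Tendsto (fun v : ℝ => v⁻¹) atTop (𝓝 0) := tendsto_inv_atTop_zero
    have h2 : Tendsto (fun v : ℝ => Real.exp (-v)) atTop (𝓝 0) := Real.tendsto_exp_neg_atTop_nhds_zero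
    refine ((h2.mul (h1.pow 2)).neg).congr fun v => ?_
    rw [inv_pow, div_eq_mul_inv]
  have h := MeasureTheory.integral_Ioi_of_hasDerivAt_of_nonneg' (a := u)
    (g := fun v => -(Real.exp (-v) / v ^ 2)) (g' := fun v => Real.exp (-v) * recipWeightDeriv v)
    (fun v hv => ?_) (fun v hv => mul_nonneg (Real.exp_pos _).le
      (recipWeightDeriv_nonneg (hu.trans hv).le)) hl
  · simpa using h
  · have hv0 : v ≠ 0 := (lt_of_lt_of_le hu hv).ne'
    have d1 : HasDerivAt (fun v : ℝ => Real.exp (-v)) (-Real.exp (-v)) v := by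
      simpa using (hasDerivAt_neg v).exp
    refine (d1.fun_div (hasDerivAt_pow 2 v) (pow_ne_zero 2 hv0)).fun_neg.congr_deriv ?_
    rw [recipWeightDeriv]
    push_cast
    field_simp
    ring

theorem trivSum_antitone {u v : ℝ} (hu : 0 ≤ u) (h : u ≤ v) : trivSum v ≤ trivSum u := by
  refine (hasSum_trivSum (hu.trans h)).summable.tsum_le_tsum (fun k => ?_)
    (hasSum_trivSum hu).summable
  have := trivCoeff_nonneg k
  gcongr ?_ * Real.exp ?_
  nlinarith [Nat.cast_nonneg (α := ℝ) k]

theorem mertensError_le {u : ℝ} (hu : 0 < u) :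
    mertensError u ≤ Real.log (2 * Real.pi) * (Real.exp (-u) / u) +
      (recipWeight u + recipWeightDeriv u / 3) * zeroBoundSum u := by
  have iE : MeasureTheory.IntegrableOn (fun v : ℝ => Real.exp (-v) * recipWeightDeriv v) (Ioi u) := by
    have := integrableOn_mul_recipWeightDeriv (f := fun v : ℝ => Real.exp (-v))
      (Continuous.continuousOn (by fun_prop)) (B := 1) (fun v hv => by
        rw [Real.norm_of_nonneg (Real.exp_pos _).le, Real.exp_le_one_iff]; linarith) hu
    simpa only [smul_eq_mul, mul_comm] using this
  have iT : MeasureTheory.IntegrableOn (fun v : ℝ => trivSum v * recipWeightDeriv v) (Ioi u) := by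
    have := integrableOn_mul_recipWeightDeriv continuousOn_trivSum (B := trivSum 0) (fun v hv => by
        rw [Real.norm_of_nonneg (trivSum_nonneg v)]; exact trivSum_antitone le_rfl hv) hu
    simpa only [smul_eq_mul, mul_comm] using this
  have iZ := integrableOn_zeroSum hu
  have bT : ∫ v in Ioi u, trivSum v * recipWeightDeriv v ≤ trivSum u * recipWeight u := by
    rw [← integral_recipWeightDeriv hu, ← MeasureTheory.integral_const_mul]
    refine MeasureTheory.setIntegral_mono_on iT ((integrableOn_recipWeightDeriv hu).const_mul _)
      measurableSet_Ioi fun v hv => ?_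
    exact mul_le_mul_of_nonneg_right (trivSum_antitone hu.le (le_of_lt hv))
      (recipWeightDeriv_nonneg (hu.trans hv).le)
  have eZ : ∫ v in Ioi u, (zeroSum v).re * recipWeightDeriv v =
      (∫ v in Ioi u, recipWeightDeriv v • zeroSum v).re := by
    have := integral_re iZ
    simp only [RCLike.re_to_complex] at this
    rw [← this]
    refine MeasureTheory.setIntegral_congr_fun measurableSet_Ioi fun v _ => ?_
    simp [mul_comm]
  have iZ' : MeasureTheory.IntegrableOn (fun v : ℝ => (zeroSum v).re * recipWeightDeriv v) (Ioi u) := by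
    have := iZ.re
    refine MeasureTheory.Integrable.congr this (Eventually.of_forall fun v => ?_)
    simp [mul_comm]
  have e : ∫ v in Ioi u, meanError v * recipWeightDeriv v =
      -Real.log (2 * Real.pi) * (Real.exp (-u) / u ^ 2) +
        (∫ v in Ioi u, trivSum v * recipWeightDeriv v) -
        ∫ v in Ioi u, (zeroSum v).re * recipWeightDeriv v := by
    have i1 : MeasureTheory.IntegrableOn (fun v : ℝ => -Real.log (2 * Real.pi) *
      (Real.exp (-v) * recipWeightDeriv v) + trivSum v * recipWeightDeriv v) (Ioi u) :=
      (iE.const_mul _).add iT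
    rw [← integral_exp_neg_mul_recipWeightDeriv hu, ← MeasureTheory.integral_const_mul,
      ← MeasureTheory.integral_add (iE.const_mul _) iT, ← MeasureTheory.integral_sub i1 iZ']
    refine MeasureTheory.setIntegral_congr_fun measurableSet_Ioi fun v _ => ?_
    simp only [meanError]
    ring
  have hz1 := (Complex.re_le_norm _).trans (norm_zeroSum_le hu.le)
  have hz2 := (neg_le_abs _).trans ((Complex.abs_re_le_norm _).trans (norm_integral_zeroSum_le hu))
  have hz3 := mul_le_mul_of_nonneg_right hz1 (recipWeight_nonneg hu.le)
  rw [mertensError, e, eZ, meanError]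
  have e2 : Real.log (2 * Real.pi) * (Real.exp (-u) / u) =
      Real.log (2 * Real.pi) * Real.exp (-u) * recipWeight u -
        Real.log (2 * Real.pi) * (Real.exp (-u) / u ^ 2) := by
    rw [recipWeight]; field_simp; ring
  rw [e2]
  linarith

theorem hasSum_vonMangoldt_logDeriv_zeta {s : ℂ} (hs : 1 < s.re) :
    HasSum (fun n : ℕ => (Λ n : ℂ) * (n : ℂ) ^ (-s)) (-logDeriv riemannZeta s) := by
  have h := (ArithmeticFunction.LSeriesSummable_vonMangoldt hs).hasSum
  rw [show ∑' n, LSeries.term (fun n => (Λ n : ℂ)) s n = LSeries (fun n => (Λ n : ℂ)) s from rfl,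
    ArithmeticFunction.LSeries_vonMangoldt_eq_deriv_riemannZeta_div hs] at h
  rw [logDeriv_apply, ← neg_div]
  refine h.congr_fun fun n => ?_
  rcases eq_or_ne n 0 with rfl | hn
  · simp
  · rw [LSeries.term_of_ne_zero hn, Complex.cpow_neg, div_eq_mul_inv]

theorem hasSum_vonMangoldt_logDeriv_zeta_re {σ : ℝ} (hs : 1 < σ) (t : ℝ) :
    HasSum (fun n : ℕ => Λ n * (Real.exp (-(σ * Real.log n)) * Real.cos (t * Real.log n)))
      (-(logDeriv riemannZeta (σ + t * Complex.I)).re) := by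
  have h := Complex.hasSum_re (hasSum_vonMangoldt_logDeriv_zeta (s := σ + t * Complex.I)
    (by simpa using hs))
  rw [Complex.neg_re] at h
  refine h.congr_fun fun n => ?_
  rcases eq_or_ne n 0 with rfl | hn
  · simp
  · rw [Complex.re_ofReal_mul, Complex.cpow_def_of_ne_zero (by exact_mod_cast hn),
      ← Complex.natCast_log, show (Real.log n : ℂ) * -(σ + t * Complex.I) =
        ((-(σ * Real.log n) : ℝ) : ℂ) + ((-(t * Real.log n) : ℝ) : ℂ) * Complex.I by
          push_cast; ring, Complex.exp_re]
    generalize Real.log n = y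
    simp

theorem logDeriv_zeta_comb_nonpos {σ : ℝ} (hs : 1 < σ) (t : ℝ) :
    3 * (logDeriv riemannZeta σ).re + 4 * (logDeriv riemannZeta (σ + t * Complex.I)).re +
      (logDeriv riemannZeta (σ + 2 * t * Complex.I)).re ≤ 0 := by
  have h0 := (hasSum_vonMangoldt_logDeriv_zeta_re hs 0).mul_left 3
  have h1 := (hasSum_vonMangoldt_logDeriv_zeta_re hs t).mul_left 4
  have h2 := hasSum_vonMangoldt_logDeriv_zeta_re hs (2 * t)
  have h := ((h0.add h1).add h2).nonneg fun n => by
    have e : Real.cos (2 * t * Real.log n) = 2 * Real.cos (t * Real.log n) ^ 2 - 1 := by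
      rw [mul_assoc, Real.cos_two_mul]
    have p := mul_nonneg (ArithmeticFunction.vonMangoldt_nonneg (n := n))
      (Real.exp_pos (-(σ * Real.log n))).le
    rw [e, zero_mul, Real.cos_zero]
    nlinarith [mul_nonneg p (sq_nonneg (1 + Real.cos (t * Real.log n)))]
  push_cast at h
  simp only [zero_mul, add_zero] at h
  linarith

theorem re_logDeriv_zeta_nonpos {σ : ℝ} (hs : 1 < σ) : (logDeriv riemannZeta σ).re ≤ 0 := by
  have h := (hasSum_vonMangoldt_logDeriv_zeta_re hs 0).nonneg fun n => by
    rw [zero_mul, Real.cos_zero]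
    exact mul_nonneg ArithmeticFunction.vonMangoldt_nonneg (by positivity)
  simp only [Complex.ofReal_zero, zero_mul, add_zero] at h
  linarith

theorem div_sq_sub_sq_eq {z α : ℂ} (h1 : z - α ≠ 0) (h2 : z + α ≠ 0) :
    z / (z ^ 2 - α ^ 2) = ((z - α)⁻¹ + (z + α)⁻¹) / 2 := by
  rw [show z ^ 2 - α ^ 2 = (z - α) * (z + α) by ring]
  field_simp
  ring

theorem re_inv_nonneg {w : ℂ} (h : 0 ≤ w.re) : 0 ≤ w⁻¹.re := by
  rw [Complex.inv_re]; exact div_nonneg h (Complex.normSq_nonneg _)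

theorem hasSum_re_logDeriv_centredXi {z : ℂ} (hz : 1 / 2 ≤ z.re) :
    HasSum (fun α => (xiMult α : ℝ) * (((z - α)⁻¹.re + (z + α)⁻¹.re) / 2))
      (logDeriv centredXi z).re := by
  refine (Complex.hasSum_re (hasSum_logDeriv_centredXi (centredXi_ne_zero hz))).congr_fun
    fun α => ?_
  rcases eq_or_ne (xiMult α) 0 with h | h
  · simp [h]
  · have := abs_lt.1 (abs_re_lt_of_xiMult_ne_zero h)
    rw [div_sq_sub_sq_eq (fun e => ?_) (fun e => ?_)]
    · rw [show ((xiMult α : ℕ) : ℂ) = ((xiMult α : ℝ) : ℂ) by simp, Complex.re_ofReal_mul,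
        Complex.div_ofNat_re, Complex.add_re]
    · have := congrArg Complex.re e; simp at this; linarith
    · have := congrArg Complex.re e; simp at this; linarith

theorem re_logDeriv_term_nonneg {z : ℂ} (hz : 1 / 2 ≤ z.re) (α : ℂ) :
    0 ≤ (xiMult α : ℝ) * (((z - α)⁻¹.re + (z + α)⁻¹.re) / 2) := by
  rcases eq_or_ne (xiMult α) 0 with h | h
  · simp [h]
  · have := abs_lt.1 (abs_re_lt_of_xiMult_ne_zero h)
    have h1 := re_inv_nonneg (w := z - α) (by simp; linarith)
    have h2 := re_inv_nonneg (w := z + α) (by simp; linarith)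
    positivity

theorem re_logDeriv_centredXi_nonneg {z : ℂ} (hz : 1 / 2 ≤ z.re) :
    0 ≤ (logDeriv centredXi z).re :=
  (hasSum_re_logDeriv_centredXi hz).nonneg (re_logDeriv_term_nonneg hz)

/-- A zero off the critical line, together with its three mirror images, contributes to the
logarithmic derivative at the same height. -/
theorem le_re_logDeriv_centredXi {α : ℂ} (h : xiMult α ≠ 0) (hre : α.re ≠ 0) {x : ℝ}
    (hx : 1 / 2 ≤ x) :
    (x - α.re)⁻¹ + (x + α.re)⁻¹ ≤ (logDeriv centredXi (x + α.im * Complex.I)).re := by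
  set z : ℂ := x + α.im * Complex.I with hz
  have hzre : z.re = x := by simp [hz]
  have hzim : z.im = α.im := by simp [hz]
  have hz2 : 1 / 2 ≤ z.re := by rwa [hzre]
  have him : α.im ≠ 0 := fun h0 => by
    have := (sq_im_ge_of_xiMult_ne_zero h).1; rw [h0] at this; norm_num at this
  have hb := abs_lt.1 (abs_re_lt_of_xiMult_ne_zero h)
  set c := (starRingEnd ℂ) α with hc
  have e1 : (z - α)⁻¹.re = (x - α.re)⁻¹ := by
    rw [show z - α = ((x - α.re : ℝ) : ℂ) by apply Complex.ext <;> simp [hz]]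
    rw [← Complex.ofReal_inv, Complex.ofReal_re]
  have e2 : (z + c)⁻¹.re = (x + α.re)⁻¹ := by
    rw [show z + c = ((x + α.re : ℝ) : ℂ) by apply Complex.ext <;> simp [hz, hc]]
    rw [← Complex.ofReal_inv, Complex.ofReal_re]
  have p1 := re_inv_nonneg (w := z + α) (by simp [hzre]; linarith)
  have p2 := re_inv_nonneg (w := z - c) (by simp [hzre, hc]; linarith)
  have m1 : (1 : ℝ) ≤ xiMult α := by exact_mod_cast Nat.one_le_iff_ne_zero.2 h
  have n1 : α ≠ -α := fun e => hre (by have := congrArg Complex.re e; simp at this; linarith)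
  have n2 : α ≠ c := fun e => him (by have := congrArg Complex.im e; simp [hc] at this; linarith)
  have n3 : α ≠ -c := fun e => hre (by have := congrArg Complex.re e; simp [hc] at this; linarith)
  have n4 : -α ≠ c := fun e => n3 (by rw [← e, neg_neg])
  have n5 : -α ≠ -c := fun e => n2 (neg_injective e)
  have n6 : c ≠ -c := fun e => hre (by
    have := congrArg Complex.re e; simp [hc] at this; linarith)
  have hs := sum_le_hasSum ({α, -α, c, -c} : Finset ℂ)
    (fun β _ => re_logDeriv_term_nonneg hz2 β) (hasSum_re_logDeriv_centredXi hz2)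
  rw [Finset.sum_insert (by simp [n1, n2, n3]), Finset.sum_insert (by simp [n4, n5]),
    Finset.sum_insert (by simp [n6]), Finset.sum_singleton] at hs
  simp only [xiMult_neg, hc, xiMult_conj] at hs
  simp only [← hc, sub_neg_eq_add, ← sub_eq_add_neg] at hs
  rw [e1, e2] at hs
  have q1 : 0 ≤ (x - α.re)⁻¹ := inv_nonneg.2 (by linarith)
  have q2 : 0 ≤ (x + α.re)⁻¹ := inv_nonneg.2 (by linarith)
  nlinarith

theorem re_logDeriv_centredXi_sub_half {s : ℂ} (hs : 1 < s.re) :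
    (logDeriv centredXi (s - 1 / 2)).re = (s - 1)⁻¹.re + (logDeriv riemannZeta s).re
      - Real.log Real.pi / 2 + (Complex.digamma (s / 2 + 1)).re / 2 := by
  rw [logDeriv_centredXi_sub_half hs, ← Complex.ofReal_log Real.pi_pos.le]
  simp only [Complex.add_re, Complex.sub_re, Complex.div_ofNat_re, Complex.ofReal_re, one_div]

theorem log_norm_le_log_im_add {w : ℂ} (h : 0 < w.im) :
    Real.log ‖w‖ ≤ Real.log w.im + w.re ^ 2 / (2 * w.im ^ 2) := by
  have e : ‖w‖ ^ 2 = w.im ^ 2 * (1 + w.re ^ 2 / w.im ^ 2) := by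
    rw [Complex.sq_norm, Complex.normSq_apply]; field_simp; ring
  have hw : 0 < ‖w‖ := norm_pos_iff.2 fun h0 => by simp [h0] at h
  have h1 := congrArg Real.log e
  rw [Real.log_pow, Real.log_mul (by positivity) (by positivity), Real.log_pow] at h1
  have h2 := Real.log_le_sub_one_of_pos (x := 1 + w.re ^ 2 / w.im ^ 2) (by positivity)
  have e3 : w.re ^ 2 / (2 * w.im ^ 2) = w.re ^ 2 / w.im ^ 2 / 2 := by field_simp
  rw [e3]
  push_cast at h1
  linarith

theorem re_inv_le_div_sq {x y : ℝ} (hx : 0 ≤ x) (hy : 0 < y) :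
    ((x + y * Complex.I : ℂ)⁻¹).re ≤ x / y ^ 2 := by
  rw [Complex.inv_re]
  simp only [Complex.normSq_apply, Complex.add_re, Complex.add_im, Complex.ofReal_re,
    Complex.ofReal_im, Complex.mul_re, Complex.mul_im, Complex.I_re, Complex.I_im]
  rw [show x + (y * 0 - 0 * 1) = x by ring, show 0 + (y * 1 + 0 * 0) = y by ring]
  exact div_le_div_of_nonneg_left hx (by positivity) (by nlinarith)

theorem re_digamma_half_add_one_le {σ t : ℝ} (h1 : 1 < σ) (h2 : σ ≤ 1.65) (ht : 9 ≤ t) :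
    (Complex.digamma ((σ + t * Complex.I) / 2 + 1)).re ≤
      Real.log t - Real.log 2 + 6.662 / t ^ 2 + Real.pi / (2 * t) := by
  set w : ℂ := (σ + t * Complex.I) / 2 + 1 with hw
  have hre : w.re = σ / 2 + 1 := by simp [hw]
  have him : w.im = t / 2 := by simp [hw]
  have h := Complex.digamma_re_le (w := w) (by rw [hre]; linarith) (by rw [him]; linarith)
  have h3 := log_norm_le_log_im_add (w := w) (by rw [him]; linarith)
  rw [hre, him, Real.log_div (by linarith) (by norm_num)] at h3
  rw [him] at h
  have h4 : (σ / 2 + 1) ^ 2 / (2 * (t / 2) ^ 2) ≤ 6.662 / t ^ 2 := by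
    rw [show (2 : ℝ) * (t / 2) ^ 2 = t ^ 2 / 2 by ring, div_div_eq_mul_div]
    gcongr; nlinarith
  rw [show 4 * (t / 2) = 2 * t by ring] at h
  linarith

theorem re_logDeriv_zeta_ge {σ t : ℝ} (h1 : 1 < σ) (h2 : σ ≤ 1.65) (ht : 9 ≤ t) :
    (logDeriv centredXi ((σ - 1 / 2 : ℝ) + t * Complex.I)).re - (σ - 1) / t ^ 2 +
      Real.log Real.pi / 2 - (Real.log t - Real.log 2 + 6.662 / t ^ 2 + Real.pi / (2 * t)) / 2 ≤
      (logDeriv riemannZeta (σ + t * Complex.I)).re := by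
  have h := re_logDeriv_centredXi_sub_half (s := σ + t * Complex.I) (by simpa using h1)
  rw [show (σ + t * Complex.I - 1 / 2 : ℂ) = (σ - 1 / 2 : ℝ) + t * Complex.I by push_cast; ring,
    show (σ + t * Complex.I - 1 : ℂ) = (σ - 1 : ℝ) + t * Complex.I by push_cast; ring] at h
  have h3 := re_inv_le_div_sq (x := σ - 1) (y := t) (by linarith) (by linarith)
  have h4 := re_digamma_half_add_one_le h1 h2 ht
  linarith

theorem re_logDeriv_centredXi_real_le {σ : ℝ} (h1 : 1 < σ) :
    (logDeriv centredXi ((σ - 1 / 2 : ℝ) : ℂ)).re ≤ (σ - 1)⁻¹ + (logDeriv riemannZeta σ).re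
      - Real.log Real.pi / 2 + (Real.log (σ / 2 + 1) - 1 / (σ + 2)) / 2 := by
  have h := re_logDeriv_centredXi_sub_half (s := σ) (by simpa using h1)
  rw [show (σ - 1 / 2 : ℂ) = (σ - 1 / 2 : ℝ) by push_cast; ring,
    show (σ - 1 : ℂ) = (σ - 1 : ℝ) by push_cast; ring,
    show (σ / 2 + 1 : ℂ) = (σ / 2 + 1 : ℝ) by push_cast; ring, ← Complex.ofReal_inv,
    Complex.ofReal_re] at h
  have h2 := Complex.digamma_re_le_log_sub (x := σ / 2 + 1) (by linarith)
  rw [show 2 * (σ / 2 + 1) = σ + 2 by ring] at h2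
  linarith

theorem log_nineteen_lt : Real.log 19 < 2.945 := by
  rw [Real.log_lt_iff_lt_exp (by norm_num)]
  have h := Real.exp_one_gt_d9
  have h1 : Real.exp 2.945 = Real.exp 1 ^ 3 / Real.exp 0.055 := by
    rw [← Real.exp_nat_mul, ← Real.exp_sub]; norm_num
  have h2 : Real.exp 0.055 ≤ 1 / (1 - 0.055) := Real.exp_bound_div_one_sub_of_interval
    (by norm_num) (by norm_num)
  have h3 : (2.7182818283 : ℝ) ^ 3 < Real.exp 1 ^ 3 := by gcongr
  rw [h1, lt_div_iff₀ (Real.exp_pos _)]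
  refine lt_of_le_of_lt ?_ h3
  have h4 : Real.exp 0.055 ≤ 1.0567 := by
    have := Real.exp_bound' (x := 0.055) (by norm_num) (by norm_num) (n := 3) (by norm_num)
    refine this.trans ?_
    norm_num [Finset.sum_range_succ, Nat.factorial]
  linarith

set_option maxHeartbeats 1000000 in
theorem inv_half_sub_re_le {α : ℂ} (h : xiMult α ≠ 0) (hre : 0.4 < α.re) (him : 0 < α.im) :
    1 / (1 / 2 - α.re) ≤ 34.83 * Real.log (α.im / 19) := by
  set t := α.im with ht
  set r := 1 / 2 - α.re with hr
  have hb := abs_lt.1 (abs_re_lt_of_xiMult_ne_zero h)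
  have hr0 : 0 < r := by rw [hr]; linarith
  have hr1 : r < 0.1 := by rw [hr]; linarith
  have h81 := (sq_im_ge_of_xiMult_ne_zero h).2 (by linarith)
  have ht9 : 9 ≤ t := by nlinarith
  set σ := 1 + 6.5 * r with hσ
  have hσ1 : 1 < σ := by rw [hσ]; linarith
  have hσ2 : σ ≤ 1.65 := by rw [hσ]; linarith
  have hc := logDeriv_zeta_comb_nonpos hσ1 t
  have h0 := re_logDeriv_centredXi_real_le hσ1
  have h0' := re_logDeriv_centredXi_nonneg (z := ((σ - 1 / 2 : ℝ) : ℂ))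
    (by rw [Complex.ofReal_re]; linarith)
  have h1 := re_logDeriv_zeta_ge hσ1 hσ2 ht9
  have h1' := le_re_logDeriv_centredXi h (by linarith) (x := σ - 1 / 2) (by linarith)
  rw [← ht] at h1'
  have h2 := re_logDeriv_zeta_ge hσ1 hσ2 (t := 2 * t) (by linarith)
  have h2' := re_logDeriv_centredXi_nonneg (z := (σ - 1 / 2 : ℝ) + (2 * t : ℝ) * Complex.I)
    (by simp; linarith)
  rw [show (σ + (2 * t : ℝ) * Complex.I : ℂ) = σ + 2 * t * Complex.I by push_cast; ring] at h2
  rw [show σ - 1 / 2 - α.re = 7.5 * r by rw [hσ, hr]; ring,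
    show σ - 1 / 2 + α.re = 1 + 5.5 * r by rw [hσ, hr]; ring] at h1'
  rw [Real.log_mul (by norm_num) (by linarith)] at h2
  rw [show σ - 1 = 6.5 * r by rw [hσ]; ring] at h0 h1 h2
  have i1 : (7.5 * r)⁻¹ = 2 / 15 * (1 / r) := by field_simp; norm_num
  have i2 : (6.5 * r)⁻¹ = 2 / 13 * (1 / r) := by field_simp; norm_num
  have i3 : 2.58 ≤ 4 * (1 + 5.5 * r)⁻¹ := by
    rw [← div_eq_mul_inv, le_div_iff₀ (by linarith)]; nlinarith
  have i4 : Real.log (σ / 2 + 1) - 1 / (σ + 2) ≤ 0.34 := by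
    have hl : Real.log (σ / 2 + 1) ≤ Real.log 2 - 0.0875 := by
      have : Real.log ((σ / 2 + 1) / 2) ≤ (σ / 2 + 1) / 2 - 1 :=
        Real.log_le_sub_one_of_pos (by linarith)
      rw [Real.log_div (by linarith) (by norm_num)] at this
      linarith
    have hl2 := Real.log_two_lt_d9
    have : 0.2739 ≤ 1 / (σ + 2) := by
      rw [le_div_iff₀ (by linarith)]; linarith
    linarith
  have j1 : 1 / t ≤ 1 / 9 := one_div_le_one_div_of_le (by norm_num) ht9
  have j2 : 1 / t ^ 2 ≤ 1 / 81 := one_div_le_one_div_of_le (by norm_num) (by linarith)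
  have hpi := Real.pi_lt_d4
  have k1 : 6.5 * r / t ^ 2 ≤ 0.0081 := by
    rw [div_eq_mul_one_div]; nlinarith [mul_le_mul_of_nonneg_left j2 hr0.le]
  have k2 : 6.5 * r / (2 * t) ^ 2 ≤ 0.0021 := by
    rw [show 6.5 * r / (2 * t) ^ 2 = 6.5 * r / t ^ 2 / 4 by field_simp; norm_num]; linarith
  have k3 : 6.662 / t ^ 2 ≤ 0.0823 := by rw [div_eq_mul_one_div]; linarith
  have k4 : 6.662 / (2 * t) ^ 2 ≤ 0.0206 := by
    rw [show 6.662 / (2 * t) ^ 2 = 6.662 / t ^ 2 / 4 by field_simp; norm_num]; linarith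
  have k5 : Real.pi / (2 * t) ≤ 0.1746 := by
    rw [show Real.pi / (2 * t) = Real.pi / 2 * (1 / t) by field_simp]
    nlinarith [Real.pi_pos]
  have k6 : Real.pi / (2 * (2 * t)) ≤ 0.0873 := by
    rw [show Real.pi / (2 * (2 * t)) = Real.pi / (2 * t) / 2 by field_simp]; linarith
  have hlt : 0 ≤ Real.log t := Real.log_nonneg (by linarith only [ht9])
  have h19 := log_nineteen_lt
  have h4pi := log_four_mul_pi_gt
  rw [show (4 : ℝ) * Real.pi = 2 ^ 2 * Real.pi by norm_num, Real.log_mul (by norm_num)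
    Real.pi_ne_zero, Real.log_pow] at h4pi
  push_cast at h4pi
  have hl2 := Real.log_two_lt_d9
  rw [Real.log_div (by linarith only [ht9]) (by norm_num)]
  linarith only [hc, h0, h0', h1, h1', h2, h2', i1, i2, i3, i4, k1, k2, k3, k4, k5, k6, h19, h4pi, hl2, hlt]

theorem inv_half_sub_abs_re_le {α : ℂ} (h : xiMult α ≠ 0) (hre : 0.4 < |α.re|) :
    1 / (1 / 2 - |α.re|) ≤ 34.83 * Real.log (|α.im| / 19) := by
  have him : α.im ≠ 0 := fun h0 => by
    have := (sq_im_ge_of_xiMult_ne_zero h).1; rw [h0] at this; norm_num at this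
  wlog h1 : 0 < α.im generalizing α
  · have := this (α := -α) (by rwa [xiMult_neg]) (by simpa using hre) (by simpa using him)
      (by simp; exact lt_of_le_of_ne (not_lt.1 h1) him)
    simpa using this
  wlog h2 : 0 < α.re generalizing α
  · have := this (α := -(starRingEnd ℂ) α) (by rwa [xiMult_neg, xiMult_conj]) (by simpa using hre)
      (by simpa using him) (by simpa using h1) (by
        simp; exact lt_of_le_of_ne (not_lt.1 h2) fun h0 => by rw [h0] at hre; norm_num at hre)
    simpa using this
  rw [abs_of_pos h2] at hre ⊢
  rw [abs_of_pos h1]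
  exact inv_half_sub_re_le h hre h1

theorem re_logDeriv_centredXi_ofReal_le {b : ℝ} (hb : 19 ≤ b) :
    (logDeriv centredXi (b : ℂ)).re ≤ 1 / 2 * Real.log (b / (2 * Real.pi)) + 0.12 := by
  have h := re_logDeriv_centredXi_real_le (σ := b + 1 / 2) (by linarith)
  have h0 := re_logDeriv_zeta_nonpos (σ := b + 1 / 2) (by linarith)
  rw [show b + 1 / 2 - 1 / 2 = b by ring, show b + 1 / 2 - 1 = b - 1 / 2 by ring] at h
  have h1 : (b - 1 / 2)⁻¹ ≤ 2 / 37 := by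
    rw [inv_le_comm₀ (by linarith) (by norm_num)]; linarith
  have h2 : Real.log ((b + 1 / 2) / 2 + 1) ≤ Real.log b - Real.log 2 + 0.1316 := by
    have h3 := Real.log_le_sub_one_of_pos (x := ((b + 1 / 2) / 2 + 1) / (b / 2)) (by positivity)
    rw [Real.log_div (by positivity) (by positivity), Real.log_div (by positivity) (by norm_num)]
      at h3
    have h4 : ((b + 1 / 2) / 2 + 1) / (b / 2) ≤ 1.1316 := by
      rw [div_le_iff₀ (by positivity)]; linarith
    linarith
  have h3 : 0 ≤ 1 / (b + 1 / 2 + 2) := by positivity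
  rw [Real.log_div (by positivity) (by positivity), Real.log_mul (by norm_num) Real.pi_ne_zero]
  linarith

theorem div_sq_add_sq_le {b : ℝ} (hb : 19 ≤ b) {α : ℂ} (hα : |α.re| < 1 / 2) :
    b / (b ^ 2 + α.im ^ 2) ≤ 1.01 * ((((b : ℂ) - α)⁻¹.re + ((b : ℂ) + α)⁻¹.re) / 2) := by
  simp only [Complex.inv_re, Complex.normSq_apply, Complex.sub_re, Complex.sub_im, Complex.add_re,
    Complex.add_im, Complex.ofReal_re, Complex.ofReal_im]
  generalize α.re = x at hα
  generalize α.im = y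
  have hx := abs_lt.1 hα
  set M := b ^ 2 + y ^ 2 with hM
  have hMb : 361 ≤ M := by nlinarith [sq_nonneg y]
  have hx2 : x ^ 2 ≤ 1 / 4 := by nlinarith
  have p1 : 0 < (b - x) ^ 2 + y ^ 2 := by nlinarith [sq_nonneg y]
  have p2 : 0 < (b + x) ^ 2 + y ^ 2 := by nlinarith [sq_nonneg y]
  have e : ((b - x) / ((b - x) * (b - x) + (0 - y) * (0 - y)) +
      (b + x) / ((b + x) * (b + x) + (0 + y) * (0 + y))) / 2 =
      b * (M - x ^ 2) / ((M + x ^ 2) ^ 2 - 4 * b ^ 2 * x ^ 2) := by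
    have e3 : (M + x ^ 2) ^ 2 - 4 * b ^ 2 * x ^ 2 =
      ((b - x) ^ 2 + y ^ 2) * ((b + x) ^ 2 + y ^ 2) := by rw [hM]; ring
    rw [e3, show (b - x) * (b - x) + (0 - y) * (0 - y) = (b - x) ^ 2 + y ^ 2 by ring,
      show (b + x) * (b + x) + (0 + y) * (0 + y) = (b + x) ^ 2 + y ^ 2 by ring]
    field_simp
    rw [hM]; ring
  have p3 : 0 < (M + x ^ 2) ^ 2 - 4 * b ^ 2 * x ^ 2 := by
    have : (M + x ^ 2) ^ 2 - 4 * b ^ 2 * x ^ 2 =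
      ((b - x) ^ 2 + y ^ 2) * ((b + x) ^ 2 + y ^ 2) := by rw [hM]; ring
    rw [this]; positivity
  rw [e, ← mul_div_assoc, div_le_div_iff₀ (by positivity) p3]
  have k : (M + x ^ 2) ^ 2 ≤ 1.01 * (M - x ^ 2) * M := by
    nlinarith [sq_nonneg x, mul_nonneg (sq_nonneg x) (sub_nonneg.2 hMb)]
  have k2 := mul_le_mul_of_nonneg_left k (by linarith : 0 ≤ b)
  have k3 : 0 ≤ b * (4 * b ^ 2 * x ^ 2) := by positivity
  linarith

theorem sum_xiMult_mul_div_le {b : ℝ} (hb : 19 ≤ b) (A : Finset ℂ) :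
    ∑ α ∈ A, (xiMult α : ℝ) * (b / (b ^ 2 + α.im ^ 2)) ≤
      1.01 * (1 / 2 * Real.log (b / (2 * Real.pi)) + 0.12) := by
  have hz : 1 / 2 ≤ (b : ℂ).re := by rw [Complex.ofReal_re]; linarith
  have h := sum_le_hasSum A (fun β _ => re_logDeriv_term_nonneg hz β)
    (hasSum_re_logDeriv_centredXi hz)
  have h2 := re_logDeriv_centredXi_ofReal_le hb
  have h3 : ∑ α ∈ A, (xiMult α : ℝ) * (b / (b ^ 2 + α.im ^ 2)) ≤
      ∑ α ∈ A, 1.01 * ((xiMult α : ℝ) * ((((b : ℂ) - α)⁻¹.re + ((b : ℂ) + α)⁻¹.re) / 2)) := by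
    refine Finset.sum_le_sum fun α _ => ?_
    rcases eq_or_ne (xiMult α) 0 with h0 | h0
    · simp [h0]
    · have := mul_le_mul_of_nonneg_left (div_sq_add_sq_le hb (abs_re_lt_of_xiMult_ne_zero h0))
        (Nat.cast_nonneg (α := ℝ) (xiMult α))
      linarith
  rw [← Finset.mul_sum] at h3
  linarith

theorem hasDerivAt_log_one_add_sq_div_sq (y : ℝ) {b : ℝ} (hb : 0 < b) :
    HasDerivAt (fun b : ℝ => Real.log (1 + y ^ 2 / b ^ 2)) (-(2 * y ^ 2 / (b * (b ^ 2 + y ^ 2)))) b := by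
  have h := ((((hasDerivAt_pow 2 b).fun_inv (pow_ne_zero 2 hb.ne')).const_mul (y ^ 2)).const_add
    1).log (by positivity)
  simp only [← div_eq_mul_inv] at h
  refine h.congr_deriv ?_
  field_simp
  push_cast
  ring

theorem sum_xiMult_mul_log_le (A : Finset ℂ) :
    ∑ α ∈ A, (xiMult α : ℝ) / α.im ^ 2 * Real.log (1 + α.im ^ 2 / 19 ^ 2) ≤ 0.1248 := by
  have hpi := Real.pi_pos
  set G : ℝ → ℝ := fun b => ∑ α ∈ A, (xiMult α : ℝ) / α.im ^ 2 * Real.log (1 + α.im ^ 2 / b ^ 2)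
    with hG
  set H : ℝ → ℝ := fun b => 2.02 * (b⁻¹ * (1 / 2 * Real.log (b / (2 * Real.pi)) + 0.62)) with hH
  have dG : ∀ b : ℝ, 0 < b → HasDerivAt G (∑ α ∈ A, (xiMult α : ℝ) / α.im ^ 2 *
      (-(2 * α.im ^ 2 / (b * (b ^ 2 + α.im ^ 2))))) b := fun b hb =>
    HasDerivAt.fun_sum fun α _ => (hasDerivAt_log_one_add_sq_div_sq α.im hb).const_mul _
  have dH : ∀ b : ℝ, 0 < b → HasDerivAt H
      (-(2.02 / b ^ 2 * (1 / 2 * Real.log (b / (2 * Real.pi)) + 0.12))) b := fun b hb => by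
    have h1 : HasDerivAt (fun b : ℝ => Real.log (b / (2 * Real.pi))) (1 / b) b := by
      refine (((hasDerivAt_id b).div_const (2 * Real.pi)).log (by simp; positivity)).congr_deriv ?_
      simp only [id]; field_simp
    refine (((hasDerivAt_inv hb.ne').fun_mul ((h1.const_mul (1 / 2)).add_const 0.62)).const_mul
      2.02).congr_deriv ?_
    generalize Real.log (b / (2 * Real.pi)) = l
    field_simp
    ring
  have hle : ∀ b : ℝ, 19 ≤ b → -(2.02 / b ^ 2 * (1 / 2 * Real.log (b / (2 * Real.pi)) + 0.12)) ≤
      ∑ α ∈ A, (xiMult α : ℝ) / α.im ^ 2 * (-(2 * α.im ^ 2 / (b * (b ^ 2 + α.im ^ 2)))) :=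
    fun b hb => by
    have h := mul_le_mul_of_nonneg_left (sum_xiMult_mul_div_le hb A)
      (by positivity : 0 ≤ 2 / b ^ 2)
    have e : ∑ α ∈ A, (xiMult α : ℝ) / α.im ^ 2 * (-(2 * α.im ^ 2 / (b * (b ^ 2 + α.im ^ 2)))) =
        -(2 / b ^ 2 * ∑ α ∈ A, (xiMult α : ℝ) * (b / (b ^ 2 + α.im ^ 2))) := by
      rw [Finset.mul_sum, ← Finset.sum_neg_distrib]
      refine Finset.sum_congr rfl fun α _ => ?_
      rcases eq_or_ne (xiMult α) 0 with h0 | h0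
      · simp [h0]
      · have him : α.im ≠ 0 := fun h1 => by
          have := (sq_im_ge_of_xiMult_ne_zero h0).1; rw [h1] at this; norm_num at this
        have : b ≠ 0 := by linarith
        have h5 : b ^ 2 + α.im ^ 2 ≠ 0 := by positivity
        field_simp
    have e2 : 2.02 / b ^ 2 * (1 / 2 * Real.log (b / (2 * Real.pi)) + 0.12) =
        2 / b ^ 2 * (1.01 * (1 / 2 * Real.log (b / (2 * Real.pi)) + 0.12)) := by ring
    rw [e, e2]
    linarith
  have hanti : AntitoneOn (fun b => H b - G b) (Ici 19) := by
    refine antitoneOn_of_deriv_nonpos (convex_Ici _) (fun b hb => ?_) (fun b hb => ?_)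
      (fun b hb => ?_)
    · have hb0 : 0 < b := lt_of_lt_of_le (by norm_num) hb
      exact ((dH b hb0).sub (dG b hb0)).continuousAt.continuousWithinAt
    · rw [interior_Ici] at hb
      have hb0 : 0 < b := lt_trans (by norm_num) hb
      exact ((dH b hb0).sub (dG b hb0)).differentiableAt.differentiableWithinAt
    · rw [interior_Ici] at hb
      have hb0 : 0 < b := lt_trans (by norm_num) hb
      rw [((dH b hb0).fun_sub (dG b hb0)).deriv]
      linarith [hle b (le_of_lt hb)]
  have tinv : Tendsto (fun b : ℝ => b⁻¹) atTop (𝓝 0) := tendsto_inv_atTop_zero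
  have tG : Tendsto G atTop (𝓝 0) := by
    have : Tendsto G atTop (𝓝 (∑ α ∈ A, (xiMult α : ℝ) / α.im ^ 2 * Real.log (1 + α.im ^ 2 * 0 ^ 2))) := by
      refine tendsto_finsetSum _ fun α _ => Tendsto.const_mul _ ?_
      refine Tendsto.log ?_ (by simp)
      refine (((tinv.pow 2).const_mul (α.im ^ 2)).const_add 1).congr fun b => ?_
      rw [inv_pow, div_eq_mul_inv]
    simpa using this
  have tH : Tendsto H atTop (𝓝 0) := by
    have h1 : Tendsto (fun b : ℝ => Real.log b / b) atTop (𝓝 0) :=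
      Real.isLittleO_log_id_atTop.tendsto_div_nhds_zero
    have h2 := ((h1.const_mul (1 / 2)).add
      (tinv.const_mul (0.62 - 1 / 2 * Real.log (2 * Real.pi)))).const_mul 2.02
    simp only [mul_zero, add_zero] at h2
    refine h2.congr' ?_
    filter_upwards [eventually_gt_atTop 0] with b hb
    simp only [hH]
    rw [Real.log_div hb.ne' (by positivity)]
    ring
  have hfin : 0 - 0 ≤ H 19 - G 19 := by
    refine le_of_tendsto (tH.sub tG) ?_
    filter_upwards [eventually_ge_atTop 19] with b hb
    exact hanti (mem_Ici.2 le_rfl) (mem_Ici.2 hb) hb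
  have hG19 : G 19 ≤ H 19 := by linarith
  refine hG19.trans ?_
  have h19 := log_nineteen_lt
  have h4pi := log_four_mul_pi_gt
  have hl2 := Real.log_two_lt_d9
  rw [show (4 : ℝ) * Real.pi = 2 * (2 * Real.pi) by ring, Real.log_mul (by norm_num)
    (by positivity)] at h4pi
  simp only [hH]
  rw [Real.log_div (by norm_num) (by positivity)]
  linarith

theorem mul_exp_neg_div_ten_le {u : ℝ} (hu : 18 ≤ u) : u * Real.exp (-(0.1 * u)) ≤ 2.98 := by
  have h1 : (6.045 : ℝ) < Real.exp 1.8 := by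
    have h : Real.exp 1.8 = Real.exp 1 ^ 2 / Real.exp 0.2 := by
      rw [← Real.exp_nat_mul, ← Real.exp_sub]; norm_num
    have h2 : Real.exp 0.2 ≤ 1.2215 := by
      refine (Real.exp_bound' (x := 0.2) (by norm_num) (by norm_num) (n := 4) (by norm_num)).trans ?_
      norm_num [Finset.sum_range_succ, Nat.factorial]
    have h3 : (2.718 : ℝ) ^ 2 < Real.exp 1 ^ 2 := by
      have := Real.exp_one_gt_d9; gcongr; linarith
    rw [h, lt_div_iff₀ (Real.exp_pos _)]
    nlinarith
  have h2 : Real.exp (0.1 * u) = Real.exp 1.8 * Real.exp (0.1 * u - 1.8) := by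
    rw [← Real.exp_add]; congr 1; ring
  have h3 := Real.add_one_le_exp (0.1 * u - 1.8)
  rw [Real.exp_neg, ← div_eq_mul_inv, div_le_iff₀ (Real.exp_pos _), h2]
  nlinarith [Real.exp_pos (0.1 * u - 1.8)]

theorem mul_exp_neg_mul_le {r u : ℝ} (hr : 0 < r) :
    u * Real.exp (-(r * u)) ≤ 1 / r * Real.exp (-1) := by
  have h := Real.add_one_le_exp (r * u - 1)
  rw [sub_add_cancel] at h
  have h2 := mul_le_mul_of_nonneg_right h (Real.exp_pos (-(r * u))).le
  rw [← Real.exp_add, show r * u - 1 + -(r * u) = -1 by ring] at h2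
  rw [div_mul_eq_mul_div, le_div_iff₀ hr]
  linarith

theorem mul_zeroBound_le {α : ℂ} (h : xiMult α ≠ 0) {u : ℝ} (hu : 18 ≤ u) :
    u * zeroBound α u ≤ 1.4915 + 3.205 * Real.log (1 + α.im ^ 2 / 19 ^ 2) := by
  have hr := abs_re_lt_of_xiMult_ne_zero h
  have h10 := mul_exp_neg_div_ten_le hu
  have h2 : u * Real.exp (-(1 / 2) * u) ≤ 0.003 := by
    have e : Real.exp (-(1 / 2) * u) = Real.exp (-(0.1 * u)) * Real.exp (-(0.4 * u)) := by
      rw [← Real.exp_add]; congr 1; ring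
    have h7 : Real.exp (-(0.4 * u)) ≤ 1 / 2.7 ^ 7 := by
      have h1 := Real.exp_one_gt_d9
      have : Real.exp (-(0.4 * u)) ≤ Real.exp (-7) := Real.exp_le_exp.2 (by linarith)
      refine this.trans ?_
      rw [Real.exp_neg, ← one_div, show (7 : ℝ) = (7 : ℕ) * 1 by norm_num, Real.exp_nat_mul]
      gcongr
      linarith
    rw [e, ← mul_assoc]
    refine (mul_le_mul h10 h7 (Real.exp_pos _).le (by norm_num)).trans ?_
    norm_num
  have hl : 0 ≤ Real.log (1 + α.im ^ 2 / 19 ^ 2) := Real.log_nonneg (by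
    have : 0 ≤ α.im ^ 2 / 19 ^ 2 := by positivity
    linarith)
  have h1 : u * Real.exp (-(1 / 2 - |α.re|) * u) ≤
      2.98 + 6.41 * Real.log (1 + α.im ^ 2 / 19 ^ 2) := by
    rw [neg_mul]
    rcases le_or_gt |α.re| 0.4 with hc | hc
    · have : Real.exp (-((1 / 2 - |α.re|) * u)) ≤ Real.exp (-(0.1 * u)) :=
        Real.exp_le_exp.2 (by nlinarith)
      have := mul_le_mul_of_nonneg_left this (by linarith : 0 ≤ u)
      linarith
    · have h3 := inv_half_sub_abs_re_le h hc
      have h4 := mul_exp_neg_mul_le (u := u) (by linarith : 0 < 1 / 2 - |α.re|)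
      have h0 : 0 < 1 / (1 / 2 - |α.re|) := one_div_pos.2 (by linarith)
      have him : 0 < |α.im| := abs_pos.2 fun h1 => by
        have := (sq_im_ge_of_xiMult_ne_zero h).1; rw [h1] at this; norm_num at this
      have h5 : 2 * Real.log (|α.im| / 19) ≤ Real.log (1 + α.im ^ 2 / 19 ^ 2) := by
        have e : 2 * Real.log (|α.im| / 19) = Real.log (α.im ^ 2 / 19 ^ 2) := by
          rw [← sq_abs α.im, ← div_pow, Real.log_pow]; norm_num
        rw [e]
        refine Real.log_le_log (div_pos (by rw [← sq_abs]; positivity) (by norm_num)) (by linarith)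
      have h6 : Real.exp (-1) ≤ 1 / 2.7182 := by
        rw [Real.exp_neg, ← one_div]
        have := Real.exp_one_gt_d9
        gcongr
        linarith
      have h7 := mul_le_mul_of_nonneg_left h6 h0.le
      linarith
  rw [zeroBound]
  linarith

theorem mul_zeroBoundSum_le {u : ℝ} (hu : 18 ≤ u) : u * zeroBoundSum u ≤ 0.4728 := by
  rw [zeroBoundSum, ← tsum_mul_left]
  refine ((summable_zeroBoundSum (by linarith : 0 ≤ u)).mul_left u).tsum_le_of_sum_le fun A => ?_
  have h1 : ∑ α ∈ A, u * (‖zeroCoeff α‖ * zeroBound α u) ≤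
      ∑ α ∈ A, (1.4915 * ((xiMult α : ℝ) * ‖(1 / 4 - α ^ 2)⁻¹‖) +
        3.205 * ((xiMult α : ℝ) / α.im ^ 2 * Real.log (1 + α.im ^ 2 / 19 ^ 2))) := by
    refine Finset.sum_le_sum fun α _ => ?_
    rw [norm_zeroCoeff]
    rcases eq_or_ne (xiMult α) 0 with h0 | h0
    · simp [h0]
    · have h2 := mul_zeroBound_le h0 hu
      have him : 0 < α.im ^ 2 := by
        have := (sq_im_ge_of_xiMult_ne_zero h0).1; linarith
      have hl : 0 ≤ Real.log (1 + α.im ^ 2 / 19 ^ 2) := Real.log_nonneg (by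
        have : 0 ≤ α.im ^ 2 / 19 ^ 2 := by positivity
        linarith)
      have h3 : ‖(1 / 4 - α ^ 2)⁻¹‖ ≤ 1 / α.im ^ 2 := by
        rw [norm_inv, ← one_div]
        refine one_div_le_one_div_of_le him ?_
        rw [show (1 / 4 - α ^ 2) = (1 / 2 - α) * (1 / 2 + α) by ring, norm_mul, ← sq_abs, sq]
        have a1 := Complex.abs_im_le_norm (1 / 2 - α)
        have a2 := Complex.abs_im_le_norm (1 / 2 + α)
        simp only [Complex.sub_im, Complex.add_im, Complex.div_ofNat_im, Complex.one_im, zero_div,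
          zero_sub, abs_neg, zero_add] at a1 a2
        exact mul_le_mul a1 a2 (abs_nonneg _) (norm_nonneg _)
      have hm : (0 : ℝ) ≤ xiMult α := Nat.cast_nonneg _
      have h4 := mul_le_mul_of_nonneg_left h2
        (mul_nonneg hm (norm_nonneg (1 / 4 - α ^ 2)⁻¹))
      have h5 := mul_le_mul_of_nonneg_right (mul_le_mul_of_nonneg_left h3 hm) hl
      rw [mul_one_div] at h5
      linarith
  refine h1.trans ?_
  rw [Finset.sum_add_distrib, ← Finset.mul_sum, ← Finset.mul_sum]
  have h2 := summable_xiMult_mul_norm.sum_le_tsum A (fun α _ => by positivity)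
  have h3 := tsum_xiMult_mul_norm_le
  have h4 := sum_xiMult_mul_log_le A
  linarith

theorem zeroBoundSum_le {u : ℝ} (hu : 0 ≤ u) :
    zeroBoundSum u ≤ 0.0244 * (1 + Real.exp (-(1 / 2) * u)) := by
  have hs := summable_xiMult_mul_norm.mul_right ((1 + Real.exp (-(1 / 2) * u)) / 2)
  have h := (summable_zeroBoundSum hu).tsum_le_tsum (fun α => ?_) hs
  · rw [tsum_mul_right] at h
    have h3 := mul_le_mul_of_nonneg_right tsum_xiMult_mul_norm_le
      (by positivity : 0 ≤ (1 + Real.exp (-(1 / 2) * u)) / 2)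
    rw [zeroBoundSum]
    linarith
  · rw [norm_zeroCoeff]
    rcases eq_or_ne (xiMult α) 0 with h0 | h0
    · simp [h0]
    · refine mul_le_mul_of_nonneg_left ?_ (by positivity)
      have := abs_re_lt_of_xiMult_ne_zero h0
      have : Real.exp (-(1 / 2 - |α.re|) * u) ≤ 1 := Real.exp_le_one_iff.2 (by nlinarith)
      rw [zeroBound]
      linarith

theorem log_two_mul_pi_lt : Real.log (2 * Real.pi) < 1.851 := by
  have hpi := Real.pi_lt_d4
  have h1 := Real.exp_one_gt_d9
  have h2 : (7.389 : ℝ) < Real.exp 1 ^ 2 := by nlinarith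
  have h := Real.log_le_sub_one_of_pos (x := 2 * Real.pi / Real.exp 1 ^ 2)
    (by have := Real.pi_pos; positivity)
  rw [Real.log_div (by have := Real.pi_pos; positivity) (by positivity), Real.log_pow,
    Real.log_exp] at h
  have h3 : 2 * Real.pi / Real.exp 1 ^ 2 < 0.8505 := by
    rw [div_lt_iff₀ (by positivity)]; linarith
  push_cast at h
  linarith

theorem mul_exp_neg_antitone {a u : ℝ} (ha : 1 ≤ a) (hu : a ≤ u) :
    u * Real.exp (-u) ≤ a * Real.exp (-a) := by
  have h := Real.add_one_le_exp (u - a)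
  have e : Real.exp (-a) = Real.exp (u - a) * Real.exp (-u) := by rw [← Real.exp_add]; congr 1; ring
  rw [e, ← mul_assoc]
  refine mul_le_mul_of_nonneg_right ?_ (Real.exp_pos _).le
  nlinarith

theorem sq_mul_mertensError_le {u : ℝ} (hu : 0 < u) :
    u ^ 2 * mertensError u ≤ 1.851 * (u * Real.exp (-u)) +
      (u + 4 / 3 + 2 / (3 * u)) * zeroBoundSum u := by
  have h := mul_le_mul_of_nonneg_left (mertensError_le hu) (sq_nonneg u)
  have e : u ^ 2 * (Real.log (2 * Real.pi) * (Real.exp (-u) / u) +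
      (recipWeight u + recipWeightDeriv u / 3) * zeroBoundSum u) =
      Real.log (2 * Real.pi) * (u * Real.exp (-u)) +
      (u + 4 / 3 + 2 / (3 * u)) * zeroBoundSum u := by
    rw [recipWeight, recipWeightDeriv]; field_simp; ring
  rw [e] at h
  have := mul_le_mul_of_nonneg_right log_two_mul_pi_lt.le
    (mul_nonneg hu.le (Real.exp_pos (-u)).le)
  linarith

theorem sq_mul_mertensError_le_of_mem_Icc {a b q u : ℝ} (ha : 1 ≤ a) (hau : a ≤ u) (hub : u ≤ b)
    (hq : 1 / q ≤ Real.exp (a / 2)) (hq0 : 0 < q) :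
    u ^ 2 * mertensError u ≤ 1.851 * (a * q ^ 2) +
      (b + 4 / 3 + 2 / (3 * a)) * (0.0244 * (1 + q)) := by
  have hu : 0 < u := by linarith
  have hq1 : Real.exp (-(a / 2)) ≤ q := by
    rw [Real.exp_neg, inv_le_comm₀ (Real.exp_pos _) hq0, ← one_div]; exact hq
  have h1 := mul_exp_neg_antitone ha hau
  have h2 : Real.exp (-a) ≤ q ^ 2 := by
    rw [show -a = (2 : ℕ) * (-(a / 2)) by push_cast; ring, Real.exp_nat_mul]
    gcongr
  have h3 : Real.exp (-(1 / 2) * u) ≤ q :=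
    (Real.exp_le_exp.2 (by linarith)).trans hq1
  have h4 := zeroBoundSum_le hu.le
  have h5 : 2 / (3 * u) ≤ 2 / (3 * a) := by gcongr
  have h6 : zeroBoundSum u ≤ 0.0244 * (1 + q) := by linarith
  have h7 := mul_le_mul_of_nonneg_left h2 (by linarith : 0 ≤ a)
  refine (sq_mul_mertensError_le hu).trans (add_le_add (by linarith) ?_)
  exact (mul_le_mul_of_nonneg_left h6 (by positivity)).trans
    (mul_le_mul_of_nonneg_right (by linarith) (by positivity))

theorem sq_mul_mertensError_lt {u : ℝ} (hu : 2.77 ≤ u) : u ^ 2 * mertensError u ≤ 0.52 := by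
  have he := Real.exp_one_gt_d9
  have hpos := Real.exp_pos 1
  rcases le_or_gt u 4 with h4 | h4
  · refine (sq_mul_mertensError_le_of_mem_Icc (a := 2.77) (b := 4) (q := 0.251) (by norm_num) hu h4
      ?_ (by norm_num)).trans (by norm_num)
    have h1 := Real.sum_le_exp_of_nonneg (x := 0.385) (by norm_num) 4
    have e : Real.exp (2.77 / 2) = Real.exp 1 * Real.exp 0.385 := by
      rw [← Real.exp_add]; norm_num
    norm_num [Finset.sum_range_succ, Nat.factorial] at h1
    rw [e]
    nlinarith
  rcases le_or_gt u 10 with h10 | h10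
  · refine (sq_mul_mertensError_le_of_mem_Icc (a := 4) (b := 10) (q := 0.1355) (by norm_num) h4.le
      h10 ?_ (by norm_num)).trans (by norm_num)
    rw [show (4 / 2 : ℝ) = (2 : ℕ) * 1 by norm_num, Real.exp_nat_mul]
    have : (2.718 : ℝ) ^ 2 ≤ Real.exp 1 ^ 2 := by gcongr; linarith
    linarith
  rcases le_or_gt u 18 with h18 | h18
  · refine (sq_mul_mertensError_le_of_mem_Icc (a := 10) (b := 18) (q := 0.007) (by norm_num) h10.le
      h18 ?_ (by norm_num)).trans (by norm_num)
    rw [show (10 / 2 : ℝ) = (5 : ℕ) * 1 by norm_num, Real.exp_nat_mul]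
    have : (2.718 : ℝ) ^ 5 ≤ Real.exp 1 ^ 5 := by gcongr; linarith
    linarith
  · have hu0 : 0 < u := by linarith
    have h1 := mul_zeroBoundSum_le h18.le
    have h2 := mul_exp_neg_antitone (a := 18) (by norm_num) h18.le
    have h3 : Real.exp (-18) ≤ 1 / 2.718 ^ 18 := by
      rw [Real.exp_neg, ← one_div, show (18 : ℝ) = (18 : ℕ) * 1 by norm_num, Real.exp_nat_mul]
      gcongr
      linarith
    have h4 : (u + 4 / 3 + 2 / (3 * u)) * zeroBoundSum u =
        (1 + 4 / 3 * (1 / u) + 2 / 3 * (1 / u) ^ 2) * (u * zeroBoundSum u) := by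
      field_simp
    have h5 : 1 / u ≤ 1 / 18 := one_div_le_one_div_of_le (by norm_num) h18.le
    have h6 : 0 < 1 / u := by positivity
    have h7 : (1 + 4 / 3 * (1 / u) + 2 / 3 * (1 / u) ^ 2) ≤ 1.08 := by nlinarith
    have h8 := mul_le_mul_of_nonneg_left h1 (by positivity :
      0 ≤ 1 + 4 / 3 * (1 / u) + 2 / 3 * (1 / u) ^ 2)
    have h9 := sq_mul_mertensError_le hu0
    rw [h4] at h9
    norm_num at h3
    linarith

theorem exp_neg_gamma_gt : 0.56 < Real.exp (-Real.eulerMascheroniConstant) := by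
  have h := Real.eulerMascheroniConstant_lt_d4
  have h1 : Real.exp (-0.5792) ≤ Real.exp (-Real.eulerMascheroniConstant) :=
    Real.exp_le_exp.2 (by linarith)
  refine lt_of_lt_of_le ?_ h1
  have h2 := Real.exp_bound' (x := 0.5792) (by norm_num) (by norm_num) (n := 7) (by norm_num)
  norm_num [Finset.sum_range_succ, Nat.factorial] at h2
  rw [Real.exp_neg, lt_inv_comm₀ (by norm_num) (Real.exp_pos _)]
  norm_num
  linarith

theorem mertensMean_lt {u : ℝ} (hu : 2.77 ≤ u) :
    mertensMean u < Real.log (Real.exp Real.eulerMascheroniConstant * u + 1 / u) := by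
  have hu0 : 0 < u := by linarith
  have hl2 := Real.log_two_lt_d9
  rw [mertensMean_eq_log_add (by linarith)]
  set k := Real.exp (-Real.eulerMascheroniConstant) with hk
  have hk0 : 0.56 < k := exp_neg_gamma_gt
  have hk1 : k ≤ 0.58 := by
    have h := Real.eulerMascheroniConstant_gt_d4
    have h1 := Real.add_one_le_exp Real.eulerMascheroniConstant
    have h3 := Real.quadratic_le_exp_of_nonneg (x := Real.eulerMascheroniConstant) (by linarith)
    rw [hk, Real.exp_neg, inv_le_comm₀ (Real.exp_pos _) (by norm_num)]
    refine le_trans ?_ h3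
    norm_num
    nlinarith
  have e : Real.exp Real.eulerMascheroniConstant * u + 1 / u =
      Real.exp Real.eulerMascheroniConstant * u * (1 + k / u ^ 2) := by
    rw [hk, Real.exp_neg]; field_simp
  have hku : 0 < k / u ^ 2 := by positivity
  rw [e, Real.log_mul (by positivity) (by positivity), Real.log_mul (by positivity) hu0.ne',
    Real.log_exp]
  have h := sq_mul_mertensError_lt hu
  have hlog := Real.one_sub_inv_le_log_of_pos (x := 1 + k / u ^ 2) (by positivity)
  have e2 : 1 - (1 + k / u ^ 2)⁻¹ = k / (u ^ 2 + k) := by field_simp; ring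
  rw [e2] at hlog
  have h3 : mertensError u ≤ 0.52 / u ^ 2 := by
    rw [le_div_iff₀ (by positivity)]; linarith
  have h4 : 0.52 / u ^ 2 < k / (u ^ 2 + k) := by
    rw [div_lt_div_iff₀ (by positivity) (by positivity)]
    nlinarith
  linarith

theorem log_geom_sum_le {y : ℝ} (hy0 : 0 < y) (hy : y ≤ 1 / 2) {k : ℕ} (hk : k ≠ 0) :
    Real.log (∑ j ∈ Finset.range (k + 1), y ^ j) ≤
      ∑ j ∈ Finset.range k, y ^ (j + 1) / ((j : ℝ) + 1) := by
  have hyk : y ^ (k + 1) < 1 := pow_lt_one₀ hy0.le (by linarith) (by omega)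
  have hyp : 0 < y ^ (k + 1) := by positivity
  have h1 : ∑ j ∈ Finset.range (k + 1), y ^ j = (1 - y ^ (k + 1)) / (1 - y) := by
    rw [geom_sum_eq (by linarith), ← neg_div_neg_eq]; congr 1 <;> ring
  have hs := Real.hasSum_pow_div_log_of_abs_lt_one (x := y) (by rw [abs_of_pos hy0]; linarith)
  have hsplit := hs.summable.sum_add_tsum_nat_add k
  rw [hs.tsum_eq] at hsplit
  have hg : HasSum (fun n : ℕ => y ^ (k + 1) / ((k : ℝ) + 1) * y ^ n)
      (y ^ (k + 1) / ((k : ℝ) + 1) * (1 - y)⁻¹) :=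
    (hasSum_geometric_of_lt_one hy0.le (by linarith)).mul_left _
  have htail : ∑' n : ℕ, y ^ (n + k + 1) / (((n + k : ℕ) : ℝ) + 1) ≤
      y ^ (k + 1) / ((k : ℝ) + 1) * (1 - y)⁻¹ := by
    rw [← hg.tsum_eq]
    refine ((summable_nat_add_iff k).2 hs.summable).tsum_le_tsum (fun n => ?_) hg.summable
    rw [div_mul_eq_mul_div, ← pow_add, show k + 1 + n = n + k + 1 by ring]
    push_cast
    gcongr
    linarith [(Nat.cast_nonneg n : (0 : ℝ) ≤ n)]
  have hk1 : (1 : ℝ) ≤ k := by exact_mod_cast Nat.one_le_iff_ne_zero.2 hk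
  have htail2 : y ^ (k + 1) / ((k : ℝ) + 1) * (1 - y)⁻¹ ≤ y ^ (k + 1) := by
    rw [← div_eq_mul_inv, div_div, div_le_iff₀ (by nlinarith)]
    have : 1 ≤ ((k : ℝ) + 1) * (1 - y) := by nlinarith
    nlinarith
  have hlog := Real.log_le_sub_one_of_pos (x := 1 - y ^ (k + 1)) (by linarith)
  rw [h1, Real.log_div (by linarith) (by linarith)]
  linarith

theorem sum_divisors_div_pos {n : ℕ} (hn : n ≠ 0) :
    (0 : ℝ) < (∑ d ∈ n.divisors, d : ℕ) / n := by
  have h : 0 < ∑ d ∈ n.divisors, d :=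
    Finset.sum_pos (fun d hd => Nat.pos_of_mem_divisors hd) ⟨n, by simp [hn]⟩
  have hn' := Nat.pos_of_ne_zero hn
  positivity

theorem log_sum_divisors_div_le {n : ℕ} (hn : n ≠ 0) :
    Real.log ((∑ d ∈ n.divisors, d : ℕ) / n) ≤
      ∑ q ∈ n.divisors, Λ q * (1 / (q * Real.log q)) := by
  induction n using Nat.recOnPosPrimePosCoprime with
  | zero => exact absurd rfl hn
  | one => simp
  | prime_pow p k hp hk =>
    have hp2 : (2 : ℝ) ≤ p := by exact_mod_cast hp.two_le
    have hp0 : (0 : ℝ) < p := by linarith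
    have hlp : 0 < Real.log p := Real.log_pos (by linarith)
    rw [Nat.sum_divisors_prime_pow hp, Nat.sum_divisors_prime_pow hp]
    have h := log_geom_sum_le (y := (p : ℝ)⁻¹) (by positivity)
      (by rw [one_div]; exact inv_anti₀ (by norm_num) hp2) hk.ne'
    have e1 : ((∑ j ∈ Finset.range (k + 1), p ^ j : ℕ) : ℝ) / ((p ^ k : ℕ) : ℝ) =
        ∑ j ∈ Finset.range (k + 1), (p : ℝ)⁻¹ ^ j := by
      rw [← Finset.sum_range_reflect (fun j => (p : ℝ)⁻¹ ^ j)]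
      push_cast
      rw [Finset.sum_div]
      refine Finset.sum_congr rfl fun j hj => ?_
      have hj' : j ≤ k := by have := Finset.mem_range.1 hj; omega
      rw [inv_pow, pow_sub₀ _ hp0.ne' hj']
      field_simp
    rw [e1]
    refine h.trans_eq ?_
    rw [Finset.sum_range_succ']
    simp only [pow_zero, ArithmeticFunction.vonMangoldt_apply_one, zero_mul, add_zero]
    refine Finset.sum_congr rfl fun j _ => ?_
    rw [ArithmeticFunction.vonMangoldt_apply_pow (by omega),
      ArithmeticFunction.vonMangoldt_apply_prime hp]
    push_cast
    rw [Real.log_pow, inv_pow]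
    push_cast
    field_simp
  | coprime a b ha hb hab iha ihb =>
    have ha0 : a ≠ 0 := by omega
    have hb0 : b ≠ 0 := by omega
    have e : ((∑ d ∈ (a * b).divisors, d : ℕ) : ℝ) / (a * b : ℕ) =
        ((∑ d ∈ a.divisors, d : ℕ) / a) * ((∑ d ∈ b.divisors, d : ℕ) / b) := by
      rw [Nat.Coprime.sum_divisors_mul hab]
      push_cast
      rw [div_mul_div_comm]
    rw [e, Real.log_mul (sum_divisors_div_pos ha0).ne' (sum_divisors_div_pos hb0).ne']
    refine (add_le_add (iha ha0) (ihb hb0)).trans ?_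
    have hinter : ∑ q ∈ a.divisors ∩ b.divisors, Λ q * (1 / (q * Real.log q)) = 0 := by
      refine Finset.sum_eq_zero fun q hq => ?_
      rw [Finset.mem_inter, Nat.mem_divisors, Nat.mem_divisors] at hq
      have : q = 1 := Nat.eq_one_of_dvd_coprimes hab hq.1.1 hq.2.1
      simp [this]
    rw [← Finset.sum_union_inter, hinter, add_zero]
    refine Finset.sum_le_sum_of_subset_of_nonneg ?_ fun q _ _ => ?_
    · exact Finset.union_subset (Nat.divisors_subset_of_dvd hn (dvd_mul_right a b))
        (Nat.divisors_subset_of_dvd hn (dvd_mul_left b a))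
    · exact mul_nonneg ArithmeticFunction.vonMangoldt_nonneg
        (div_nonneg zero_le_one (mul_nonneg q.cast_nonneg (Real.log_natCast_nonneg q)))

theorem log_sum_divisors_div_le_add {n : ℕ} (hn : n ≠ 0) {c : ℝ} {N : ℕ}
    (h1 : ∀ q ≤ N, 0 ≤ Λ q * (1 / (q * Real.log q) - c))
    (h2 : ∀ q, N < q → Λ q * (1 / (q * Real.log q) - c) ≤ 0) :
    Real.log ((∑ d ∈ n.divisors, d : ℕ) / n) ≤
      ∑ q ∈ Finset.range (N + 1), Λ q * (1 / (q * Real.log q) - c) + c * Real.log n := by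
  refine (log_sum_divisors_div_le hn).trans ?_
  rw [← ArithmeticFunction.vonMangoldt_sum, Finset.mul_sum, ← sub_le_iff_le_add,
    ← Finset.sum_sub_distrib]
  have e : ∑ q ∈ n.divisors, (Λ q * (1 / (q * Real.log q)) - c * Λ q) =
      ∑ q ∈ n.divisors, Λ q * (1 / (q * Real.log q) - c) :=
    Finset.sum_congr rfl fun q _ => by ring
  rw [e, ← Finset.sum_filter_add_sum_filter_not n.divisors (· ≤ N)]
  have hneg : ∑ q ∈ n.divisors with ¬ q ≤ N, Λ q * (1 / (q * Real.log q) - c) ≤ 0 :=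
    Finset.sum_nonpos fun q hq => h2 q (not_le.1 (Finset.mem_filter.1 hq).2)
  have hpos : ∑ q ∈ n.divisors with q ≤ N, Λ q * (1 / (q * Real.log q) - c) ≤
      ∑ q ∈ Finset.range (N + 1), Λ q * (1 / (q * Real.log q) - c) := by
    refine Finset.sum_le_sum_of_subset_of_nonneg (fun q hq => ?_) fun q hq _ => ?_
    · exact Finset.mem_range.2 (Nat.lt_succ_of_le (Finset.mem_filter.1 hq).2)
    · exact h1 q (Nat.lt_succ_iff.1 (Finset.mem_range.1 hq))
  linarith

theorem vonMangoldt_mul_sub_nonneg {c : ℝ} {q : ℕ} (h : c * (q * Real.log q) ≤ 1) :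
    0 ≤ Λ q * (1 / (q * Real.log q) - c) := by
  rcases le_or_gt q 1 with hq | hq
  · interval_cases q <;> simp
  · have hq' : (1 : ℝ) < q := by exact_mod_cast hq
    have hl := Real.log_pos hq'
    refine mul_nonneg ArithmeticFunction.vonMangoldt_nonneg (sub_nonneg.2 ?_)
    rwa [le_div_iff₀ (by positivity)]

theorem vonMangoldt_mul_sub_nonpos {c : ℝ} {q : ℕ} (h : 1 ≤ c * (q * Real.log q)) :
    Λ q * (1 / (q * Real.log q) - c) ≤ 0 := by
  rcases le_or_gt q 1 with hq | hq
  · interval_cases q <;> simp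
  · have hq' : (1 : ℝ) < q := by exact_mod_cast hq
    have hl := Real.log_pos hq'
    refine mul_nonpos_of_nonneg_of_nonpos ArithmeticFunction.vonMangoldt_nonneg (sub_nonpos.2 ?_)
    rwa [div_le_iff₀ (by positivity)]

theorem mul_log_mono {x y : ℝ} (hx : 1 ≤ x) (hxy : x ≤ y) : x * Real.log x ≤ y * Real.log y :=
  mul_le_mul hxy (Real.log_le_log (by linarith) hxy) (Real.log_nonneg hx) (by linarith)

theorem log_sum_divisors_div_le_mertensMean {n : ℕ} {u : ℝ} (hu : 0 < u)
    (hn : Real.log n = Real.exp u) :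
    Real.log ((∑ d ∈ n.divisors, d : ℕ) / n) ≤ mertensMean u := by
  have hn0 : n ≠ 0 := by
    rintro rfl
    have := Real.exp_pos u
    simp at hn
    linarith
  have hE : 1 < Real.exp u := Real.one_lt_exp_iff.2 hu
  have hE0 : 0 < u * Real.exp u := by positivity
  have hEl : Real.exp u * Real.log (Real.exp u) = u * Real.exp u := by
    rw [Real.log_exp, mul_comm]
  have h := log_sum_divisors_div_le_add hn0 (c := 1 / (u * Real.exp u)) (N := ⌊Real.exp u⌋₊)
    (fun q hq => vonMangoldt_mul_sub_nonneg ?_) (fun q hq => vonMangoldt_mul_sub_nonpos ?_)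
  · rw [hn] at h
    rw [mertensMean]
    refine h.trans_eq ?_
    congr 1
    field_simp
  · rw [one_div, inv_mul_le_iff₀ hE0, mul_one, ← hEl]
    rcases Nat.eq_zero_or_pos q with rfl | hq0
    · simp only [Nat.cast_zero, zero_mul]; rw [hEl]; exact hE0.le
    · exact mul_log_mono (by exact_mod_cast hq0) ((Nat.le_floor_iff (by positivity)).1 hq)
  · rw [one_div, le_inv_mul_iff₀ hE0, mul_one, ← hEl]
    exact mul_log_mono hE.le (Nat.lt_of_floor_lt hq).le

theorem exp_le_taylor_pow {x : ℝ} (h0 : 0 ≤ x) (h4 : x ≤ 4) :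
    Real.exp x ≤ (∑ m ∈ Finset.range 9, (x / 4) ^ m / (m.factorial : ℝ) +
      (x / 4) ^ 9 * (9 + 1) / (Nat.factorial 9 * 9)) ^ 4 := by
  have h := Real.exp_bound' (x := x / 4) (by linarith) (by linarith) (n := 9) (by norm_num)
  have e : Real.exp x = Real.exp (x / 4) ^ 4 := by
    rw [← Real.exp_nat_mul]; congr 1; push_cast; ring
  rw [e]
  exact pow_le_pow_left₀ (Real.exp_pos _).le (by exact_mod_cast h) 4

theorem exp_le_of_taylor_le {x y : ℝ} (h0 : 0 ≤ x) (h4 : x ≤ 4)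
    (h : (∑ m ∈ Finset.range 9, (x / 4) ^ m / (m.factorial : ℝ) +
      (x / 4) ^ 9 * (9 + 1) / (Nat.factorial 9 * 9)) ^ 4 ≤ y) : Real.exp x ≤ y :=
  (exp_le_taylor_pow h0 h4).trans h

theorem log_seven_gt : 1.945 ≤ Real.log 7 :=
  (Real.le_log_iff_exp_le (by norm_num)).2 (exp_le_of_taylor_le (by norm_num) (by norm_num)
    (by norm_num [Finset.sum_range_succ, Nat.factorial]))

theorem log_eleven_gt : 2.397 ≤ Real.log 11 :=
  (Real.le_log_iff_exp_le (by norm_num)).2 (exp_le_of_taylor_le (by norm_num) (by norm_num)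
    (by norm_num [Finset.sum_range_succ, Nat.factorial]))

theorem log_thirteen_gt : 2.564 ≤ Real.log 13 :=
  (Real.le_log_iff_exp_le (by norm_num)).2 (exp_le_of_taylor_le (by norm_num) (by norm_num)
    (by norm_num [Finset.sum_range_succ, Nat.factorial]))

theorem log_seven_lt : Real.log 7 ≤ 1.95 :=
  (Real.log_le_iff_le_exp (by norm_num)).2 (le_trans
    (by norm_num [Finset.sum_range_succ, Nat.factorial])
    (Real.sum_le_exp_of_nonneg (by norm_num) 14))

theorem log_thirteen_lt : Real.log 13 ≤ 2.57 :=
  (Real.log_le_iff_le_exp (by norm_num)).2 (le_trans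
    (by norm_num [Finset.sum_range_succ, Nat.factorial])
    (Real.sum_le_exp_of_nonneg (by norm_num) 16))

theorem exp_eulerMascheroniConstant_gt : 1.777 ≤ Real.exp Real.eulerMascheroniConstant := by
  refine le_trans ?_ (Real.exp_le_exp.2 Real.eulerMascheroniConstant_gt_d4.le)
  exact le_trans (by norm_num [Finset.sum_range_succ, Nat.factorial])
    (Real.sum_le_exp_of_nonneg (by norm_num) 8)

theorem vonMangoldt_pow_mul_sub {p k : ℕ} (hp : p.Prime) (hk : k ≠ 0) (c : ℝ) :
    Λ (p ^ k) * (1 / ((p ^ k : ℕ) * Real.log (p ^ k : ℕ)) - c) =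
      1 / (k * p ^ k) - c * Real.log p := by
  have hp1 : (1 : ℝ) < p := by exact_mod_cast hp.one_lt
  have hlp : 0 < Real.log p := Real.log_pos hp1
  have hk0 : (0 : ℝ) < k := by exact_mod_cast Nat.pos_of_ne_zero hk
  rw [ArithmeticFunction.vonMangoldt_apply_pow hk, ArithmeticFunction.vonMangoldt_apply_prime hp]
  push_cast
  rw [Real.log_pow]
  field_simp

theorem vonMangoldt_mul_eq_zero {a b : ℕ} (hab : a.Coprime b) (ha : a ≠ 1) (hb : b ≠ 1) :
    Λ (a * b) = 0 := by
  rw [ArithmeticFunction.vonMangoldt_eq_zero_iff]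
  intro h
  rcases (Nat.Coprime.isPrimePow_dvd_mul hab h).1 dvd_rfl with h1 | h1
  · exact hb (hab.symm.eq_one_of_dvd ((dvd_mul_left b a).trans h1))
  · exact ha (hab.eq_one_of_dvd ((dvd_mul_right a b).trans h1))

theorem sum_range_six_vonMangoldt (c : ℝ) :
    ∑ q ∈ Finset.range (5 + 1), Λ q * (1 / (q * Real.log q) - c) =
      139 / 120 - c * (2 * Real.log 2 + Real.log 3 + Real.log 5) := by
  have h2 := vonMangoldt_pow_mul_sub Nat.prime_two one_ne_zero c
  have h4 := vonMangoldt_pow_mul_sub Nat.prime_two two_ne_zero c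
  have h3 := vonMangoldt_pow_mul_sub Nat.prime_three one_ne_zero c
  have h5 := vonMangoldt_pow_mul_sub Nat.prime_five one_ne_zero c
  norm_num only [pow_one] at h2 h3 h4 h5
  simp only [Finset.sum_range_succ, Finset.sum_range_zero, Nat.cast_ofNat, Nat.cast_zero,
    Nat.cast_one, ArithmeticFunction.vonMangoldt_apply_one, zero_mul,
    ArithmeticFunction.map_zero]
  linarith

theorem sum_range_eight_vonMangoldt (c : ℝ) :
    ∑ q ∈ Finset.range (7 + 1), Λ q * (1 / (q * Real.log q) - c) =
      1093 / 840 - c * (2 * Real.log 2 + Real.log 3 + Real.log 5 + Real.log 7) := by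
  have h6 : Λ 6 = 0 := vonMangoldt_mul_eq_zero (a := 2) (b := 3) (by norm_num) (by norm_num)
    (by norm_num)
  have h7 := vonMangoldt_pow_mul_sub (p := 7) (by norm_num) one_ne_zero c
  rw [Finset.sum_range_succ, Finset.sum_range_succ, sum_range_six_vonMangoldt, h6, zero_mul]
  norm_num at h7 ⊢
  linarith

theorem sum_range_ten_vonMangoldt (c : ℝ) :
    ∑ q ∈ Finset.range (9 + 1), Λ q * (1 / (q * Real.log q) - c) =
      3524 / 2520 - c * (3 * Real.log 2 + 2 * Real.log 3 + Real.log 5 + Real.log 7) := by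
  have h8 := vonMangoldt_pow_mul_sub Nat.prime_two three_ne_zero c
  have h9 := vonMangoldt_pow_mul_sub Nat.prime_three two_ne_zero c
  rw [Finset.sum_range_succ, Finset.sum_range_succ, sum_range_eight_vonMangoldt]
  norm_num at h8 h9 ⊢
  linarith

theorem sum_range_fourteen_vonMangoldt (c : ℝ) :
    ∑ q ∈ Finset.range (13 + 1), Λ q * (1 / (q * Real.log q) - c) =
      3524 / 2520 + 1 / 11 + 1 / 13 - c * (3 * Real.log 2 + 2 * Real.log 3 + Real.log 5 +
        Real.log 7 + Real.log 11 + Real.log 13) := by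
  have h10 : Λ 10 = 0 := vonMangoldt_mul_eq_zero (a := 2) (b := 5) (by norm_num) (by norm_num)
    (by norm_num)
  have h12 : Λ 12 = 0 := vonMangoldt_mul_eq_zero (a := 4) (b := 3) (by norm_num) (by norm_num)
    (by norm_num)
  have h11 := vonMangoldt_pow_mul_sub (p := 11) (by norm_num) one_ne_zero c
  have h13 := vonMangoldt_pow_mul_sub (p := 13) (by norm_num) one_ne_zero c
  rw [Finset.sum_range_succ, Finset.sum_range_succ, Finset.sum_range_succ,
    Finset.sum_range_succ, sum_range_ten_vonMangoldt, h10, h12, zero_mul, zero_mul]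
  norm_num at h11 h13 ⊢
  linarith

theorem sum_range_seventeen_vonMangoldt (c : ℝ) :
    ∑ q ∈ Finset.range (16 + 1), Λ q * (1 / (q * Real.log q) - c) =
      3524 / 2520 + 1 / 11 + 1 / 13 + 1 / 64 - c * (4 * Real.log 2 + 2 * Real.log 3 +
        Real.log 5 + Real.log 7 + Real.log 11 + Real.log 13) := by
  have h14 : Λ 14 = 0 := vonMangoldt_mul_eq_zero (a := 2) (b := 7) (by norm_num) (by norm_num)
    (by norm_num)
  have h15 : Λ 15 = 0 := vonMangoldt_mul_eq_zero (a := 3) (b := 5) (by norm_num) (by norm_num)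
    (by norm_num)
  have h16 := vonMangoldt_pow_mul_sub Nat.prime_two four_ne_zero c
  rw [Finset.sum_range_succ, Finset.sum_range_succ, Finset.sum_range_succ,
    sum_range_fourteen_vonMangoldt, h14, h15, zero_mul, zero_mul]
  norm_num at h16 ⊢
  linarith

theorem log_sum_divisors_div_le_of_mul_log {n : ℕ} (hn : n ≠ 0) {c : ℝ} (hc : 0 ≤ c) {N : ℕ}
    (h1 : c * (N * Real.log N) ≤ 1)
    (h2 : 1 ≤ c * ((N + 1) * Real.log (N + 1))) :
    Real.log ((∑ d ∈ n.divisors, d : ℕ) / n) ≤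
      ∑ q ∈ Finset.range (N + 1), Λ q * (1 / (q * Real.log q) - c) + c * Real.log n := by
  refine log_sum_divisors_div_le_add hn (fun q hq => vonMangoldt_mul_sub_nonneg ?_)
    (fun q hq => vonMangoldt_mul_sub_nonpos ?_)
  · rcases Nat.eq_zero_or_pos q with rfl | hq0
    · simp
    · exact (mul_le_mul_of_nonneg_left
        (mul_log_mono (by exact_mod_cast hq0) (by exact_mod_cast hq)) hc).trans h1
  · refine h2.trans (mul_le_mul_of_nonneg_left (mul_log_mono ?_ (by exact_mod_cast hq)) hc)
    linarith [(Nat.cast_nonneg N : (0 : ℝ) ≤ N)]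

/-- If `x` is at most an affine function `a + c L` of `L` that satisfies suitable numerical bounds
at the ends of `[L₁, L₂]`, then `exp x` lies below `1.777 log L + 1 / log L` on `[L₁, L₂]`. -/
theorem exp_affine_lt_of_mem_Icc {a c L₁ L₂ v E x L : ℝ} (hx : x ≤ a + c * L) (hL₁ : L₁ ≤ L)
    (hL₂ : L ≤ L₂) (hc : 0 ≤ c) (hL : L₁ < L₂) (hv0 : 0 < v) (hv : Real.exp v ≤ L₁)
    (hE : Real.exp (a + c * L₁) ≤ E) (hv1 : 1 ≤ 1.777 * v ^ 2) (hd : c * (L₂ - L₁) < 1)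
    (h1 : E < 1.777 * v + 1 / v)
    (h2 : E * L₂ < (1 - c * (L₂ - L₁)) * ((1.777 * v + 1 / v) * L₂ +
      (1.777 - 1 / v ^ 2) * (L₂ - L₁))) :
    Real.exp x < 1.777 * Real.log L + 1 / Real.log L := by
  have hL10 : 0 < L₁ := (Real.exp_pos v).trans_le hv
  have hL0 : 0 < L := by linarith
  have hvu : v ≤ Real.log L := (Real.le_log_iff_exp_le hL0).2 (hv.trans hL₁)
  have hvL1 : v ≤ Real.log L₁ := (Real.le_log_iff_exp_le hL10).2 hv
  have huv : 1 - L₁ / L ≤ Real.log L - v := by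
    have h := Real.one_sub_inv_le_log_of_pos (x := L / L₁) (by positivity)
    rw [inv_div, Real.log_div hL0.ne' hL10.ne'] at h
    linarith
  set u := Real.log L with hu
  have hu0 : 0 < u := by linarith
  set φ := 1.777 * v + 1 / v with hφ
  set p := 1.777 - 1 / v ^ 2 with hp
  have hp0 : 0 ≤ p := by
    rw [hp, sub_nonneg, div_le_iff₀ (by positivity)]
    exact hv1
  have hφ0 : 0 < φ := by positivity
  have htan : φ + p * (u - v) ≤ 1.777 * u + 1 / u := by
    have e : 1.777 * u + 1 / u - (φ + p * (u - v)) = (u - v) ^ 2 / (u * v ^ 2) := by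
      rw [hφ, hp]; field_simp; ring
    have : 0 ≤ (u - v) ^ 2 / (u * v ^ 2) := by positivity
    linarith
  have hden : 0 < 1 - c * (L - L₁) := by nlinarith
  have hexp : Real.exp x ≤ E / (1 - c * (L - L₁)) := by
    have h3 : Real.exp (c * (L - L₁)) ≤ 1 / (1 - c * (L - L₁)) := by
      have h := Real.one_sub_le_exp_neg (c * (L - L₁))
      rw [Real.exp_neg] at h
      rw [one_div]
      exact (le_inv_comm₀ hden (Real.exp_pos _)).1 h
    calc Real.exp x ≤ Real.exp (a + c * L₁) * Real.exp (c * (L - L₁)) := by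
          rw [← Real.exp_add]; exact Real.exp_le_exp.2 (by linarith)
      _ ≤ E * (1 / (1 - c * (L - L₁))) :=
          mul_le_mul hE h3 (Real.exp_pos _).le ((Real.exp_pos _).le.trans hE)
      _ = _ := by ring
  have hquad : E * L < (1 - c * (L - L₁)) * (φ * L + p * (L - L₁)) := by
    have e : (L₂ - L₁) * ((1 - c * (L - L₁)) * (φ * L + p * (L - L₁)) - E * L) =
        (L₂ - L) * (L₁ * (φ - E)) +
        (L - L₁) * ((1 - c * (L₂ - L₁)) * (φ * L₂ + p * (L₂ - L₁)) - E * L₂) +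
        c * (φ + p) * (L - L₁) * (L₂ - L) * (L₂ - L₁) := by ring
    have t1 : 0 ≤ c * (φ + p) * (L - L₁) * (L₂ - L) * (L₂ - L₁) := by
      have := sub_nonneg.2 hL₁
      have := sub_nonneg.2 hL₂
      have := sub_pos.2 hL
      positivity
    have t2 : 0 < (L₂ - L) * (L₁ * (φ - E)) +
        (L - L₁) * ((1 - c * (L₂ - L₁)) * (φ * L₂ + p * (L₂ - L₁)) - E * L₂) := by
      have q1 : 0 < L₁ * (φ - E) := mul_pos hL10 (sub_pos.2 h1)
      have q2 := sub_pos.2 h2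
      rcases hL₂.lt_or_eq with hlt | heq
      · exact add_pos_of_pos_of_nonneg (mul_pos (sub_pos.2 hlt) q1)
          (mul_nonneg (sub_nonneg.2 hL₁) q2.le)
      · rw [heq, sub_self, zero_mul, zero_add]
        exact mul_pos (sub_pos.2 hL) q2
    have := pos_of_mul_pos_right (e ▸ add_pos_of_pos_of_nonneg t2 t1) (sub_pos.2 hL).le
    linarith
  refine (hexp.trans_lt ?_).trans_le
    ((add_le_add_right (mul_le_mul_of_nonneg_left huv hp0) φ).trans htan)
  rw [div_lt_iff₀ hden]
  have e2 : φ + p * (1 - L₁ / L) = (φ * L + p * (L - L₁)) / L := by field_simp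
  rw [e2, div_mul_eq_mul_div, lt_div_iff₀ hL0]
  linarith

theorem sum_divisors_div_lt_of_log_le {n : ℕ} (hn : 3 ≤ n) (hL : Real.log n ≤ 16.1) :
    ((∑ d ∈ n.divisors, d : ℕ) : ℝ) / n <
      1.777 * Real.log (Real.log n) + 1 / Real.log (Real.log n) := by
  have hn0 : n ≠ 0 := by omega
  have hn0' : (0 : ℝ) < n := by exact_mod_cast Nat.pos_of_ne_zero hn0
  have hσ : (0 : ℝ) < (∑ d ∈ n.divisors, d : ℕ) / n := sum_divisors_div_pos hn0
  have l2 := Real.log_two_gt_d9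
  have l2' := Real.log_two_lt_d9
  have l3 := Real.log_three_gt_d9
  have l3' := Real.log_three_lt_d9
  have l5 := Real.log_five_gt_d9
  have l5' := Real.log_five_lt_d9
  have l7 := log_seven_gt
  have l7' := log_seven_lt
  have l11 := log_eleven_gt
  have l13 := log_thirteen_gt
  have l13' := log_thirteen_lt
  have l6 : Real.log 6 = Real.log 2 + Real.log 3 := by
    rw [← Real.log_mul (by norm_num) (by norm_num)]; norm_num
  have l8 : Real.log 8 = 3 * Real.log 2 := by
    rw [show (8 : ℝ) = 2 ^ 3 by norm_num, Real.log_pow]; norm_num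
  have l9 : Real.log 9 = 2 * Real.log 3 := by
    rw [show (9 : ℝ) = 3 ^ 2 by norm_num, Real.log_pow]; norm_num
  have l10 : Real.log 10 = Real.log 2 + Real.log 5 := by
    rw [← Real.log_mul (by norm_num) (by norm_num)]; norm_num
  have l14 : Real.log 14 = Real.log 2 + Real.log 7 := by
    rw [← Real.log_mul (by norm_num) (by norm_num)]; norm_num
  have l16 : Real.log 16 = 4 * Real.log 2 := by
    rw [show (16 : ℝ) = 2 ^ 4 by norm_num, Real.log_pow]; norm_num
  have l17 : Real.log 16 ≤ Real.log 17 := Real.log_le_log (by norm_num) (by norm_num)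
  have hL3 : Real.log 3 ≤ Real.log n := Real.log_le_log (by norm_num) (by exact_mod_cast hn)
  rw [← Real.exp_log hσ]
  set x := Real.log ((∑ d ∈ n.divisors, d : ℕ) / n) with hx
  set L := Real.log n with hLdef
  have h1 : x ≤ 0.6499 + 0.1242 * L := by
    have h := log_sum_divisors_div_le_of_mul_log hn0 (c := 0.1242) (by norm_num) (N := 5)
      (by push_cast; linarith) (by push_cast; norm_num only; linarith)
    rw [sum_range_six_vonMangoldt] at h
    linarith
  have h2 : x ≤ 0.7772 + 0.0931 * L := by
    have h := log_sum_divisors_div_le_of_mul_log hn0 (c := 0.0931) (by norm_num) (N := 5)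
      (by push_cast; linarith) (by push_cast; norm_num only; linarith)
    rw [sum_range_six_vonMangoldt] at h
    linarith
  have h3 : x ≤ 0.861 + 0.073 * L := by
    have h := log_sum_divisors_div_le_of_mul_log hn0 (c := 0.073) (by norm_num) (N := 7)
      (by push_cast; linarith) (by push_cast; norm_num only; linarith)
    rw [sum_range_eight_vonMangoldt] at h
    linarith
  have h4 : x ≤ 1.0073 + 0.05 * L := by
    have h := log_sum_divisors_div_le_of_mul_log hn0 (c := 0.05) (by norm_num) (N := 9)
      (by push_cast; linarith) (by push_cast; norm_num only; linarith)
    rw [sum_range_ten_vonMangoldt] at h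
    linarith
  have h5 : x ≤ 1.184 + 0.0299 * L := by
    have h := log_sum_divisors_div_le_of_mul_log hn0 (c := 0.0299) (by norm_num) (N := 13)
      (by push_cast; linarith) (by push_cast; norm_num only; linarith)
    rw [sum_range_fourteen_vonMangoldt] at h
    linarith
  have h6 : x ≤ 1.2921 + 0.0215 * L := by
    have h := log_sum_divisors_div_le_of_mul_log hn0 (c := 0.0215) (by norm_num) (N := 16)
      (by push_cast; linarith) (by push_cast; norm_num only; linarith)
    rw [sum_range_seventeen_vonMangoldt] at h
    linarith
  rcases le_or_gt L 2.4 with g | g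
  · have hu : 0 < Real.log L := Real.log_pos (by linarith)
    have hexp : Real.exp x ≤ 2.6 :=
      (Real.exp_le_exp.2 (by linarith : x ≤ 0.95)).trans (exp_le_of_taylor_le (by norm_num)
        (by norm_num) (by norm_num [Finset.sum_range_succ, Nat.factorial]))
    have h2 : 2.6 < 1.777 * Real.log L + 1 / Real.log L := by
      rw [← sub_pos]
      have e : 1.777 * Real.log L + 1 / Real.log L - 2.6 =
          (1.777 * Real.log L ^ 2 - 2.6 * Real.log L + 1) / Real.log L := by
        field_simp; ring
      rw [e]
      exact div_pos (by nlinarith [sq_nonneg (Real.log L - 1.3 / 1.777)]) hu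
    exact hexp.trans_lt h2
  replace g := g.le
  rcases le_or_gt L 3 with k | k
  · exact exp_affine_lt_of_mem_Icc h1 (L₁ := 2.4) (L₂ := 3) (v := 0.8754) (E := 2.5806) g k
      (by norm_num) (by norm_num) (by norm_num)
      (exp_le_of_taylor_le (by norm_num) (by norm_num)
        (by norm_num [Finset.sum_range_succ, Nat.factorial]))
      (exp_le_of_taylor_le (by norm_num) (by norm_num)
        (by norm_num [Finset.sum_range_succ, Nat.factorial]))
      (by norm_num) (by norm_num) (by norm_num) (by norm_num)
  replace g := k.le
  rcases le_or_gt L 3.6 with k | k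
  · exact exp_affine_lt_of_mem_Icc h1 (L₁ := 3) (L₂ := 3.6) (v := 1.0985) (E := 2.7802) g k
      (by norm_num) (by norm_num) (by norm_num)
      (exp_le_of_taylor_le (by norm_num) (by norm_num)
        (by norm_num [Finset.sum_range_succ, Nat.factorial]))
      (exp_le_of_taylor_le (by norm_num) (by norm_num)
        (by norm_num [Finset.sum_range_succ, Nat.factorial]))
      (by norm_num) (by norm_num) (by norm_num) (by norm_num)
  replace g := k.le
  rcases le_or_gt L 4.2 with k | k
  · exact exp_affine_lt_of_mem_Icc h2 (L₁ := 3.6) (L₂ := 4.2) (v := 1.2808) (E := 3.0416) g k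
      (by norm_num) (by norm_num) (by norm_num)
      (exp_le_of_taylor_le (by norm_num) (by norm_num)
        (by norm_num [Finset.sum_range_succ, Nat.factorial]))
      (exp_le_of_taylor_le (by norm_num) (by norm_num)
        (by norm_num [Finset.sum_range_succ, Nat.factorial]))
      (by norm_num) (by norm_num) (by norm_num) (by norm_num)
  replace g := k.le
  rcases le_or_gt L 4.9 with k | k
  · exact exp_affine_lt_of_mem_Icc h3 (L₁ := 4.2) (L₂ := 4.9) (v := 1.435) (E := 3.2144) g k
      (by norm_num) (by norm_num) (by norm_num)
      (exp_le_of_taylor_le (by norm_num) (by norm_num)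
        (by norm_num [Finset.sum_range_succ, Nat.factorial]))
      (exp_le_of_taylor_le (by norm_num) (by norm_num)
        (by norm_num [Finset.sum_range_succ, Nat.factorial]))
      (by norm_num) (by norm_num) (by norm_num) (by norm_num)
  replace g := k.le
  rcases le_or_gt L 5.7 with k | k
  · exact exp_affine_lt_of_mem_Icc h3 (L₁ := 4.9) (L₂ := 5.7) (v := 1.5891) (E := 3.3829) g k
      (by norm_num) (by norm_num) (by norm_num)
      (exp_le_of_taylor_le (by norm_num) (by norm_num)
        (by norm_num [Finset.sum_range_succ, Nat.factorial]))
      (exp_le_of_taylor_le (by norm_num) (by norm_num)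
        (by norm_num [Finset.sum_range_succ, Nat.factorial]))
      (by norm_num) (by norm_num) (by norm_num) (by norm_num)
  replace g := k.le
  rcases le_or_gt L 6.8 with k | k
  · exact exp_affine_lt_of_mem_Icc h4 (L₁ := 5.7) (L₂ := 6.8) (v := 1.7404) (E := 3.6413) g k
      (by norm_num) (by norm_num) (by norm_num)
      (exp_le_of_taylor_le (by norm_num) (by norm_num)
        (by norm_num [Finset.sum_range_succ, Nat.factorial]))
      (exp_le_of_taylor_le (by norm_num) (by norm_num)
        (by norm_num [Finset.sum_range_succ, Nat.factorial]))
      (by norm_num) (by norm_num) (by norm_num) (by norm_num)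
  replace g := k.le
  rcases le_or_gt L 7.7 with k | k
  · exact exp_affine_lt_of_mem_Icc h4 (L₁ := 6.8) (L₂ := 7.7) (v := 1.9168) (E := 3.8472) g k
      (by norm_num) (by norm_num) (by norm_num)
      (exp_le_of_taylor_le (by norm_num) (by norm_num)
        (by norm_num [Finset.sum_range_succ, Nat.factorial]))
      (exp_le_of_taylor_le (by norm_num) (by norm_num)
        (by norm_num [Finset.sum_range_succ, Nat.factorial]))
      (by norm_num) (by norm_num) (by norm_num) (by norm_num)
  replace g := k.le
  rcases le_or_gt L 11.15 with k | k
  · exact exp_affine_lt_of_mem_Icc h5 (L₁ := 7.7) (L₂ := 11.15) (v := 2.0411) (E := 4.1135) g k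
      (by norm_num) (by norm_num) (by norm_num)
      (exp_le_of_taylor_le (by norm_num) (by norm_num)
        (by norm_num [Finset.sum_range_succ, Nat.factorial]))
      (exp_le_of_taylor_le (by norm_num) (by norm_num)
        (by norm_num [Finset.sum_range_succ, Nat.factorial]))
      (by norm_num) (by norm_num) (by norm_num) (by norm_num)
  replace g := k.le
  rcases le_or_gt L 16.1 with k | k
  · exact exp_affine_lt_of_mem_Icc h6 (L₁ := 11.15) (L₂ := 16.1) (v := 2.4113) (E := 4.6268) g k
      (by norm_num) (by norm_num) (by norm_num)
      (exp_le_of_taylor_le (by norm_num) (by norm_num)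
        (by norm_num [Finset.sum_range_succ, Nat.factorial]))
      (exp_le_of_taylor_le (by norm_num) (by norm_num)
        (by norm_num [Finset.sum_range_succ, Nat.factorial]))
      (by norm_num) (by norm_num) (by norm_num) (by norm_num)
  replace g := k.le
  linarith

/-- Robin's bound: for `n ≥ 3`, `σ(n) < e^γ n log log n + n / log log n`. -/
theorem robin_sigma_bound (n : ℕ) (hn : 3 ≤ n) :
    ((∑ d ∈ n.divisors, d : ℕ) : ℝ) <
      Real.exp Real.eulerMascheroniConstant * n * Real.log (Real.log n) +
        n / Real.log (Real.log n) := by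
  have hn0 : n ≠ 0 := by omega
  have hn0' : (0 : ℝ) < n := by exact_mod_cast Nat.pos_of_ne_zero hn0
  have hL : 1 < Real.log n := by
    have h3 : Real.log 3 ≤ Real.log n := Real.log_le_log (by norm_num) (by exact_mod_cast hn)
    linarith [Real.log_three_gt_d9]
  set u := Real.log (Real.log n) with hu
  have hu0 : 0 < u := Real.log_pos hL
  suffices h : ((∑ d ∈ n.divisors, d : ℕ) : ℝ) / n <
      Real.exp Real.eulerMascheroniConstant * u + 1 / u by
    rw [div_lt_iff₀ hn0'] at h
    refine h.trans_eq ?_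
    ring
  rcases le_or_gt (Real.log n) 16.1 with h16 | h16
  · refine (sum_divisors_div_lt_of_log_le hn h16).trans_le ?_
    gcongr
    exact exp_eulerMascheroniConstant_gt
  · have hexp : Real.exp u = Real.log n := Real.exp_log (by linarith)
    have hu1 : 2.77 ≤ u := by
      rw [hu, Real.le_log_iff_exp_le (by linarith)]
      refine le_trans (exp_le_of_taylor_le (by norm_num) (by norm_num) ?_) h16.le
      norm_num [Finset.sum_range_succ, Nat.factorial]
    have h := (log_sum_divisors_div_le_mertensMean hu0 hexp.symm).trans_lt (mertensMean_lt hu1)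
    have hσ : (0 : ℝ) < (∑ d ∈ n.divisors, d : ℕ) / n := sum_divisors_div_pos hn0
    exact (Real.log_lt_log_iff hσ (by positivity)).1 h
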